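/- Let g ≥ 4 and let D ≥ 1 be an integer. Then the second integral group homology of the finite symplectic group Sp(2g, Z/DZ) satisfies: H₂(Sp(2g, Z/DZ)) ≅ Z/2Z if D ≡ 0 (mod 4), and H₂(Sp(2g, Z/DZ)) = 0 otherwise. -/

import Mathlib

noncomputable section

namespace GpH2

open Finsupp

variable (G : Type) [Group G]

/-- Second boundary map of the bar complex: `(g,h) ↦ [h] - [gh] + [g]`. -/
def d2 : ((G × G) →₀ ℤ) →ₗ[ℤ] (G →₀ ℤ) :=
  Finsupp.linearCombination ℤ fun p : G × G =>
    Finsupp.single p.2 1 - Finsupp.single (p.1 * p.2) 1 + Finsupp.single p.1 1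

/-- Third boundary map of the bar complex:
`(g,h,k) ↦ [(h,k)] - [(gh,k)] + [(g,hk)] - [(g,h)]`. -/
def d3 : ((G × G × G) →₀ ℤ) →ₗ[ℤ] ((G × G) →₀ ℤ) :=
  Finsupp.linearCombination ℤ fun t : G × G × G =>
    Finsupp.single (t.2.1, t.2.2) 1 - Finsupp.single (t.1 * t.2.1, t.2.2) 1
      + Finsupp.single (t.1, t.2.1 * t.2.2) 1 - Finsupp.single (t.1, t.2.1) 1

/-- 2-cycles. -/
def Z2 : Submodule ℤ ((G × G) →₀ ℤ) := LinearMap.ker (d2 G)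

/-- 2-boundaries. -/
def B2 : Submodule ℤ ((G × G) →₀ ℤ) := LinearMap.range (d3 G)

/-- The second homology group of `G` with trivial integral coefficients,
defined via the bar resolution as 2-cycles modulo 2-boundaries. -/
abbrev H2 := ↥(Z2 G) ⧸ (B2 G).comap (Z2 G).subtype

variable {G} {H : Type} [Group H]

/-- The map induced on bar 2-chains by a group homomorphism. -/
def C2 (f : G →* H) : ((G × G) →₀ ℤ) →ₗ[ℤ] ((H × H) →₀ ℤ) :=
  Finsupp.lmapDomain ℤ ℤ (Prod.map f f)

def C1 (f : G →* H) : (G →₀ ℤ) →ₗ[ℤ] (H →₀ ℤ) :=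
  Finsupp.lmapDomain ℤ ℤ f

def C3 (f : G →* H) : ((G × G × G) →₀ ℤ) →ₗ[ℤ] ((H × H × H) →₀ ℤ) :=
  Finsupp.lmapDomain ℤ ℤ (Prod.map f (Prod.map f f))

@[simp] theorem C2_single (f : G →* H) (p : G × G) (n : ℤ) :
    C2 f (Finsupp.single p n) = Finsupp.single (f p.1, f p.2) n := by
  simp [C2, Finsupp.mapDomain_single, Prod.map]

@[simp] theorem C1_single (f : G →* H) (g : G) (n : ℤ) :
    C1 f (Finsupp.single g n) = Finsupp.single (f g) n := by
  simp [C1, Finsupp.mapDomain_single]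

@[simp] theorem C3_single (f : G →* H) (t : G × G × G) (n : ℤ) :
    C3 f (Finsupp.single t n) = Finsupp.single (f t.1, f t.2.1, f t.2.2) n := by
  simp [C3, Finsupp.mapDomain_single, Prod.map]

theorem d2_comm (f : G →* H) : (d2 H).comp (C2 f) = (C1 f).comp (d2 G) := by
  refine Finsupp.lhom_ext fun p n => ?_
  simp only [LinearMap.comp_apply, C2_single, d2, Finsupp.linearCombination_single,
    map_smul, map_sub, map_add, C1_single, map_mul]

theorem d3_comm (f : G →* H) : (d3 H).comp (C3 f) = (C2 f).comp (d3 G) := by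
  refine Finsupp.lhom_ext fun t n => ?_
  simp only [LinearMap.comp_apply, C3_single, d3, Finsupp.linearCombination_single,
    map_smul, map_sub, map_add, C2_single, map_mul]

theorem C2_mem_Z2 (f : G →* H) : ∀ x ∈ Z2 G, C2 f x ∈ Z2 H := by
  intro x hx
  have := congrArg (fun φ => φ x) (d2_comm f)
  simp only [LinearMap.comp_apply] at this
  simp only [Z2, LinearMap.mem_ker] at hx ⊢
  rw [this, hx, map_zero]

/-- The map induced by a group homomorphism on second homology. -/
def H2Map (f : G →* H) : H2 G →ₗ[ℤ] H2 H :=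
  Submodule.mapQ _ _ ((C2 f).restrict (C2_mem_Z2 f)) (by
    rintro ⟨x, hxZ⟩ hx
    simp only [Submodule.mem_comap, Submodule.subtype_apply] at hx ⊢
    simp only [LinearMap.restrict_apply]
    obtain ⟨w, hw⟩ := hx
    have := congrArg (fun φ => φ w) (d3_comm f)
    simp only [LinearMap.comp_apply] at this
    exact ⟨C3 f w, by rw [this, hw]⟩)

end GpH2



open Matrix

/-- The symplectic group `Sp(2g, R)`: matrices `M` (of size `2g`) with `Mᵀ * J * M = J`,
where `J` is the standard symplectic form (see `SymplecticGroup.mem_iff'`). -/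
abbrev Sp (g : ℕ) (R : Type) [CommRing R] : Submonoid (Matrix (Fin g ⊕ Fin g) (Fin g ⊕ Fin g) R) :=
  Matrix.symplecticGroup (Fin g) R

namespace SpAux

variable {g : ℕ} {R S : Type} [CommRing R] [CommRing S]

theorem J_map (f : R →+* S) : (Matrix.J (Fin g) R).map f = Matrix.J (Fin g) S := by
  ext i j
  rcases i with i | i <;> rcases j with j | j <;>
    simp [Matrix.J, Matrix.fromBlocks, Matrix.one_apply, apply_ite f]

theorem map_mem (f : R →+* S) {A : Matrix (Fin g ⊕ Fin g) (Fin g ⊕ Fin g) R}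
    (hA : A ∈ Sp g R) : A.map f ∈ Sp g S := by
  rw [SymplecticGroup.mem_iff] at hA ⊢
  rw [← J_map f, ← Matrix.transpose_map, ← Matrix.map_mul, ← Matrix.map_mul, hA]

/-- The homomorphism `Sp(2g, R) → Sp(2g, S)` induced by a ring homomorphism `R → S`
(entrywise application). -/
def SpMap (f : R →+* S) (g : ℕ) : Sp g R →* Sp g S where
  toFun A := ⟨Matrix.map A.1 f, map_mem f A.2⟩
  map_one' := Subtype.ext <| by
    show ((1 : Matrix _ _ R)).map f = (1 : Matrix _ _ S)
    exact Matrix.map_one f (map_zero f) (map_one f)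
  map_mul' A B := Subtype.ext <| by
    show Matrix.map (A.1 * B.1) f = Matrix.map A.1 f * Matrix.map B.1 f
    exact Matrix.map_mul

end SpAux

set_option linter.unusedSectionVars false

namespace SpH2

section Vectors

variable {l R : Type} [Fintype l] [DecidableEq l] [CommRing R]

/-- The standard symplectic form. -/
def om (u v : l ⊕ l → R) : R := ∑ i, (u (.inl i) * v (.inr i) - u (.inr i) * v (.inl i))

/-- The basis vector `e i`. -/
def ve (R : Type) [CommRing R] (i : l) : l ⊕ l → R := Pi.single (.inl i) 1

/-- The basis vector `f i`, dual to `e i`. -/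
def vf (R : Type) [CommRing R] (i : l) : l ⊕ l → R := Pi.single (.inr i) 1

theorem om_add_left (u u' v : l ⊕ l → R) : om (u + u') v = om u v + om u' v := by
  simp only [om, ← Finset.sum_add_distrib, Pi.add_apply]
  exact Finset.sum_congr rfl fun i _ => by ring

theorem om_smul_left (c : R) (u v : l ⊕ l → R) : om (c • u) v = c * om u v := by
  simp only [om, Finset.mul_sum, Pi.smul_apply, smul_eq_mul]
  exact Finset.sum_congr rfl fun i _ => by ring

theorem om_swap (u v : l ⊕ l → R) : om v u = -om u v := by
  simp only [om, ← Finset.sum_neg_distrib]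
  exact Finset.sum_congr rfl fun i _ => by ring

theorem om_add_right (u v v' : l ⊕ l → R) : om u (v + v') = om u v + om u v' := by
  rw [om_swap, om_add_left, om_swap v, om_swap v']; ring

theorem om_smul_right (c : R) (u v : l ⊕ l → R) : om u (c • v) = c * om u v := by
  rw [om_swap, om_smul_left, om_swap v]; ring

@[simp] theorem om_self (u : l ⊕ l → R) : om u u = 0 := by
  simp only [om]
  exact Finset.sum_eq_zero fun i _ => by ring

theorem om_neg_left (u v : l ⊕ l → R) : om (-u) v = -om u v := by
  rw [← neg_one_smul R, om_smul_left]; ring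

theorem om_sub_left (u u' v : l ⊕ l → R) : om (u - u') v = om u v - om u' v := by
  rw [sub_eq_add_neg, om_add_left, om_neg_left]; ring

@[simp] theorem om_ve_left (i : l) (v : l ⊕ l → R) : om (ve R i) v = v (.inr i) := by
  simp [om, ve, Pi.single_apply]

@[simp] theorem om_vf_left (i : l) (v : l ⊕ l → R) : om (vf R i) v = -v (.inl i) := by
  simp [om, vf, Pi.single_apply]

@[simp] theorem om_ve_right (i : l) (v : l ⊕ l → R) : om v (ve R i) = -v (.inr i) := by
  rw [om_swap, om_ve_left]

@[simp] theorem om_vf_right (i : l) (v : l ⊕ l → R) : om v (vf R i) = v (.inl i) := by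
  rw [om_swap, om_vf_left, neg_neg]

@[simp] theorem ve_inl (i j : l) : ve R i (.inl j) = if j = i then 1 else 0 := by
  simp [ve, Pi.single_apply]
@[simp] theorem ve_inr (i j : l) : ve R i (.inr j) = 0 := by simp [ve]
@[simp] theorem vf_inr (i j : l) : vf R i (.inr j) = if j = i then 1 else 0 := by
  simp [vf, Pi.single_apply]
@[simp] theorem vf_inl (i j : l) : vf R i (.inl j) = 0 := by simp [vf]

theorem om_eq_dot (u v : l ⊕ l → R) : om u v = -(u ⬝ᵥ (J l R *ᵥ v)) := by
  simp only [om, J, Matrix.fromBlocks_mulVec, dotProduct, Fintype.sum_sum_type]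
  simp [Matrix.neg_mulVec]
  abel

theorem om_mulVec (M : Matrix (l ⊕ l) (l ⊕ l) R) (u v : l ⊕ l → R) :
    om (M *ᵥ u) (M *ᵥ v) = -(u ⬝ᵥ ((Mᵀ * J l R * M) *ᵥ v)) := by
  rw [om_eq_dot, ← Matrix.vecMul_transpose, ← Matrix.dotProduct_mulVec]
  simp only [Matrix.mulVec_mulVec, Matrix.mul_assoc]

/-- The natural action of the symplectic group on vectors. -/
def ac : symplecticGroup l R →* Module.End R (l ⊕ l → R) where
  toFun M := Matrix.mulVecLin M.1
  map_one' := by simp; rfl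
  map_mul' M N := by
    ext1; simp [Matrix.mulVecLin_mul, Module.End.mul_eq_comp]

theorem ac_def (M : symplecticGroup l R) (v : l ⊕ l → R) : ac M v = M.1 *ᵥ v := rfl

theorem ac_mul (M N : symplecticGroup l R) (v : l ⊕ l → R) : ac (M * N) v = ac M (ac N v) := by
  rw [map_mul]; rfl

@[simp] theorem ac_one (v : l ⊕ l → R) : ac (1 : symplecticGroup l R) v = v := by
  rw [map_one]; rfl

@[simp] theorem ac_inv_ac (M : symplecticGroup l R) (v : l ⊕ l → R) : ac M⁻¹ (ac M v) = v := by
  rw [← ac_mul, inv_mul_cancel, ac_one]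

@[simp] theorem ac_ac_inv (M : symplecticGroup l R) (v : l ⊕ l → R) : ac M (ac M⁻¹ v) = v := by
  rw [← ac_mul, mul_inv_cancel, ac_one]

theorem ac_inv_eq {M : symplecticGroup l R} {v w : l ⊕ l → R} (h : ac M v = w) : ac M⁻¹ w = v := by
  rw [← h, ac_inv_ac]

@[simp] theorem om_ac (M : symplecticGroup l R) (u v : l ⊕ l → R) :
    om (ac M u) (ac M v) = om u v := by
  rw [ac_def, ac_def, om_mulVec, SymplecticGroup.mem_iff'.1 M.2, om_eq_dot]

theorem om_ac_left (M : symplecticGroup l R) (u v : l ⊕ l → R) :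
    om (ac M u) v = om u (ac M⁻¹ v) := by
  rw [← om_ac M u, ac_ac_inv]

theorem sp_ext {M N : symplecticGroup l R} (h : ∀ v, ac M v = ac N v) : M = N := by
  apply Subtype.ext
  apply Matrix.ext_of_mulVec_single
  intro i
  exact h _

/-- Coordinate expansion of a vector. -/
theorem vec_eq_sum (v : l ⊕ l → R) :
    v = ∑ i, (v (.inl i) • ve R i + v (.inr i) • vf R i) := by
  ext (j | j) <;> simp [Finset.sum_apply]

theorem sp_ext_basis {M N : symplecticGroup l R} (he : ∀ i, ac M (ve R i) = ac N (ve R i))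
    (hf : ∀ i, ac M (vf R i) = ac N (vf R i)) : M = N := by
  apply sp_ext
  intro v
  rw [vec_eq_sum v]
  simp [he, hf]

/-- Symplectic group element from a form preserving endomorphism. -/
def ofLin (φ : Module.End R (l ⊕ l → R)) (h : ∀ u v, om (φ u) (φ v) = om u v) :
    symplecticGroup l R :=
  ⟨LinearMap.toMatrix' φ, by
    rw [SymplecticGroup.mem_iff']
    apply Matrix.ext_of_mulVec_single
    intro j
    ext i
    have h1 := h (Pi.single i 1) (Pi.single j 1)
    rw [← LinearMap.toMatrix'_mulVec φ, ← LinearMap.toMatrix'_mulVec φ, om_mulVec, om_eq_dot,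
      neg_inj] at h1
    simpa using h1⟩

@[simp] theorem ac_ofLin (φ : Module.End R (l ⊕ l → R)) (h : ∀ u v, om (φ u) (φ v) = om u v)
    (v : l ⊕ l → R) : ac (ofLin φ h) v = φ v :=
  LinearMap.toMatrix'_mulVec φ v

/-- The symplectic transvection `x ↦ x + t ω(v,x) v`. -/
def T (v : l ⊕ l → R) (t : R) : symplecticGroup l R :=
  ofLin
    { toFun := fun x => x + (t * om v x) • v
      map_add' := fun x y => by rw [om_add_right]; module
      map_smul' := fun c x => by rw [om_smul_right]; simp only [RingHom.id_apply]; module } (by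
    intro x y
    simp only [LinearMap.coe_mk, AddHom.coe_mk, om_add_left, om_add_right, om_smul_left,
      om_smul_right, om_self, om_swap v x]
    ring)

theorem ac_T (v : l ⊕ l → R) (t : R) (x : l ⊕ l → R) : ac (T v t) x = x + (t * om v x) • v := by
  rw [T, ac_ofLin]; rfl

/-- The Eichler transformation `x ↦ x + t (ω(u,x) v + ω(v,x) u)` for `ω(u,v) = 0`. -/
def EE (u v : l ⊕ l → R) (h : om u v = 0) (t : R) : symplecticGroup l R :=
  ofLin
    { toFun := fun x => x + (t * om u x) • v + (t * om v x) • u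
      map_add' := fun x y => by rw [om_add_right, om_add_right]; module
      map_smul' := fun c x => by
        rw [om_smul_right, om_smul_right]; simp only [RingHom.id_apply]; module } (by
    intro x y
    have h' : om v u = 0 := by rw [om_swap, h, neg_zero]
    simp only [LinearMap.coe_mk, AddHom.coe_mk, om_add_left, om_add_right, om_smul_left,
      om_smul_right, om_self, om_swap v x, om_swap u x, h, h']
    ring)

theorem ac_EE (u v : l ⊕ l → R) (h : om u v = 0) (t : R) (x : l ⊕ l → R) :
    ac (EE u v h t) x = x + (t * om u x) • v + (t * om v x) • u := by
  rw [EE, ac_ofLin]; rfl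

theorem T_conj (M : symplecticGroup l R) (v : l ⊕ l → R) (t : R) :
    M * T v t * M⁻¹ = T (ac M v) t := by
  apply sp_ext
  intro x
  simp only [ac_mul, ac_T, map_add, map_smul, ac_ac_inv, om_ac_left]

theorem EE_conj (M : symplecticGroup l R) (u v : l ⊕ l → R) (h : om u v = 0) (t : R) :
    M * EE u v h t * M⁻¹ = EE (ac M u) (ac M v) (by rwa [om_ac]) t := by
  apply sp_ext
  intro x
  simp only [ac_mul, ac_EE, map_add, map_smul, ac_ac_inv, om_ac_left]

theorem T_add (v : l ⊕ l → R) (s t : R) : T v (s + t) = T v s * T v t := by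
  apply sp_ext
  intro x
  simp only [ac_mul, ac_T, om_add_right, om_smul_right, om_self]
  module

theorem T_zero (v : l ⊕ l → R) : T v 0 = 1 := by
  apply sp_ext
  intro x
  simp [ac_T]

theorem T_pow (v : l ⊕ l → R) (t : R) (n : ℕ) : T v t ^ n = T v (n * t) := by
  induction n with
  | zero => simp [T_zero]
  | succ n ih => rw [pow_succ, ih, ← T_add]; congr 1; push_cast; ring

theorem T_smul (v : l ⊕ l → R) (c t : R) : T (c • v) t = T v (c ^ 2 * t) := by
  apply sp_ext
  intro x
  simp only [ac_T, om_smul_left]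
  module

theorem T_add_vec (u v : l ⊕ l → R) (h : om u v = 0) (t : R) :
    T (u + v) t = T u t * T v t * EE u v h t := by
  have h' : om v u = 0 := by rw [om_swap, h, neg_zero]
  apply sp_ext
  intro x
  simp only [ac_mul, ac_T, ac_EE, om_add_left, om_add_right, om_smul_right, om_self, h, h']
  module

/-- Permutation of the hyperbolic planes. -/
def Pm (R : Type) [CommRing R] (σ : Equiv.Perm l) : symplecticGroup l R :=
  ofLin (LinearMap.funLeft R R (Sum.map σ.symm σ.symm)) (by
    intro u v
    simp only [om, LinearMap.funLeft_apply, Sum.map_inl, Sum.map_inr]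
    exact Equiv.sum_comp σ.symm fun i => u (.inl i) * v (.inr i) - u (.inr i) * v (.inl i))

theorem ac_Pm_ve (σ : Equiv.Perm l) (i : l) : ac (Pm R σ) (ve R i) = ve R (σ i) := by
  rw [Pm, ac_ofLin]
  ext (j | j) <;> simp [LinearMap.funLeft_apply, Equiv.symm_apply_eq]

theorem ac_Pm_vf (σ : Equiv.Perm l) (i : l) : ac (Pm R σ) (vf R i) = vf R (σ i) := by
  rw [Pm, ac_ofLin]
  ext (j | j) <;> simp [LinearMap.funLeft_apply, Equiv.symm_apply_eq]

/-- The flip `e i ↦ f i`, `f i ↦ - e i`. -/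
def Fl (R : Type) [CommRing R] (i : l) : symplecticGroup l R := T (ve R i) (-1) * T (vf R i) (-1) * T (ve R i) (-1)

theorem ac_Fl_ve (i : l) : ac (Fl R i) (ve R i) = vf R i := by
  simp [Fl, ac_T, om_add_right]

theorem ac_Fl_ve_ne {i j : l} (h : i ≠ j) : ac (Fl R i) (ve R j) = ve R j := by
  have h' : j ≠ i := h.symm
  simp [Fl, ac_T, h']

theorem ac_Fl_vf_ne {i j : l} (h : i ≠ j) : ac (Fl R i) (vf R j) = vf R j := by
  have h' : j ≠ i := h.symm
  simp [Fl, ac_T, h']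

/-- The torus element `e i ↦ c e i`, `f i ↦ c⁻¹ f i`. -/
def Ho (i : l) (c : Rˣ) : symplecticGroup l R :=
  ofLin
    { toFun := fun x => x + ((c - 1) * x (.inl i)) • ve R i
        + ((((c⁻¹ : Rˣ) : R) - 1) * x (.inr i)) • vf R i
      map_add' := fun x y => by simp only [Pi.add_apply]; module
      map_smul' := fun c x => by simp only [Pi.smul_apply, smul_eq_mul, RingHom.id_apply]; module } (by
    intro x y
    simp only [LinearMap.coe_mk, AddHom.coe_mk, om_add_left, om_add_right, om_smul_left,
      om_smul_right, om_ve_left, om_ve_right, om_vf_left, om_vf_right, ve_inl, ve_inr, vf_inr, vf_inl, if_true, Pi.add_apply,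
      Pi.smul_apply, smul_eq_mul]
    linear_combination (x (.inl i) * y (.inr i) - x (.inr i) * y (.inl i)) * Units.mul_inv c)

theorem ac_Ho (i : l) (c : Rˣ) (x : l ⊕ l → R) : ac (Ho i c) x = x + ((c - 1) * x (.inl i)) • ve R i
        + ((((c⁻¹ : Rˣ) : R) - 1) * x (.inr i)) • vf R i := by
  rw [Ho, ac_ofLin]; rfl

theorem ac_Ho_ve (i : l) (c : Rˣ) : ac (Ho i c) (ve R i) = (c : R) • ve R i := by
  simp [ac_Ho, sub_smul]

theorem ac_Ho_ve_ne {i j : l} (h : i ≠ j) (c : Rˣ) : ac (Ho i c) (ve R j) = ve R j := by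
  simp [ac_Ho, h]

end Vectors

section Generation

variable {l R : Type} [Fintype l] [DecidableEq l] [CommRing R]

/-- Some coordinate of `v` is a unit. -/
def Uni (v : l ⊕ l → R) : Prop := ∃ j, IsUnit (v j)

/-- `v` is supported on the hyperbolic planes with index in `S`. -/
def Sup (S : Finset l) (v : l ⊕ l → R) : Prop := ∀ i ∉ S, v (.inl i) = 0 ∧ v (.inr i) = 0

/-- The subgroup generated by transvections along unimodular vectors supported on `S`. -/
def Gn (R : Type) [CommRing R] (S : Finset l) : Subgroup (symplecticGroup l R) :=
  Subgroup.closure {M | ∃ v t, Uni v ∧ Sup S v ∧ M = T v t}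

theorem T_mem_Gn {S : Finset l} {v : l ⊕ l → R} (hv : Uni v) (hS : Sup S v) (t : R) :
    T v t ∈ Gn R S := Subgroup.subset_closure ⟨v, t, hv, hS, rfl⟩

theorem Sup.add {S : Finset l} {v w : l ⊕ l → R} (hv : Sup S v) (hw : Sup S w) : Sup S (v + w) :=
  fun i hi => by simp [hv i hi, hw i hi]

theorem Sup.sub {S : Finset l} {v w : l ⊕ l → R} (hv : Sup S v) (hw : Sup S w) : Sup S (v - w) :=
  fun i hi => by simp [hv i hi, hw i hi]

theorem Sup.mono {S S' : Finset l} (h : S ⊆ S') {v : l ⊕ l → R} (hv : Sup S v) : Sup S' v :=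
  fun i hi => hv i fun h' => hi (h h')

theorem sup_ve {S : Finset l} {k : l} (hk : k ∈ S) : Sup S (ve R k) := fun i hi => by
  have : i ≠ k := fun h => hi (h ▸ hk)
  simp [this]

theorem sup_vf {S : Finset l} {k : l} (hk : k ∈ S) : Sup S (vf R k) := fun i hi => by
  have : i ≠ k := fun h => hi (h ▸ hk)
  simp [this]

theorem uni_ve (k : l) : Uni (ve R k) := ⟨.inl k, by simp⟩
theorem uni_vf (k : l) : Uni (vf R k) := ⟨.inr k, by simp⟩

theorem ac_of_mem_Gn {S : Finset l} {N : symplecticGroup l R} (hN : N ∈ Gn R S) {i : l}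
    (hi : i ∉ S) : ac N (ve R i) = ve R i ∧ ac N (vf R i) = vf R i := by
  induction hN using Subgroup.closure_induction with
  | mem x hx => obtain ⟨v, t, -, h2, rfl⟩ := hx; simp [ac_T, h2 i hi]
  | one => simp
  | mul x y _ _ hx hy => simp [hx, hy]
  | inv x _ hx => exact ⟨ac_inv_eq hx.1, ac_inv_eq hx.2⟩

variable [IsLocalRing R]

theorem uni_of_om {u v : l ⊕ l → R} (h : IsUnit (om u v)) : Uni u := by
  by_contra hu
  simp only [Uni, not_exists] at hu
  have : om u v ∈ IsLocalRing.maximalIdeal R := by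
    refine Ideal.sum_mem _ fun i _ => Ideal.sub_mem _ ?_ ?_ <;>
    exact Ideal.mul_mem_right _ _ (hu _)
  exact this h

theorem uni_ac (M : symplecticGroup l R) {v : l ⊕ l → R} (hv : Uni v) : Uni (ac M v) := by
  have : ∃ w, IsUnit (om v w) := by
    obtain ⟨j | j, hj⟩ := hv
    · exact ⟨vf R j, by simpa using hj⟩
    · exact ⟨ve R j, by simpa using hj⟩
  obtain ⟨w, hw⟩ := this
  exact uni_of_om (v := ac M w) (by simpa using hw)

/-- A transvection moving `u` to `w` when `ω(u,w)` is a unit. -/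
theorem exists_move {S : Finset l} {u w : l ⊕ l → R} (hu : Sup S u) (hw : Sup S w)
    (h : IsUnit (om u w)) : ∃ v t, Uni v ∧ Sup S v ∧ ac (T v t) u = w ∧ v = w - u := by
  obtain ⟨c, hc⟩ := h
  refine ⟨w - u, -((c⁻¹ : Rˣ) : R), ?_, hw.sub hu, ?_, rfl⟩
  · apply uni_of_om (v := u)
    rw [om_sub_left, om_self, sub_zero, om_swap, ← hc]
    exact c.isUnit.neg
  · rw [ac_T, om_sub_left, om_self, sub_zero, om_swap, ← hc, neg_mul_neg, Units.inv_mul, one_smul]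
    abel

theorem exists_Gn_ve {S : Finset l} {k : l} (hk : k ∈ S) {w : l ⊕ l → R} (hw : Sup S w)
    (hu : Uni w) : ∃ M ∈ Gn R S, ac M (ve R k) = w := by
  have key : ∀ v, Sup S v → IsUnit (om (ve R k) v) → IsUnit (om v w) →
      ∃ M ∈ Gn R S, ac M (ve R k) = w := by
    intro v hv h1 h2
    obtain ⟨v1, t1, a1, b1, c1, -⟩ := exists_move (sup_ve hk) hv h1
    obtain ⟨v2, t2, a2, b2, c2, -⟩ := exists_move hv hw h2
    exact ⟨T v2 t2 * T v1 t1, mul_mem (T_mem_Gn a2 b2 _) (T_mem_Gn a1 b1 _), by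
      rw [ac_mul, c1, c2]⟩
  by_cases h1 : IsUnit (w (.inr k))
  · obtain ⟨v1, t1, a1, b1, c1, -⟩ := exists_move (sup_ve hk) hw (by simpa using h1)
    exact ⟨_, T_mem_Gn a1 b1 t1, c1⟩
  by_cases h2 : IsUnit (w (.inl k))
  · exact key (vf R k) (sup_vf hk) (by simp) (by simpa using h2)
  have hs : ∀ a : R, IsUnit a → IsUnit (-w (.inl k) + a) := fun a ha => by
    by_contra hcon
    have h3 : a ∈ IsLocalRing.maximalIdeal R := by
      have : a = (-w (.inl k) + a) + w (.inl k) := by ring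
      rw [this]
      exact Ideal.add_mem _ hcon h2
    exact h3 ha
  obtain ⟨j | j, hj⟩ := hu
  · have hjk : k ≠ j := by rintro rfl; exact h2 hj
    have hjS : j ∈ S := by
      by_contra h; rw [(hw j h).1] at hj; exact not_isUnit_zero hj
    refine key (vf R k + vf R j) ((sup_vf hk).add (sup_vf hjS)) (by simp [hjk]) ?_
    rw [om_add_left, om_vf_left, om_vf_left]
    exact hs _ hj.neg
  · have hjk : k ≠ j := by rintro rfl; exact h1 hj
    have hjS : j ∈ S := by
      by_contra h; rw [(hw j h).2] at hj; exact not_isUnit_zero hj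
    refine key (vf R k + ve R j) ((sup_vf hk).add (sup_ve hjS)) (by simp) ?_
    rw [om_add_left, om_vf_left, om_ve_left]
    exact hs _ hj

/-- Transvections generate: an element supported on `S` is a product of transvections along
unimodular vectors supported on `S`. -/
theorem mem_Gn (S : Finset l) : ∀ M : symplecticGroup l R,
    (∀ i ∉ S, ac M (ve R i) = ve R i ∧ ac M (vf R i) = vf R i) → M ∈ Gn R S := by
  induction S using Finset.induction_on with
  | empty =>
    intro M hM
    have : M = 1 := sp_ext_basis (fun i => by simp [hM i]) (fun i => by simp [hM i])
    rw [this]; exact one_mem _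
  | insert k S hkS ih =>
    have hk : k ∈ insert k S := Finset.mem_insert_self _ _
    have mono : Gn R S ≤ Gn R (insert k S) := by
      apply Subgroup.closure_mono
      rintro _ ⟨v, t, h1, h2, rfl⟩
      exact ⟨v, t, h1, h2.mono (Finset.subset_insert _ _), rfl⟩
    have hsup : ∀ M : symplecticGroup l R, (∀ i ∉ insert k S, ac M (ve R i) = ve R i ∧ ac M (vf R i) = vf R i) →
        ∀ v, Sup (insert k S) v → Sup (insert k S) (ac M v) := by
      intro M hM v hv i hi
      have h1 := om_ac M (ve R i) v
      have h2 := om_ac M (vf R i) v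
      rw [(hM i hi).1, om_ve_left, om_ve_left, (hv i hi).2] at h1
      rw [(hM i hi).2, om_vf_left, om_vf_left, (hv i hi).1, neg_zero, neg_eq_zero] at h2
      exact ⟨h2, h1⟩
    have fixT : ∀ v t, Sup (insert k S) v → ∀ i ∉ insert k S,
        ac (T v t) (ve R i) = ve R i ∧ ac (T v t) (vf R i) = vf R i := by
      intro v t hv i hi
      simp [ac_T, hv i hi]
    -- the case where `e k` is fixed
    have step : ∀ M : symplecticGroup l R, (∀ i ∉ insert k S, ac M (ve R i) = ve R i ∧ ac M (vf R i) = vf R i) →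
        ac M (ve R k) = ve R k → IsUnit (ac M (vf R k) (.inl k)) → M ∈ Gn R (insert k S) := by
      intro M hM hMe hu
      have h1 : ac M (vf R k) (.inr k) = 1 := by
        have := om_ac M (ve R k) (vf R k)
        rw [hMe, om_ve_left] at this
        simpa using this
      obtain ⟨v, t, a1, b1, c1, rfl⟩ := exists_move (hsup M hM _ (sup_vf hk)) (sup_vf hk)
        (by simpa using hu)
      have h2 : (T (vf R k - ac M (vf R k)) t) * M ∈ Gn R S := by
        apply ih
        intro i hi
        by_cases hik : i = k
        · subst hik
          rw [ac_mul, ac_mul, c1, hMe]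
          refine ⟨?_, rfl⟩
          simp [ac_T, h1]
        · have hi' : i ∉ insert k S := by simp [hi, hik]
          rw [ac_mul, ac_mul, (hM i hi').1, (hM i hi').2]
          exact fixT _ _ b1 i hi'
      have h3 := mul_mem (inv_mem (T_mem_Gn a1 b1 t)) (mono h2)
      rwa [inv_mul_cancel_left] at h3
    have step2 : ∀ M : symplecticGroup l R, (∀ i ∉ insert k S, ac M (ve R i) = ve R i ∧ ac M (vf R i) = vf R i) →
        ac M (ve R k) = ve R k → M ∈ Gn R (insert k S) := by
      intro M hM hMe
      by_cases hu : IsUnit (ac M (vf R k) (.inl k))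
      · exact step M hM hMe hu
      · have h1 : ac M (vf R k) (.inr k) = 1 := by
          have := om_ac M (ve R k) (vf R k)
          rw [hMe, om_ve_left] at this
          simpa using this
        have h2 := step (T (ve R k) 1 * M) (fun i hi => by
          rw [ac_mul, ac_mul, (hM i hi).1, (hM i hi).2]
          exact fixT _ _ (sup_ve hk) i hi) (by simp [hMe, ac_T]) (by
          simp only [ac_mul, ac_T, om_ve_left, h1, Pi.add_apply, Pi.smul_apply, ve_inl, if_true]
          by_contra hcon
          have h3 : (1 : R) ∈ IsLocalRing.maximalIdeal R := by
            have := Ideal.sub_mem (IsLocalRing.maximalIdeal R) hcon hu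
            simp at this
          exact h3 isUnit_one)
        have h3 := mul_mem (inv_mem (T_mem_Gn (uni_ve k) (sup_ve hk) 1)) h2
        rwa [inv_mul_cancel_left] at h3
    intro M hM
    obtain ⟨N, hN, hNe⟩ := exists_Gn_ve (S := insert k S) hk (hsup M hM _ (sup_ve hk))
      (uni_ac M (uni_ve k))
    have h2 := step2 (N⁻¹ * M) (fun i hi => by
      rw [ac_mul, ac_mul, (hM i hi).1, (hM i hi).2]
      exact ac_of_mem_Gn (inv_mem hN) hi) (by rw [ac_mul, ac_inv_eq hNe])
    have h3 := mul_mem hN h2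
    rwa [mul_inv_cancel_left] at h3

theorem Gn_univ : Gn R (Finset.univ : Finset l) = ⊤ :=
  top_le_iff.1 fun M _ => mem_Gn _ M fun i hi => absurd (Finset.mem_univ i) hi

theorem exists_ac_ve {w : l ⊕ l → R} (k : l) (hw : Uni w) : ∃ M, ac M (ve R k) = w := by
  obtain ⟨M, -, h⟩ := exists_Gn_ve (S := Finset.univ) (Finset.mem_univ k)
    (fun i hi => absurd (Finset.mem_univ i) hi) hw
  exact ⟨M, h⟩

/-- Generation of the stabilizer of `e k`. -/
theorem stab_gen {k m : l} (hkm : k ≠ m) (P : Subgroup (symplecticGroup l R))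
    (h0 : ∀ t, T (ve R k) t ∈ P)
    (h1 : ∀ v t, v (.inr k) = 0 → (∃ v' : l ⊕ l → R, ∃ c : R, Uni v' ∧ Sup (Finset.univ.erase k) v' ∧
      v = c • ve R k + v') → T v t ∈ P)
    (M : symplecticGroup l R) (hM : ac M (ve R k) = ve R k) : M ∈ P := by
  have fin : ∀ M : symplecticGroup l R, ac M (ve R k) = ve R k → ac M (vf R k) = vf R k → M ∈ P := by
    intro M h2 h3
    have h4 := mem_Gn (Finset.univ.erase k) M (by
      intro i hi
      have : i = k := by simpa using hi
      subst this
      exact ⟨h2, h3⟩)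
    refine (Subgroup.closure_le P).2 ?_ h4
    rintro _ ⟨v, t, a, b, rfl⟩
    exact h1 v t (b k (by simp)).2 ⟨v, 0, a, b, by simp⟩
  have dec : ∀ v : l ⊕ l → R, v (.inr k) = 0 →
      Sup (Finset.univ.erase k) (v - v (.inl k) • ve R k) := by
    intro v hv i hi
    have : i = k := by simpa using hi
    subst this
    simp [hv]
  have inr1 : ∀ M : symplecticGroup l R, ac M (ve R k) = ve R k → ac M (vf R k) (.inr k) = 1 := by
    intro M hM
    have := om_ac M (ve R k) (vf R k)
    rw [hM, om_ve_left] at this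
    simpa using this
  -- first coordinate a unit and good rest
  have step1 : ∀ M : symplecticGroup l R, ac M (ve R k) = ve R k →
      IsUnit (ac M (vf R k) (.inl k)) →
      Uni (ac M (vf R k) - vf R k - ac M (vf R k) (.inl k) • ve R k) → M ∈ P := by
    intro M hM hu hy
    set w := ac M (vf R k) with hw
    obtain ⟨v, t, -, -, c1, rfl⟩ := exists_move (S := Finset.univ) (u := w) (w := vf R k)
      (fun i hi => absurd (Finset.mem_univ i) hi) (fun i hi => absurd (Finset.mem_univ i) hi)
      (by simpa using hu)
    have hwk := inr1 M hM
    rw [← hw] at hwk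
    have e1 : T (vf R k - w) t = T (w - vf R k) t := by
      rw [← neg_sub, ← neg_one_smul R, T_smul]; simp
    rw [e1] at c1
    have h2 : T (w - vf R k) t ∈ P := by
      refine h1 _ _ (by simp [hwk]) ⟨_, w (.inl k), hy, ?_, by module⟩
      have := dec (w - vf R k) (by simp [hwk])
      simpa using this
    have h3 := fin (T (w - vf R k) t * M) (by
      rw [ac_mul, hM, ac_T]; simp [hwk]) (by rw [ac_mul, ← hw, c1])
    have h4 := mul_mem (inv_mem h2) h3
    rwa [inv_mul_cancel_left] at h4
  have nonu : ∀ a : R, ¬ IsUnit a → IsUnit (a + 1) := by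
    intro a ha
    by_contra hcon
    have := Ideal.sub_mem (IsLocalRing.maximalIdeal R) hcon ha
    exact this (by simp)
  have step2 : ∀ M : symplecticGroup l R, ac M (ve R k) = ve R k →
      Uni (ac M (vf R k) - vf R k - ac M (vf R k) (.inl k) • ve R k) → M ∈ P := by
    intro M hM hy
    by_cases hu : IsUnit (ac M (vf R k) (.inl k))
    · exact step1 M hM hu hy
    have hwk := inr1 M hM
    have e1 : ac (T (ve R k) 1 * M) (vf R k) = ac M (vf R k) + ve R k := by
      simp [ac_T, hwk]
    have h3 := step1 (T (ve R k) 1 * M) (by rw [ac_mul, hM, ac_T]; simp)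
      (by rw [e1]; simpa using nonu _ hu) (by
        rw [e1]
        convert hy using 1
        simp only [Pi.add_apply, ve_inl, if_true]
        module)
    have h4 := mul_mem (inv_mem (h0 1)) h3
    rwa [inv_mul_cancel_left] at h4
  by_cases hy : Uni (ac M (vf R k) - vf R k - ac M (vf R k) (.inl k) • ve R k)
  · exact step2 M hM hy
  have hwk := inr1 M hM
  set w := ac M (vf R k) with hw
  have hy' : ∀ j, ¬ IsUnit ((w - vf R k - w (.inl k) • ve R k) j) := by
    simpa [Uni] using hy
  have n1 : ¬ IsUnit (w (.inr m)) := by simpa [hkm, hkm.symm] using hy' (.inr m)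
  have n2 : ¬ IsUnit (w (.inl m)) := by simpa [hkm, hkm.symm] using hy' (.inl m)
  have e1 : ac (T (ve R k + ve R m) 1 * M) (vf R k)
      = w + (1 + w (.inr m)) • (ve R k + ve R m) := by
    rw [ac_mul, ac_T, ← hw, om_add_left, om_ve_left, om_ve_left, hwk, one_mul]
  have m1 : T (ve R k + ve R m) 1 ∈ P :=
    h1 _ _ (by simp) ⟨ve R m, 1, uni_ve m, sup_ve (by simp [hkm.symm]), by simp⟩
  have h3 := step2 (T (ve R k + ve R m) 1 * M) (by
    rw [ac_mul, hM, ac_T]; simp) (by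
    rw [e1]
    refine ⟨.inl m, ?_⟩
    simp only [Pi.sub_apply, Pi.add_apply, Pi.smul_apply, ve_inl, vf_inl, hkm.symm, if_true,
      if_false, smul_eq_mul]
    have h5 := nonu _ (fun h : IsUnit (w (.inl m) + w (.inr m)) =>
      (Ideal.add_mem (IsLocalRing.maximalIdeal R) n2 n1) h)
    convert h5 using 1
    ring)
  have h4 := mul_mem (inv_mem m1) h3
  rwa [inv_mul_cancel_left] at h4

end Generation

section Extension

variable {E G : Type} [Group E] [Group G]

/-- Any lifts of `x` and `y` along `π` commute. -/
def CL (π : E →* G) (x y : G) : Prop := ∀ z z', π z = x → π z' = y → Commute z z'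

theorem mem_center_of_eq {π : E →* G} (hc : π.ker ≤ Subgroup.center E) {x y : E}
    (h : π x = π y) : ∃ c ∈ Subgroup.center E, π c = 1 ∧ x = y * c := by
  have h1 : y⁻¹ * x ∈ π.ker := by rw [MonoidHom.mem_ker, map_mul, map_inv, h, inv_mul_cancel]
  exact ⟨y⁻¹ * x, hc h1, h1, by group⟩

theorem commute_center {c : E} (hc : c ∈ Subgroup.center E) (x : E) : Commute c x :=
  (Subgroup.mem_center_iff.1 hc x).symm

theorem commute_center' {c : E} (hc : c ∈ Subgroup.center E) (x : E) : Commute x c :=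
  Subgroup.mem_center_iff.1 hc x

theorem CL_of_lifts {π : E →* G} (hc : π.ker ≤ Subgroup.center E) {z z' : E} (h : Commute z z') :
    CL π (π z) (π z') := by
  intro y y' hy hy'
  obtain ⟨c, hc1, -, rfl⟩ := mem_center_of_eq hc hy
  obtain ⟨d, hd1, -, rfl⟩ := mem_center_of_eq hc hy'
  exact (h.mul_left (commute_center hc1 _)).mul_right (commute_center' hd1 _)

/-- The subgroup of elements whose lifts commute with those of `x`. -/
def CLs (π : E →* G) (hπ : Function.Surjective π) (hc : π.ker ≤ Subgroup.center E) (x : G) :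
    Subgroup G where
  carrier := {y | CL π x y}
  one_mem' := by
    obtain ⟨z, rfl⟩ := hπ x
    have := CL_of_lifts hc (Commute.one_right z)
    rwa [map_one] at this
  mul_mem' := by
    intro a b ha hb
    obtain ⟨z, rfl⟩ := hπ x
    obtain ⟨a, rfl⟩ := hπ a
    obtain ⟨b, rfl⟩ := hπ b
    have := CL_of_lifts hc ((ha z a rfl rfl).mul_right (hb z b rfl rfl))
    rwa [map_mul] at this
  inv_mem' := by
    intro a ha
    obtain ⟨z, rfl⟩ := hπ x
    obtain ⟨a, rfl⟩ := hπ a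
    have := CL_of_lifts hc (ha z a rfl rfl).inv_right
    rwa [map_inv] at this

theorem mem_CLs {π : E →* G} {hπ : Function.Surjective π} {hc : π.ker ≤ Subgroup.center E}
    {x y : G} : y ∈ CLs π hπ hc x ↔ CL π x y := Iff.rfl

open scoped commutatorElement in
theorem commutator_mem_CLs (π : E →* G) (hπ : Function.Surjective π)
    (hc : π.ker ≤ Subgroup.center E) {x a b : G} (ha : Commute x a) (hb : Commute x b) :
    ⁅a, b⁆ ∈ CLs π hπ hc x := by
  obtain ⟨z, rfl⟩ := hπ x
  obtain ⟨a, rfl⟩ := hπ a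
  obtain ⟨b, rfl⟩ := hπ b
  have key : ∀ a, Commute (π z) (π a) → ∃ c ∈ Subgroup.center E, z * a * z⁻¹ = a * c := by
    intro a ha
    obtain ⟨c, hc1, -, h⟩ := mem_center_of_eq (π := π) hc (x := z * a * z⁻¹) (y := a) (by
      rw [map_mul, map_mul, map_inv, ha.eq]; group)
    exact ⟨c, hc1, h⟩
  obtain ⟨c, hc1, h1⟩ := key a ha
  obtain ⟨d, hd1, h2⟩ := key b hb
  have h3 : z * ⁅a, b⁆ * z⁻¹ = ⁅a, b⁆ := by
    have : z * ⁅a, b⁆ * z⁻¹ = ⁅z * a * z⁻¹, z * b * z⁻¹⁆ := by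
      simp only [commutatorElement_def]; group
    rw [this, h1, h2, commutatorElement_def, commutatorElement_def]
    have e1 := (commute_center hc1 (b * d)).eq
    have e2 := (commute_center hd1 (a * c)⁻¹).eq
    calc a * c * (b * d) * (a * c)⁻¹ * (b * d)⁻¹
        = a * (c * (b * d)) * (a * c)⁻¹ * (b * d)⁻¹ := by group
      _ = a * b * d * (c * (a * c)⁻¹) * (b * d)⁻¹ := by rw [e1]; group
      _ = a * b * d * a⁻¹ * (b * d)⁻¹ := by rw [_root_.mul_inv_rev, mul_inv_cancel_left]
      _ = a * b * (d * a⁻¹) * (b * d)⁻¹ := by group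
      _ = a * b * a⁻¹ * b⁻¹ := by rw [(commute_center hd1 a⁻¹).eq]; group
  have h4 : Commute z ⁅a, b⁆ := by
    rw [Commute, SemiconjBy]; nth_rewrite 2 [← h3]; group
  have := CL_of_lifts hc h4
  rw [map_commutatorElement] at this
  exact this

theorem CL.conj {π : E →* G} (hc : π.ker ≤ Subgroup.center E) (hπ : Function.Surjective π)
    {x y : G} (h : CL π x y) (g : G) : CL π (g * x * g⁻¹) (g * y * g⁻¹) := by
  obtain ⟨z, rfl⟩ := hπ x
  obtain ⟨y, rfl⟩ := hπ y
  obtain ⟨g, rfl⟩ := hπ g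
  have h1 : Commute (g * z * g⁻¹) (g * y * g⁻¹) := by
    have := (h z y rfl rfl).eq
    rw [Commute, SemiconjBy]
    calc g * z * g⁻¹ * (g * y * g⁻¹) = g * (z * y) * g⁻¹ := by group
      _ = _ := by rw [this]; group
  have := CL_of_lifts hc h1
  simpa only [map_mul, map_inv] using this

end Extension

section Frame

variable {l R : Type} [Fintype l] [DecidableEq l] [CommRing R]

theorem EE_add_left (u u' v : l ⊕ l → R) (h : om u v = 0) (h' : om u' v = 0)
    (h2 : om (u + u') v = 0) (h3 : om u u' = 0) (t : R) :
    EE (u + u') v h2 t = EE u v h t * EE u' v h' t := by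
  have h4 : om v u' = 0 := by rw [om_swap, h', neg_zero]
  have h5 : om v u = 0 := by rw [om_swap, h, neg_zero]
  apply sp_ext; intro x
  simp only [ac_mul, ac_EE, om_add_left, om_add_right, om_smul_right, h3, h4, h, om_self]
  module

theorem T_comm (u v : l ⊕ l → R) (h : om u v = 0) (s t : R) : Commute (T u s) (T v t) := by
  have h5 : om v u = 0 := by rw [om_swap, h, neg_zero]
  apply sp_ext; intro x
  simp only [ac_mul, ac_T, om_add_right, om_smul_right, h, h5]
  module

theorem T_comm_EE (w u v : l ⊕ l → R) (h : om u v = 0) (h1 : om w u = 0) (h2 : om w v = 0)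
    (s t : R) : Commute (T w s) (EE u v h t) := by
  have h3 : om u w = 0 := by rw [om_swap, h1, neg_zero]
  have h4 : om v w = 0 := by rw [om_swap, h2, neg_zero]
  apply sp_ext; intro x
  simp only [ac_mul, ac_T, ac_EE, om_add_right, om_smul_right, h1, h2, h3, h4]
  module

theorem om_ve_ve (i j : l) : om (ve R i) (ve R j) = 0 := by simp
theorem om_ve_vf {i j : l} (h : i ≠ j) : om (ve R i) (vf R j) = 0 := by simp [h.symm]
open scoped commutatorElement in
/-- A transvection as a product of two commutators of elements supported away from a plane. -/
theorem T_eq_commutators {m a b : l} (hma : m ≠ a) (hmb : m ≠ b) (hab : a ≠ b) :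
    T (ve R m) 1 = ⁅EE (ve R m) (vf R a) (om_ve_vf hma) (-1), T (ve R a) 1⁆ *
      ⁅EE (ve R m) (vf R b) (om_ve_vf hmb) (-1), EE (ve R b) (ve R a) (om_ve_ve _ _) 1⁆⁻¹ := by
  have e1 : ac (EE (ve R m) (vf R a) (om_ve_vf hma) (-1)) (ve R a) = ve R m + ve R a := by
    rw [ac_EE]; simp [add_comm]
  have e2 : ac (EE (ve R m) (vf R b) (om_ve_vf hmb) (-1)) (ve R b) = ve R m + ve R b := by
    rw [ac_EE]; simp [add_comm]
  have e3 : ac (EE (ve R m) (vf R b) (om_ve_vf hmb) (-1)) (ve R a) = ve R a := by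
    rw [ac_EE]; simp [hab]
  simp only [commutatorElement_def]
  rw [T_conj, EE_conj, e1, T_add_vec _ _ (om_ve_ve _ _)]
  simp only [e2, e3]
  rw [EE_add_left _ _ _ (om_ve_ve _ _) (om_ve_ve _ _) _ (om_ve_ve _ _), mul_inv_cancel_right]
  have := T_comm_EE (R := R) (ve R a) (ve R m) (ve R a) (om_ve_ve _ _) (om_ve_ve _ _) (om_ve_ve _ _) 1 1
  rw [mul_assoc (T (ve R m) 1), this.eq]
  group

/-- `(u,v,w)` lies in the orbit of a triple of basis vectors `e`. -/
def Tri (u v w : l ⊕ l → R) : Prop := ∃ (M : symplecticGroup l R) (a b c : l),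
  a ≠ b ∧ a ≠ c ∧ b ≠ c ∧ u = ac M (ve R a) ∧ v = ac M (ve R b) ∧ w = ac M (ve R c)

theorem Tri.swap12 {u v w : l ⊕ l → R} : Tri u v w → Tri v u w := by
  rintro ⟨M, a, b, c, h1, h2, h3, hu, hv, hw⟩
  exact ⟨M, b, a, c, h1.symm, h3, h2, hv, hu, hw⟩

theorem Tri.swap23 {u v w : l ⊕ l → R} : Tri u v w → Tri u w v := by
  rintro ⟨M, a, b, c, h1, h2, h3, hu, hv, hw⟩
  exact ⟨M, a, c, b, h2, h1, h3.symm, hu, hw, hv⟩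

theorem Tri.swap13 {u v w : l ⊕ l → R} (h : Tri u v w) : Tri w v u := h.swap12.swap23.swap12

theorem Tri.map {u v w : l ⊕ l → R} (h : Tri u v w) (N : symplecticGroup l R) :
    Tri (ac N u) (ac N v) (ac N w) := by
  obtain ⟨M, a, b, c, h1, h2, h3, rfl, rfl, rfl⟩ := h
  exact ⟨N * M, a, b, c, h1, h2, h3, by simp only [ac_mul, and_self]⟩

theorem Tri.smul {u v w : l ⊕ l → R} (h : Tri u v w) (c : Rˣ) : Tri ((c : R) • u) v w := by
  obtain ⟨M, a, b, d, h1, h2, h3, rfl, rfl, rfl⟩ := h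
  refine ⟨M * Ho a c, a, b, d, h1, h2, h3, ?_⟩
  simp [ac_Ho_ve, ac_Ho_ve_ne, h1, h2]

theorem Tri.neg {u v w : l ⊕ l → R} (h : Tri u v w) : Tri (-u) v w := by
  simpa using h.smul (-1)

theorem Tri.add {u v w : l ⊕ l → R} (h : Tri u v w) (t : R) : Tri (u + t • v) v w := by
  obtain ⟨M, a, b, d, h1, h2, h3, rfl, rfl, rfl⟩ := h
  refine ⟨M * EE (ve R b) (vf R a) (om_ve_vf h1.symm) (-t), a, b, d, h1, h2, h3, ?_⟩
  simp [ac_EE, h1.symm, h2.symm]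

theorem tri_ve {a b c : l} (h1 : a ≠ b) (h2 : a ≠ c) (h3 : b ≠ c) :
    Tri (ve R a) (ve R b) (ve R c) := ⟨1, a, b, c, h1, h2, h3, by simp⟩

theorem Tri.om12 {u v w : l ⊕ l → R} (h : Tri u v w) : om u v = 0 := by
  obtain ⟨M, a, b, d, h1, h2, h3, rfl, rfl, rfl⟩ := h
  rw [om_ac, om_ve_ve]

theorem Tri.uni [IsLocalRing R] {u v w : l ⊕ l → R} (h : Tri u v w) : Uni u := by
  obtain ⟨M, a, b, d, h1, h2, h3, rfl, rfl, rfl⟩ := h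
  exact uni_ac M (uni_ve a)

/-- Any two `Tri` triples are conjugate. -/
theorem Tri.exists_map {a b c : l} (hab : a ≠ b) (hac : a ≠ c) (hbc : b ≠ c)
    {u v w : l ⊕ l → R} (h : Tri u v w) : ∃ M : symplecticGroup l R,
    ac M (ve R a) = u ∧ ac M (ve R b) = v ∧ ac M (ve R c) = w := by
  obtain ⟨M, a', b', c', h1, h2, h3, rfl, rfl, rfl⟩ := h
  have key : ∀ a b c : l, a ≠ b → a ≠ c → b ≠ c → Function.Injective ![a, b, c] := by
    intro a b c h1 h2 h3 i j hij
    fin_cases i <;> fin_cases j <;> simp_all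
  obtain ⟨σ, hσ⟩ := (Equiv.Perm.isMultiplyPretransitive l 3).exists_smul_eq
    (⟨_, key a b c hab hac hbc⟩ : Fin 3 ↪ l) ⟨_, key a' b' c' h1 h2 h3⟩
  have e : ∀ i, σ (![a, b, c] i) = ![a', b', c'] i := fun i => DFunLike.congr_fun hσ i
  refine ⟨M * Pm R σ, ?_, ?_, ?_⟩
  · rw [ac_mul, ac_Pm_ve]; exact congrArg _ (congrArg _ (e 0))
  · rw [ac_mul, ac_Pm_ve]; exact congrArg _ (congrArg _ (e 1))
  · rw [ac_mul, ac_Pm_ve]; exact congrArg _ (congrArg _ (e 2))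

end Frame

section Lift

variable {l : Type} [Fintype l] [DecidableEq l] {n : ℕ} [NeZero n] [IsLocalRing (ZMod n)]
variable {E : Type} [Group E]

theorem T_eq_pow (v : l ⊕ l → ZMod n) (t : ZMod n) : T v t = T v 1 ^ t.val := by
  rw [T_pow, mul_one, ZMod.natCast_zmod_val]

theorem T_ve_pow_mem {P : Subgroup (symplecticGroup l (ZMod n))} {v : l ⊕ l → ZMod n}
    (h : T v 1 ∈ P) (t : ZMod n) : T v t ∈ P := by
  rw [T_eq_pow]; exact pow_mem h _

/-- The pair `(e k, c e k + v')` is conjugate to `(e k, e m)`. -/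
theorem exists_pair_map {k m : l} (hkm : k ≠ m) {v' : l ⊕ l → ZMod n} (c : ZMod n) (hu : Uni v')
    (hs : Sup (Finset.univ.erase k) v') : ∃ M : symplecticGroup l (ZMod n),
      ac M (ve (ZMod n) k) = ve (ZMod n) k ∧ ac M (ve (ZMod n) m) = c • ve (ZMod n) k + v' := by
  obtain ⟨N, hN, hNe⟩ := exists_Gn_ve (S := Finset.univ.erase k) (k := m) (by simp [hkm.symm]) hs hu
  have hNk := (ac_of_mem_Gn hN (i := k) (by simp)).1
  have hx : ∃ x : l ⊕ l → ZMod n, om (ve (ZMod n) k) x = 0 ∧ om x v' = c := by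
    obtain ⟨j | j, a, ha⟩ := hu
    · have hjk : k ≠ j := by
        rintro rfl; rw [(hs k (by simp)).1] at ha; exact a.ne_zero ha
      refine ⟨(-(c * (a⁻¹ : (ZMod n)ˣ))) • vf (ZMod n) j, by simp [hjk], ?_⟩
      rw [om_smul_left, om_vf_left, ← ha]
      linear_combination c * Units.mul_inv a
    · have hjk : k ≠ j := by
        rintro rfl; rw [(hs k (by simp)).2] at ha; exact a.ne_zero ha
      refine ⟨((c * (a⁻¹ : (ZMod n)ˣ))) • ve (ZMod n) j, by simp [om_smul_right], ?_⟩
      rw [om_smul_left, om_ve_left, ← ha]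
      linear_combination c * Units.mul_inv a
  obtain ⟨x, hx1, hx2⟩ := hx
  have hx3 : om x (ve (ZMod n) k) = 0 := by rw [om_swap, hx1, neg_zero]
  refine ⟨EE (ve (ZMod n) k) x hx1 1 * N, ?_, ?_⟩
  · rw [ac_mul, hNk, ac_EE]; simp [hx3]
  · rw [ac_mul, hNe, ac_EE, hx2]
    simp [(hs k (by simp)).2, add_comm]

variable {π : E →* symplecticGroup l (ZMod n)} (hπ : Function.Surjective π)
  (hc : π.ker ≤ Subgroup.center E)

include hπ hc in
theorem CL_pair {k m a b : l} (hka : k ≠ a) (hkb : k ≠ b) (hma : m ≠ a)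
    (hmb : m ≠ b) (hab : a ≠ b) : CL π (T (ve (ZMod n) k) 1) (T (ve (ZMod n) m) 1) := by
  rw [← mem_CLs (hπ := hπ) (hc := hc), T_eq_commutators hma hmb hab]
  refine mul_mem (commutator_mem_CLs _ _ _ ?_ ?_)
    (inv_mem (commutator_mem_CLs _ _ _ ?_ ?_))
  · exact T_comm_EE _ _ _ _ (om_ve_ve _ _) (om_ve_vf hka) _ _
  · exact T_comm _ _ (om_ve_ve _ _) _ _
  · exact T_comm_EE _ _ _ _ (om_ve_ve _ _) (om_ve_vf hkb) _ _
  · exact T_comm_EE _ _ _ _ (om_ve_ve _ _) (om_ve_ve _ _) _ _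

include hπ hc in
theorem CL_stab {k m a b : l} (hkm : k ≠ m) (hka : k ≠ a) (hkb : k ≠ b) (hma : m ≠ a)
    (hmb : m ≠ b) (hab : a ≠ b) {M : symplecticGroup l (ZMod n)}
    (hM : ac M (ve (ZMod n) k) = ve (ZMod n) k) : CL π (T (ve (ZMod n) k) 1) M := by
  rw [← mem_CLs (hπ := hπ) (hc := hc)]
  refine stab_gen hkm _ (fun t => T_ve_pow_mem ?_ t) ?_ M hM
  · obtain ⟨z, hz⟩ := hπ (T (ve (ZMod n) k) 1)
    rw [← hz]
    exact CL_of_lifts hc (Commute.refl z)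
  · rintro v t hv ⟨v', c, hu, hs, rfl⟩
    refine T_ve_pow_mem ?_ t
    obtain ⟨N, h1, h2⟩ := exists_pair_map hkm c hu hs
    have h3 := (CL_pair hπ hc hka hkb hma hmb hab).conj hc hπ N
    rwa [T_conj, T_conj, h1, h2] at h3

include hπ hc in
/-- Equivariant lift of the transvections. -/
theorem exists_lift_aux {k m a b : l} (hkm : k ≠ m) (hka : k ≠ a) (hkb : k ≠ b) (hma : m ≠ a)
    (hmb : m ≠ b) (hab : a ≠ b) : ∃ q : (l ⊕ l → ZMod n) → E, (∀ v, Uni v → π (q v) = T v 1) ∧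
      ∀ z v, Uni v → z * q v * z⁻¹ = q (ac (π z) v) := by
  obtain ⟨t0, ht0⟩ := hπ (T (ve (ZMod n) k) 1)
  have : ∀ v : l ⊕ l → ZMod n, ∃ z : E, Uni v → ac (π z) (ve (ZMod n) k) = v := by
    intro v
    by_cases hv : Uni v
    · obtain ⟨M, hM⟩ := exists_ac_ve k hv
      obtain ⟨z, rfl⟩ := hπ M
      exact ⟨z, fun _ => hM⟩
    · exact ⟨1, fun h => absurd h hv⟩
  choose Z hZ using this
  refine ⟨fun v => Z v * t0 * (Z v)⁻¹, ?_, ?_⟩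
  · intro v hv
    rw [map_mul, map_mul, map_inv, ht0, T_conj, hZ v hv]
  · intro z v hv
    have hv' := uni_ac (π z) hv
    have h1 : Commute t0 ((Z (ac (π z) v))⁻¹ * z * Z v) := by
      refine CL_stab hπ hc hkm hka hkb hma hmb hab (M := π ((Z (ac (π z) v))⁻¹ * z * Z v)) ?_ _ _ ht0 rfl
      rw [map_mul π, map_mul π, ac_mul, ac_mul, hZ v hv, map_inv π]
      exact ac_inv_eq (hZ _ hv')
    have h2 := h1.eq
    calc z * (Z v * t0 * (Z v)⁻¹) * z⁻¹
        = Z (ac (π z) v) * ((Z (ac (π z) v))⁻¹ * z * Z v * t0) * (Z v)⁻¹ * z⁻¹ := by group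
      _ = _ := by rw [← h2]; group

/-- A lift of the unimodular transvections which is equivariant, even and satisfies the
lantern relation. -/
structure QLift (π : E →* symplecticGroup l (ZMod n)) (q : (l ⊕ l → ZMod n) → E) : Prop where
  lift : ∀ v, Uni v → π (q v) = T v 1
  equi : ∀ z v, Uni v → z * q v * z⁻¹ = q (ac (π z) v)
  even : ∀ v, Uni v → q (-v) = q v
  lantern : ∀ u v w, Tri u v w →
    q (u + v + w) * q u * q v * q w = q (u + v) * q (u + w) * q (v + w)

include hπ hc in
theorem exists_QLift {k m a b : l} (hkm : k ≠ m) (hka : k ≠ a) (hkb : k ≠ b) (hma : m ≠ a)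
    (hmb : m ≠ b) (hab : a ≠ b) : ∃ q, QLift π q := by
  obtain ⟨q, hq, hz⟩ := exists_lift_aux hπ hc hkm hka hkb hma hmb hab
  have uk : Uni (ve (ZMod n) k) := uni_ve k
  have uf : Uni (vf (ZMod n) k) := uni_vf k
  have hw : q (ve (ZMod n) k) * q (vf (ZMod n) k) * q (ve (ZMod n) k)
      = q (vf (ZMod n) k) * q (ve (ZMod n) k) * q (vf (ZMod n) k) := by
    have h1 := hz (q (ve (ZMod n) k) * q (vf (ZMod n) k) * q (ve (ZMod n) k)) _ uf
    have e1 : ac (π (q (ve (ZMod n) k) * q (vf (ZMod n) k) * q (ve (ZMod n) k))) (vf (ZMod n) k)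
        = ve (ZMod n) k := by
      simp only [map_mul π, hq _ uk, hq _ uf, ac_mul, ac_T]
      simp
    rw [e1, mul_inv_eq_iff_eq_mul] at h1
    have h2 : q (ve (ZMod n) k) * (q (vf (ZMod n) k) * q (ve (ZMod n) k) * q (vf (ZMod n) k))
      = q (ve (ZMod n) k) * (q (ve (ZMod n) k) * q (vf (ZMod n) k) * q (ve (ZMod n) k)) := by
      simpa only [mul_assoc] using h1
    exact (mul_left_cancel h2).symm
  have heven0 : q (-vf (ZMod n) k) = q (vf (ZMod n) k) := by
    have h1 := hz (q (ve (ZMod n) k) * q (vf (ZMod n) k) * q (ve (ZMod n) k)) _ uk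
    have e1 : ac (π (q (ve (ZMod n) k) * q (vf (ZMod n) k) * q (ve (ZMod n) k))) (ve (ZMod n) k)
        = -vf (ZMod n) k := by
      simp only [map_mul π, hq _ uk, hq _ uf, ac_mul, ac_T]
      simp
    rw [e1] at h1
    rw [← h1, mul_inv_eq_iff_eq_mul]
    nth_rewrite 1 [hw]
    simp only [mul_assoc]
  have heven : ∀ v, Uni v → q (-v) = q v := by
    intro v hv
    obtain ⟨M, hM⟩ := exists_ac_ve k hv
    obtain ⟨z, hz'⟩ := hπ (M * (Fl (ZMod n) k)⁻¹)
    have h1 : ac (π z) (vf (ZMod n) k) = v := by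
      rw [hz', ac_mul, ac_inv_eq (ac_Fl_ve k), hM]
    rw [← h1, ← map_neg, ← hz z _ uf, ← hz z _ (by simpa [Uni] using uf), heven0]
  have hT : ∀ u v w : l ⊕ l → ZMod n, om u v = 0 → om u w = 0 → om v w = 0 →
      T (u + v + w) 1 * T u 1 * T v 1 * T w 1 = T (u + v) 1 * T (u + w) 1 * T (v + w) 1 := by
    intro u v w h1 h2 h3
    have h1' : om v u = 0 := by rw [om_swap, h1, neg_zero]
    have h2' : om w u = 0 := by rw [om_swap, h2, neg_zero]
    have h3' : om w v = 0 := by rw [om_swap, h3, neg_zero]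
    apply sp_ext; intro x
    simp only [ac_mul, ac_T, om_add_right, om_add_left, om_smul_right, om_self, h1, h2, h3, h1',
      h2', h3']
    module
  have huni : ∀ u v w : l ⊕ l → ZMod n, Tri u v w → Uni (u + v) := by
    intro u v w h
    simpa using (h.add 1).uni
  have huni3 : ∀ u v w : l ⊕ l → ZMod n, Tri u v w → Uni (u + v + w) := by
    intro u v w h
    simpa using ((h.add 1).swap23.add 1).uni
  have ht0 : Tri (ve (ZMod n) k) (ve (ZMod n) m) (ve (ZMod n) a) := tri_ve hkm hka hma
  set x := q (ve (ZMod n) k + ve (ZMod n) m + ve (ZMod n) a) * q (ve (ZMod n) k) *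
    q (ve (ZMod n) m) * q (ve (ZMod n) a) with hx
  set y := q (ve (ZMod n) k + ve (ZMod n) m) * q (ve (ZMod n) k + ve (ZMod n) a) *
    q (ve (ZMod n) m + ve (ZMod n) a) with hy
  obtain ⟨c, hcc, hc1, hxy⟩ := mem_center_of_eq hc (x := x) (y := y) (π := π) (by
    simp only [hx, hy, map_mul π]
    rw [hq _ (huni3 _ _ _ ht0), hq _ ht0.uni, hq _ ht0.swap12.uni, hq _ ht0.swap13.uni,
      hq _ (huni _ _ _ ht0), hq _ (huni _ _ _ ht0.swap23),
      hq _ (huni _ _ _ ht0.swap12.swap23), hT _ _ _ ht0.om12 ht0.swap23.om12 ht0.swap12.swap23.om12])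
  have hci : c⁻¹ ∈ Subgroup.center E := inv_mem hcc
  refine ⟨fun v => c⁻¹ * q v, ?_, ?_, ?_, ?_⟩
  · intro v hv; rw [map_mul, map_inv, hc1, hq v hv, inv_one, one_mul]
  · intro z v hv
    rw [← hz z v hv, ← mul_assoc z, (commute_center' hci z).eq]; group
  · intro v hv
    simp only [heven v hv]
  · intro u v w h
    obtain ⟨M, h1, h2, h3⟩ := h.exists_map hkm hka hma
    obtain ⟨z, rfl⟩ := hπ M
    have key : q (u + v + w) * q u * q v * q w = q (u + v) * q (u + w) * q (v + w) * c := by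
      have : z * x * z⁻¹ = z * (y * c) * z⁻¹ := by rw [hxy]
      rw [hx, hy] at this
      have e1 : ∀ a b c d : E, z * (a * b * c * d) * z⁻¹
        = (z * a * z⁻¹) * (z * b * z⁻¹) * (z * c * z⁻¹) * (z * d * z⁻¹) := by
        intros; group
      rw [e1, e1, hz z _ (huni3 _ _ _ ht0), hz z _ ht0.uni, hz z _ ht0.swap12.uni,
        hz z _ ht0.swap13.uni, hz z _ (huni _ _ _ ht0), hz z _ (huni _ _ _ ht0.swap23),
        hz z _ (huni _ _ _ ht0.swap12.swap23)] at this
      simp only [map_add, h1, h2, h3] at this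
      rw [this, (commute_center' hcc z).eq, mul_inv_cancel_right]
    have e1 : ∀ i j : E, (c⁻¹ * i) * (c⁻¹ * j) = (c⁻¹ * c⁻¹) * (i * j) := fun i j =>
      ((commute_center' hci i).mul_mul_mul_comm _ _)
    have e2 : ∀ i j : E, (c⁻¹ * c⁻¹ * i) * (c⁻¹ * j) = (c⁻¹ * c⁻¹ * c⁻¹) * (i * j) := fun i j =>
      ((commute_center' hci i).mul_mul_mul_comm _ _)
    have e3 : ∀ i j : E, (c⁻¹ * c⁻¹ * c⁻¹ * i) * (c⁻¹ * j) = (c⁻¹ * c⁻¹ * c⁻¹ * c⁻¹) * (i * j) :=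
      fun i j => ((commute_center' hci i).mul_mul_mul_comm _ _)
    simp only [e1, e2, e3]
    rw [key, ← (commute_center hcc _).eq]
    group

end Lift

section Quadratic

/-- Formal consequences of the lantern relation in an abelian group. -/
theorem lantern_quadratic {V A : Type} [AddCommGroup V] [AddCommGroup A] (Q : V → A) (D : ℕ)
    (P : V → V → V → Prop) (s12 : ∀ u v w, P u v w → P v u w) (s23 : ∀ u v w, P u v w → P u w v)
    (hadd : ∀ u v w, P u v w → P (u + v) v w) (hneg : ∀ u v w, P u v w → P (-u) v w)
    (lan : ∀ u v w, P u v w → Q (u + v + w) + Q u + Q v + Q w = Q (u + v) + Q (u + w) + Q (v + w))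
    (even : ∀ u v w, P u v w → Q (-u) = Q u) (hD : ∀ v : V, D • v = 0)
    (δ : A) (hδ : ∀ u v w, P u v w → D • Q u = δ) {u v w : V} (h : P u v w) :
    D • Q v = 0 ∧ D • (Q (u + v) - Q u - Q v) = 0 ∧
    (∀ k : ℕ, Q (u + k • v) = Q u + k • (Q (u + v) - Q u - Q v) + k ^ 2 • Q v) ∧
    (∀ k : ℕ, P u (k • v) w → Q (k • v) = k ^ 2 • Q v) := by
  have hsub : ∀ u v w, P u v w → P (u - v) v w := fun u v w h => by
    have := hneg _ _ _ (hadd _ _ _ (hneg _ _ _ h))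
    simpa [sub_eq_add_neg, neg_add_rev, add_comm] using this
  have hnadd : ∀ (k : ℕ) u v w, P u v w → P (u + k • v) v w := by
    intro k
    induction k with
    | zero => intro u v w h; simpa using h
    | succ k ih => intro u v w h; rw [succ_nsmul, ← add_assoc]; exact hadd _ _ _ (ih _ _ _ h)
  have badd : ∀ u v w, P u v w → Q (u + w + v) - Q (u + w) - Q v =
      (Q (u + v) - Q u - Q v) + (Q (w + v) - Q w - Q v) := by
    intro u v w h
    have := lan u v w h
    rw [add_right_comm u w v, add_comm w v, eq_sub_of_add_eq (eq_sub_of_add_eq (eq_sub_of_add_eq this))]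
    abel
  have bnadd : ∀ (k : ℕ) u v w, P u v w → Q (u + k • w + v) - Q (u + k • w) - Q v =
      (Q (u + v) - Q u - Q v) + k • (Q (w + v) - Q w - Q v) := by
    intro k
    induction k with
    | zero => intro u v w h; simp
    | succ k ih =>
      intro u v w h
      have h1 := badd (u + k • w) v w (s23 _ _ _ (hnadd k _ _ _ (s23 _ _ _ h)))
      rw [succ_nsmul, ← add_assoc, h1, ih _ _ _ h, succ_nsmul]; abel
  have bD : ∀ u v w, P u v w → D • (Q (u + v) - Q u - Q v) = 0 := by
    intro u v w h
    have h' : P w v u := s12 _ _ _ (s23 _ _ _ (s12 _ _ _ h))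
    have := bnadd D w v u h'
    rw [hD, add_zero] at this
    exact left_eq_add.1 this
  -- the defect of bilinearity on the diagonal
  have cadd : ∀ u v w, P u v w → Q (u + v + v) - Q (u + v) - Q v - (Q (u + v) - Q u - Q v) =
      Q (w + v + v) - Q (w + v) - Q v - (Q (w + v) - Q w - Q v) := by
    have aux : ∀ u v w, P u v w → Q (u + w + v + v) - Q (u + w + v) - Q v -
        (Q (u + w + v) - Q (u + w) - Q v) =
        Q (u + v + v) - Q (u + v) - Q v - (Q (u + v) - Q u - Q v) := by
      intro u v w h
      have h1 := badd (u + v) v w (hadd _ _ _ h)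
      have h2 := badd u v w h
      rw [add_right_comm u v w] at h1
      rw [h1, h2]; abel
    intro u v w h
    rw [← aux u v w h, ← aux w v u (s12 _ _ _ (s23 _ _ _ (s12 _ _ _ h))), add_comm w u]
  have cpar : ∀ u v w, P u v w → Q (u + v) + Q (u - v) = 2 • Q u +
      (Q (w + v + v) - Q (w + v) - Q v - (Q (w + v) - Q w - Q v)) := by
    intro u v w h
    have := cadd (u - v) v w (hsub _ _ _ h)
    rw [← this, sub_add_cancel]; abel
  have hC : ∀ u v w, P u v w →
      Q (w + v + v) - Q (w + v) - Q v - (Q (w + v) - Q w - Q v) = 2 • Q v := by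
    intro u v w h
    have hw : P w v u := s12 _ _ _ (s23 _ _ _ (s12 _ _ _ h))
    have huw : P (u + w) v w := s23 _ _ _ (hadd _ _ _ (s23 _ _ _ h))
    have h1 := cpar u v w h
    have h2 := cpar w v u hw
    have h3 := cpar (u + w) v w huw
    have h4 := lan u v w h
    have h5 := lan u (-v) w (s12 _ _ _ (hneg _ _ _ (s12 _ _ _ h)))
    rw [even v u w (s12 _ _ _ h)] at h5
    rw [cadd u v w h] at h2
    rw [add_right_comm u v w, add_comm v w] at h4
    rw [add_right_comm u (-v) w, add_comm (-v) w] at h5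
    simp only [← sub_eq_add_neg] at h5
    generalize (Q (w + v + v) - Q (w + v) - Q v - (Q (w + v) - Q w - Q v)) = C at *
    have e1 : Q (u + w + v) = Q (u + v) + Q (u + w) + Q (w + v) - Q u - Q v - Q w := by
      rw [← h4]; abel
    have e2 : Q (u + w - v) = Q (u - v) + Q (u + w) + Q (w - v) - Q u - Q v - Q w := by
      rw [← h5]; abel
    have e3 : Q (u - v) = 2 • Q u + C - Q (u + v) := by rw [← h1]; abel
    have e4 : Q (w - v) = 2 • Q w + C - Q (w + v) := by rw [← h2]; abel
    rw [e1, e2, e3, e4] at h3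
    have h6 : 2 • Q (u + w) + (C + (C - 2 • Q v)) = 2 • Q (u + w) + (C + 0) := by
      rw [add_zero, ← h3]; abel
    exact sub_eq_zero.1 (add_left_cancel (add_left_cancel h6))
  have par : ∀ u v w, P u v w → Q (u + v) = 2 • Q u + 2 • Q v - Q (u - v) := by
    intro u v w h
    have := cpar u v w h
    rw [hC u v w h] at this
    rw [← this]; abel
  have quad : ∀ u v w, P u v w → ∀ k : ℕ,
      Q (u + k • v) = Q u + k • (Q (u + v) - Q u - Q v) + k ^ 2 • Q v ∧
      Q (u + (k + 1) • v) = Q u + (k + 1) • (Q (u + v) - Q u - Q v) + (k + 1) ^ 2 • Q v := by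
    intro u v w h k
    induction k with
    | zero =>
      constructor
      · simp
      · simp only [zero_add, one_smul, one_pow]; abel
    | succ k ih =>
      refine ⟨ih.2, ?_⟩
      have h1 := par (u + (k + 1) • v) v w (hnadd (k + 1) _ _ _ h)
      have e1 : u + (k + 1) • v + v = u + (k + 1 + 1) • v := by rw [succ_nsmul v (k+1)]; abel
      have e2 : u + (k + 1) • v - v = u + k • v := by rw [succ_nsmul]; abel
      rw [e1, e2, ih.1, ih.2] at h1
      rw [h1]
      have hz : ∀ (m : ℕ) (a : A), m • a = (m : ℤ) • a := fun m a => (natCast_zsmul a m).symm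
      simp only [hz]; push_cast
      module
  have qD : ∀ u v w, P u v w → δ = 0 := by
    intro u v w h
    have h1 := hδ (u + v) v w (hadd _ _ _ h)
    have h2 := bD u v w h
    rw [smul_sub, smul_sub, h1, hδ _ _ _ h, hδ _ _ _ (s12 _ _ _ h)] at h2
    simpa using h2
  refine ⟨?_, bD u v w h, fun k => (quad u v w h k).1, fun k hk => ?_⟩
  · rw [hδ _ _ _ (s12 _ _ _ h), qD u v w h]
  · have hw : P w v u := s12 _ _ _ (s23 _ _ _ (s12 _ _ _ h))
    have huw : P (u + w) v w := s23 _ _ _ (hadd _ _ _ (s23 _ _ _ h))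
    have h1 := badd u (k • v) w hk
    have h2 := badd u v w h
    rw [(quad _ _ _ h k).1, (quad _ _ _ hw k).1, (quad _ _ _ huw k).1, h2] at h1
    have h3 : k ^ 2 • Q v - Q (k • v) = 0 := by
      rw [← sub_eq_zero] at h1
      rw [← neg_eq_zero, ← h1, smul_add]
      abel
    exact (sub_eq_zero.1 h3).symm

end Quadratic

section QLiftAlgebra

variable {l : Type} [Fintype l] [DecidableEq l] {n : ℕ} [NeZero n] [IsLocalRing (ZMod n)]
variable {E : Type} [Group E]
variable {π : E →* symplecticGroup l (ZMod n)} {q : (l ⊕ l → ZMod n) → E}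

theorem QLift.commute (h : QLift π q) {u v : l ⊕ l → ZMod n} (hu : Uni u) (hv : Uni v)
    (huv : om u v = 0) : Commute (q u) (q v) := by
  have := h.equi (q u) v hv
  rw [h.lift u hu, ac_T, huv, mul_zero, zero_smul, add_zero, mul_inv_eq_iff_eq_mul] at this
  exact this

/-- Lift of an Eichler transformation. -/
def bq (q : (l ⊕ l → ZMod n) → E) (u v : l ⊕ l → ZMod n) : E := q (u + v) * (q u)⁻¹ * (q v)⁻¹

theorem Tri.smulv {R : Type} [CommRing R] {u v w : l ⊕ l → R} (h : Tri u v w) (c : Rˣ) :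
    Tri u ((c : R) • v) w := (h.swap12.smul c).swap12

theorem Tri.uniAdd {R : Type} [CommRing R] [IsLocalRing R] {u v w : l ⊕ l → R} (h : Tri u v w) :
    Uni (u + v) := by
  simpa using (h.add 1).uni

theorem Tri.uniAdd3 {R : Type} [CommRing R] [IsLocalRing R] {u v w : l ⊕ l → R} (h : Tri u v w) :
    Uni (u + v + w) := by
  simpa using ((h.add 1).swap23.add 1).uni

theorem pow_card_central (h : QLift π q) (hπ : Function.Surjective π)
    {v w : l ⊕ l → ZMod n} (hv : Uni v) (hw : Uni w)
    (hc : π.ker ≤ Subgroup.center E) (k : l) : q v ^ n = q w ^ n := by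
  have key : ∀ v, Uni v → q v ^ n = q (ve (ZMod n) k) ^ n := by
    intro v hv
    obtain ⟨M, hM⟩ := exists_ac_ve k hv
    obtain ⟨z, rfl⟩ := hπ M
    have h1 : q (ve (ZMod n) k) ^ n ∈ π.ker := by
      rw [MonoidHom.mem_ker, map_pow, h.lift _ (uni_ve k), T_pow, ZMod.natCast_self, zero_mul, T_zero]
    rw [← hM, ← h.equi _ _ (uni_ve k), conj_pow, (commute_center' (hc h1) z).eq, mul_inv_cancel_right]
  rw [key v hv, key w hw]

/-- Quadratic behaviour of `q` on an isotropic frame. -/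
theorem QLift.quadratic (h : QLift π q) (hπ : Function.Surjective π)
    (hc : π.ker ≤ Subgroup.center E) {u v w : l ⊕ l → ZMod n} (ht : Tri u v w) :
    q v ^ n = 1 ∧ bq q u v ^ n = 1 ∧
    (∀ k : ℕ, q (u + k • v) = q u * bq q u v ^ k * q v ^ (k ^ 2)) ∧
    (∀ k : ℕ, IsUnit (k : ZMod n) → q (k • v) = q v ^ (k ^ 2)) ∧
    bq q (u + w) v = bq q u v * bq q w v := by
  classical
  set I : Submodule (ZMod n) (l ⊕ l → ZMod n) := Submodule.span _ {u, v, w} with hI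
  have hu : u ∈ I := Submodule.subset_span (by simp)
  have hv : v ∈ I := Submodule.subset_span (by simp)
  have hw : w ∈ I := Submodule.subset_span (by simp)
  have h12 := ht.om12
  have h13 := ht.swap23.om12
  have h23 := ht.swap12.swap23.om12
  have h21 := ht.swap12.om12
  have h31 := ht.swap23.swap12.om12
  have h32 := ht.swap12.swap23.swap12.om12
  have hiso : ∀ x ∈ I, ∀ y ∈ I, om x y = 0 := by
    intro x hx y hy
    induction hx using Submodule.span_induction with
    | mem x hx =>
      induction hy using Submodule.span_induction with
      | mem y hy =>
        simp only [Set.mem_insert_iff, Set.mem_singleton_iff] at hx hy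
        rcases hx with rfl | rfl | rfl <;> rcases hy with rfl | rfl | rfl <;>
          first | assumption | exact om_self _
      | zero => simp [om]
      | add a b _ _ h1 h2 => rw [om_add_right, h1, h2, add_zero]
      | smul c a _ h1 => rw [om_smul_right, h1, mul_zero]
    | zero => simp [om]
    | add a b _ _ h1 h2 => rw [om_add_left, h1, h2, add_zero]
    | smul c a _ h1 => rw [om_smul_left, h1, mul_zero]
  set X : Set E := {e | ∃ x ∈ I, Uni x ∧ e = q x} with hX
  have hXc : ∀ x ∈ X, ∀ y ∈ X, x * y = y * x := by
    rintro _ ⟨x, hx, ux, rfl⟩ _ ⟨y, hy, uy, rfl⟩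
    exact h.commute ux uy (hiso x hx y hy)
  have hcl := Subgroup.isMulCommutative_closure hXc
  let : CommGroup (Subgroup.closure X) :=
    { (inferInstance : Group (Subgroup.closure X)) with mul_comm := hcl.is_comm.comm }
  have hmem : ∀ x, x ∈ I ∧ Uni x → q x ∈ Subgroup.closure X := fun x hx =>
    Subgroup.subset_closure ⟨x, hx.1, hx.2, rfl⟩
  let Q : (l ⊕ l → ZMod n) → Additive (Subgroup.closure X) := fun x =>
    if hx : x ∈ I ∧ Uni x then Additive.ofMul ⟨q x, hmem x hx⟩ else 0
  have hQ : ∀ x, x ∈ I → Uni x → ((Q x).toMul : E) = q x := by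
    intro x h1 h2
    simp only [Q, h1, h2, and_self, dif_pos]; rfl
  have ext : ∀ a b : Additive (Subgroup.closure X), (a.toMul : E) = (b.toMul : E) → a = b :=
    fun a b hab => Additive.toMul.injective (Subtype.ext hab)
  have tadd : ∀ a b : Additive (Subgroup.closure X), ((a + b).toMul : E) = a.toMul * b.toMul :=
    fun a b => rfl
  have tsub : ∀ a b : Additive (Subgroup.closure X), ((a - b).toMul : E) = a.toMul * (b.toMul : E)⁻¹ := by
    intro a b; rw [sub_eq_add_neg]; rfl
  have tsmul : ∀ (k : ℕ) (a : Additive (Subgroup.closure X)), ((k • a).toMul : E) = (a.toMul : E) ^ k :=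
    fun k a => by rw [toMul_nsmul]; rfl
  obtain ⟨r1, r2, r3, r4⟩ := lantern_quadratic Q n
    (fun x y z => Tri x y z ∧ x ∈ I ∧ y ∈ I ∧ z ∈ I)
    (fun x y z t => ⟨t.1.swap12, t.2.2.1, t.2.1, t.2.2.2⟩)
    (fun x y z t => ⟨t.1.swap23, t.2.1, t.2.2.2, t.2.2.1⟩)
    (fun x y z t => ⟨by simpa using t.1.add 1, I.add_mem t.2.1 t.2.2.1, t.2.2⟩)
    (fun x y z t => ⟨t.1.neg, I.neg_mem t.2.1, t.2.2⟩)
    (by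
      rintro x y z ⟨t, hx, hy, hz⟩
      apply ext
      simp only [tadd]
      rw [hQ _ (I.add_mem (I.add_mem hx hy) hz) t.uniAdd3, hQ _ hx t.uni, hQ _ hy t.swap12.uni,
        hQ _ hz t.swap13.uni, hQ _ (I.add_mem hx hy) t.uniAdd,
        hQ _ (I.add_mem hx hz) t.swap23.uniAdd, hQ _ (I.add_mem hy hz) t.swap12.swap23.uniAdd]
      exact h.lantern x y z t)
    (by
      rintro x y z ⟨t, hx, hy, hz⟩
      apply ext
      rw [hQ _ (I.neg_mem hx) t.neg.uni, hQ _ hx t.uni]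
      exact h.even x t.uni)
    (fun v => by rw [← Nat.cast_smul_eq_nsmul (ZMod n)]; simp)
    (n • Q u)
    (by
      rintro x y z ⟨t, hx, hy, hz⟩
      apply ext
      rw [tsmul, tsmul, hQ _ hx t.uni, hQ _ hu ht.uni]
      exact pow_card_central h hπ t.uni ht.uni hc ht.choose_spec.choose)
    (u := u) (v := v) (w := w) ⟨ht, hu, hv, hw⟩
  have eb : ((Q (u + v) - Q u - Q v).toMul : E) = bq q u v := by
    rw [tsub, tsub, hQ _ (I.add_mem hu hv) ht.uniAdd, hQ _ hu ht.uni, hQ _ hv ht.swap12.uni]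
    rfl
  have tr : ∀ a b : Additive (Subgroup.closure X), a = b → (a.toMul : E) = b.toMul := fun _ _ h => by rw [h]
  refine ⟨?_, ?_, ?_, ?_, ?_⟩
  · have := tr _ _ r1
    rwa [tsmul, hQ _ hv ht.swap12.uni] at this
  · have := tr _ _ r2
    rwa [tsmul, eb] at this
  · intro k
    have h1 : Uni (u + k • v) := by
      rw [← Nat.cast_smul_eq_nsmul (ZMod n)]; exact (ht.add _).uni
    have := tr _ _ (r3 k)
    rwa [tadd, tadd, tsmul, tsmul, eb, hQ _ hu ht.uni, hQ _ hv ht.swap12.uni,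
      hQ _ (I.add_mem hu (I.smul_of_tower_mem k hv)) h1] at this
  · intro k hk
    have h0 : Tri u (k • v) w := by
      rw [← Nat.cast_smul_eq_nsmul (ZMod n)]
      obtain ⟨c, hc⟩ := hk
      rw [← hc]; exact ht.smulv c
    have := tr _ _ (r4 k ⟨h0, hu, I.smul_of_tower_mem k hv, hw⟩)
    rwa [tsmul, hQ _ hv ht.swap12.uni, hQ _ (I.smul_of_tower_mem k hv) h0.swap12.uni] at this
  · have e2 : ((Q (w + v) - Q w - Q v).toMul : E) = bq q w v := by
      rw [tsub, tsub, hQ _ (I.add_mem hw hv) ht.swap13.uniAdd, hQ _ hw ht.swap13.uni,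
        hQ _ hv ht.swap12.uni]
      rfl
    have e3 : ((Q (u + w + v) - Q (u + w) - Q v).toMul : E) = bq q (u + w) v := by
      rw [tsub, tsub, hQ _ (I.add_mem (I.add_mem hu hw) hv) ht.swap23.uniAdd3,
        hQ _ (I.add_mem hu hw) ht.swap23.uniAdd, hQ _ hv ht.swap12.uni]
      rfl
    rw [← eb, ← e2, ← e3, ← tadd]
    apply tr
    have h4 : Q (u + v + w) + Q u + Q v + Q w = Q (u + v) + Q (u + w) + Q (v + w) := by
      apply ext
      simp only [tadd]
      rw [hQ _ (I.add_mem (I.add_mem hu hv) hw) ht.uniAdd3, hQ _ hu ht.uni, hQ _ hv ht.swap12.uni,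
        hQ _ hw ht.swap13.uni, hQ _ (I.add_mem hu hv) ht.uniAdd,
        hQ _ (I.add_mem hu hw) ht.swap23.uniAdd, hQ _ (I.add_mem hv hw) ht.swap12.swap23.uniAdd]
      exact h.lantern u v w ht
    rw [add_right_comm u w v, add_comm w v,
      eq_sub_of_add_eq (eq_sub_of_add_eq (eq_sub_of_add_eq h4))]
    abel

end QLiftAlgebra

section RankOne

variable {R E : Type} [CommRing R] [Group E]

/-- The Weyl element attached to a pair of one-parameter families. -/
def wl (x y : R → E) (u : Rˣ) : E := x u * y (-((u⁻¹ : Rˣ) : R)) * x u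

/-- The torus element attached to a pair of one-parameter families. -/
def hl (x y : R → E) (u : Rˣ) : E := wl x y u * wl x y (-1)

/-- Two opposite one-parameter subgroups satisfying the rank one Steinberg relations. -/
structure Rank1 (x y : R → E) : Prop where
  x_add : ∀ s t, x (s + t) = x s * x t
  y_add : ∀ s t, y (s + t) = y s * y t
  wx : ∀ (u : Rˣ) t, wl x y u * x t * (wl x y u)⁻¹ = y (-((u⁻¹ : Rˣ) : R) ^ 2 * t)
  wy : ∀ (u : Rˣ) t, wl x y u * y t * (wl x y u)⁻¹ = x (-(u : R) ^ 2 * t)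

/-- The torus of a rank one pair. -/
def Hs (x y : R → E) : Subgroup E := Subgroup.closure (Set.range (hl x y))

namespace Rank1

variable {x y : R → E} (r : Rank1 x y)
include r

theorem x_zero : x 0 = 1 := by
  have := r.x_add 0 0
  rw [add_zero] at this
  exact left_eq_mul.1 this

theorem y_zero : y 0 = 1 := by
  have := r.y_add 0 0
  rw [add_zero] at this
  exact left_eq_mul.1 this

theorem x_neg (t : R) : x (-t) = (x t)⁻¹ := by
  rw [eq_inv_iff_mul_eq_one, ← r.x_add, neg_add_cancel, r.x_zero]

theorem y_neg (t : R) : y (-t) = (y t)⁻¹ := by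
  rw [eq_inv_iff_mul_eq_one, ← r.y_add, neg_add_cancel, r.y_zero]

theorem w_neg (u : Rˣ) : wl x y (-u) = (wl x y u)⁻¹ := by
  simp only [wl, _root_.mul_inv_rev, Units.val_neg, inv_neg, r.x_neg, r.y_neg, neg_neg, inv_inv]
  group

theorem w_eq_y (u : Rˣ) : wl x y u =
    y (-((u⁻¹ : Rˣ) : R)) * x u * y (-((u⁻¹ : Rˣ) : R)) := by
  have h : wl x y u = wl x y u * wl x y u * (wl x y u)⁻¹ := by group
  have e1 : -((u⁻¹ : Rˣ) : R) ^ 2 * (u : R) = -((u⁻¹ : Rˣ) : R) := by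
    rw [neg_mul, pow_two, mul_assoc, Units.inv_mul, mul_one]
  have e2 : -(u : R) ^ 2 * (-((u⁻¹ : Rˣ) : R)) = u := by
    rw [neg_mul_neg, pow_two, mul_assoc, Units.mul_inv, mul_one]
  calc wl x y u = wl x y u * (x u * y (-((u⁻¹ : Rˣ) : R)) * x u) * (wl x y u)⁻¹ := h
    _ = (wl x y u * x u * (wl x y u)⁻¹) * (wl x y u * y (-((u⁻¹ : Rˣ) : R)) * (wl x y u)⁻¹) *
        (wl x y u * x u * (wl x y u)⁻¹) := by group
    _ = _ := by rw [r.wx, r.wy, e1, e2]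

theorem x_eq (u : Rˣ) : x u = y ((u⁻¹ : Rˣ) : R) * wl x y u * y ((u⁻¹ : Rˣ) : R) := by
  rw [r.w_eq_y, r.y_neg]; group

theorem y_eq (u : Rˣ) : y ((u⁻¹ : Rˣ) : R) = x u * wl x y (-u) * x u := by
  rw [wl, Units.val_neg, inv_neg, Units.val_neg, neg_neg, r.x_neg]; group

theorem hl_one : hl x y 1 = 1 := by
  rw [hl, r.w_neg, mul_inv_cancel]

theorem w_mul_w (u v : Rˣ) : wl x y u * wl x y v = hl x y u * (hl x y (-v))⁻¹ := by
  simp only [hl, r.w_neg]; group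

theorem w_mul_w_mem (u v : Rˣ) : wl x y u * wl x y v ∈ Hs x y := by
  rw [r.w_mul_w]
  exact mul_mem (Subgroup.subset_closure ⟨_, rfl⟩) (inv_mem (Subgroup.subset_closure ⟨_, rfl⟩))

theorem w_x (u : Rˣ) (t : R) : wl x y u * x t = y (-((u⁻¹ : Rˣ) : R) ^ 2 * t) * wl x y u := by
  rw [← r.wx]; group

theorem w_y (u : Rˣ) (t : R) : wl x y u * y t = x (-(u : R) ^ 2 * t) * wl x y u := by
  rw [← r.wy]; group

theorem h_x (u : Rˣ) (t : R) : hl x y u * x t = x ((u : R) ^ 2 * t) * hl x y u := by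
  rw [hl, mul_assoc, r.w_x, ← mul_assoc, r.w_y, mul_assoc]
  congr 2
  simp

theorem h_y (u : Rˣ) (t : R) : hl x y u * y t = y (((u⁻¹ : Rˣ) : R) ^ 2 * t) * hl x y u := by
  rw [hl, mul_assoc, r.w_y, ← mul_assoc, r.w_x, mul_assoc]
  congr 2
  simp

/-- Torus elements act on both root subgroups by a common unit. -/
theorem Hs_act {h : E} (hh : h ∈ Hs x y) :
    ∃ u : Rˣ, ∀ t, h * x t = x (u * t) * h ∧ h * y t = y ((u⁻¹ : Rˣ) * t) * h := by
  induction hh using Subgroup.closure_induction with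
  | mem _ h =>
    obtain ⟨u, rfl⟩ := h
    refine ⟨u ^ 2, fun t => ⟨?_, ?_⟩⟩
    · rw [r.h_x]; simp
    · rw [r.h_y]; simp
  | one => exact ⟨1, fun t => by simp⟩
  | mul a b _ _ ha hb =>
    obtain ⟨u, hu⟩ := ha
    obtain ⟨v, hv⟩ := hb
    refine ⟨u * v, fun t => ⟨?_, ?_⟩⟩
    · rw [mul_assoc, (hv t).1, ← mul_assoc, (hu _).1, mul_assoc, Units.val_mul, mul_assoc (u : R)]
    · rw [mul_assoc, (hv t).2, ← mul_assoc, (hu _).2, mul_assoc, mul_inv, Units.val_mul,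
        mul_assoc ((u⁻¹ : Rˣ) : R)]
  | inv a _ ha =>
    obtain ⟨u, hu⟩ := ha
    refine ⟨u⁻¹, fun t => ⟨?_, ?_⟩⟩
    · rw [inv_mul_eq_iff_eq_mul, ← mul_assoc, (hu _).1, Units.mul_inv_cancel_left,
        mul_inv_cancel_right]
    · rw [inv_mul_eq_iff_eq_mul, ← mul_assoc, (hu _).2, inv_inv, Units.inv_mul_cancel_left,
        mul_inv_cancel_right]

theorem x_y_unit_left (a u : Rˣ) (b : R) (hu : (u : R) = 1 + a * b) :
    x a * y b = y (((u⁻¹ : Rˣ) : R) * b) * (wl x y a * wl x y (-(a * u⁻¹))) *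
      x (((u⁻¹ : Rˣ) : R) * a) := by
  have e1 : y b = y (-((a⁻¹ : Rˣ) : R)) * y (((a * u⁻¹)⁻¹ : Rˣ) : R) := by
    rw [← r.y_add]; congr 1
    rw [mul_inv, inv_inv, Units.val_mul, hu, mul_add, mul_one, Units.inv_mul_cancel_left]; ring
  have e2 : x a * y (-((a⁻¹ : Rˣ) : R)) = wl x y a * x (-a) := by
    rw [wl, r.x_neg]; group
  have e3 : x (-(a : R)) * x ((a * u⁻¹ : Rˣ) : R) = x (-(a ^ 2 : R) * (((u⁻¹ : Rˣ) : R) * b)) := by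
    rw [← r.x_add]; congr 1
    have : (a : R) * b = u - 1 := by rw [hu]; ring
    rw [Units.val_mul]
    linear_combination (norm := skip) (a * ((u⁻¹ : Rˣ) : R)) * this
    ring_nf
    rw [mul_assoc, Units.inv_mul]; ring
  have e4 : -((a⁻¹ : Rˣ) : R) ^ 2 * (-(a ^ 2 : R) * (((u⁻¹ : Rˣ) : R) * b)) =
      ((u⁻¹ : Rˣ) : R) * b := by
    rw [neg_mul, neg_mul, mul_neg, neg_neg, ← mul_assoc, ← mul_pow, Units.inv_mul, one_pow,
      one_mul]
  rw [e1, ← mul_assoc, e2, r.y_eq, mul_assoc, ← mul_assoc (x _), ← mul_assoc (x _), e3,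
    ← mul_assoc, ← mul_assoc, r.w_x, e4, Units.val_mul, mul_comm (a : R)]
  group

theorem x_y_unit_right (b u : Rˣ) (a : R) (hu : (u : R) = 1 + a * b) :
    ∃ h ∈ Hs x y, ∃ s t, x a * y b = y s * h * x t := by
  have e1 : x a * y b = x ((u * b⁻¹ : Rˣ) : R) * wl x y (-b⁻¹) * x ((b⁻¹ : Rˣ) : R) := by
    have := r.y_eq b⁻¹
    rw [inv_inv] at this
    rw [this, ← mul_assoc, ← mul_assoc, ← r.x_add]
    congr 3
    rw [Units.val_mul, hu, add_mul, mul_assoc, Units.mul_inv]; ring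
  rw [e1, r.x_eq, mul_assoc (y _ * _), r.w_neg]
  have e2 : y (((u * b⁻¹)⁻¹ : Rˣ) : R) * (wl x y b⁻¹)⁻¹ =
      wl x y (-b⁻¹) * x (-((b⁻¹ : Rˣ) : R) ^ 2 * (((u * b⁻¹)⁻¹ : Rˣ) : R)) := by
    rw [r.w_neg, ← r.wy]; group
  rw [e2]
  refine ⟨_, r.w_mul_w_mem (u * b⁻¹) (-b⁻¹), (((u * b⁻¹)⁻¹ : Rˣ) : R),
    -((b⁻¹ : Rˣ) : R) ^ 2 * (((u * b⁻¹)⁻¹ : Rˣ) : R) + ((b⁻¹ : Rˣ) : R), ?_⟩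
  rw [r.x_add]
  simp only [mul_assoc]

theorem x_y_mem [IsLocalRing R] (a b : R) (hu : IsUnit (1 + a * b)) :
    ∃ h ∈ Hs x y, ∃ s t, x a * y b = y s * h * x t := by
  obtain ⟨u, hu⟩ := hu
  by_cases ha : IsUnit a
  · obtain ⟨a, rfl⟩ := ha
    exact ⟨_, r.w_mul_w_mem _ _, _, _, r.x_y_unit_left a u b hu⟩
  by_cases hb : IsUnit b
  · obtain ⟨b, rfl⟩ := hb
    exact r.x_y_unit_right b u a hu
  have ha1 : IsUnit (a - 1) := by
    rcases IsLocalRing.isUnit_or_isUnit_of_add_one (a := a) (b := 1 - a) (by ring) with h | h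
    · exact absurd h ha
    · rw [← IsUnit.neg_iff, neg_sub]; exact h
  have hb1 : IsUnit (1 + b) := by
    rcases IsLocalRing.isUnit_or_isUnit_of_add_one (a := -b) (b := 1 + b) (by ring) with h | h
    · exact absurd (IsUnit.neg_iff b |>.1 h) hb
    · exact h
  obtain ⟨a1, ha1⟩ := ha1
  obtain ⟨b1, hb1⟩ := hb1
  have h1 := r.x_y_unit_left 1 b1 b (by rw [hb1]; simp)
  have h2 := r.x_y_unit_left a1 (u * b1⁻¹) (((b1⁻¹ : Rˣ) : R) * b) (by
    have := b1.inv_mul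
    rw [hb1] at this
    rw [Units.val_mul, hu, ha1]
    linear_combination this)
  obtain ⟨v, hv⟩ := r.Hs_act (inv_mem (r.w_mul_w_mem 1 (-(1 * b1⁻¹))))
  have hv' : ∀ t, x t * (wl x y 1 * wl x y (-(1 * b1⁻¹))) =
      (wl x y 1 * wl x y (-(1 * b1⁻¹))) * x (v * t) := fun t => by
    rw [← inv_mul_eq_iff_eq_mul, ← mul_assoc, (hv t).1, inv_mul_cancel_right]
  have ha2 : a = a1 + (1 : Rˣ) := by rw [ha1]; simp
  refine ⟨_, mul_mem (r.w_mul_w_mem a1 (-(a1 * (u * b1⁻¹)⁻¹))) (r.w_mul_w_mem 1 (-(1 * b1⁻¹))),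
    ((u * b1⁻¹)⁻¹ : Rˣ) * (((b1⁻¹ : Rˣ) : R) * b),
    v * (((u * b1⁻¹)⁻¹ : Rˣ) * a1) + ((b1⁻¹ : Rˣ) : R) * (1 : Rˣ), ?_⟩
  rw [ha2, r.x_add, mul_assoc, h1, ← mul_assoc, ← mul_assoc, h2, r.x_add,
    mul_assoc (_ * _) (x _), hv']
  simp only [mul_assoc]

/-- The key exchange property of a rank one pair over a local ring. -/
theorem yxy_mem [IsLocalRing R] (t s t' : R) :
    ∃ a b, ∃ h ∈ Hs x y, ∃ c, y t * x s * y t' = x a * y b * h * x c := by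
  by_cases h1 : IsUnit (1 + t * s)
  · obtain ⟨h, hh, a, b, e⟩ := r.x_y_mem (-s) (-t) (by rwa [neg_mul_neg, mul_comm])
    have e' : y t * x s = x (-b) * h⁻¹ * y (-a) := by
      have := congrArg (·⁻¹) e
      simp only [_root_.mul_inv_rev, r.x_neg, r.y_neg, inv_inv] at this ⊢
      rw [this, mul_assoc]
    obtain ⟨v, hv⟩ := r.Hs_act (inv_mem hh)
    refine ⟨-b, (v⁻¹ : Rˣ) * (-a + t'), h⁻¹, inv_mem hh, 0, ?_⟩
    rw [e', r.x_zero, mul_one, mul_assoc, ← r.y_add, mul_assoc, (hv _).2, mul_assoc]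
  by_cases h2 : IsUnit (1 + s * t')
  · obtain ⟨h, hh, a, b, e⟩ := r.x_y_mem s t' h2
    refine ⟨0, t + a, h, hh, b, ?_⟩
    rw [mul_assoc, e, r.x_zero, one_mul, r.y_add]
    simp only [mul_assoc]
  have hs : IsUnit s := by
    rcases IsLocalRing.isUnit_or_isUnit_of_add_one (a := -(s * t')) (b := 1 + s * t') (by ring)
      with h | h
    · exact isUnit_of_mul_isUnit_left ((IsUnit.neg_iff _).1 h)
    · exact absurd h h2
  obtain ⟨s, rfl⟩ := hs
  have hm : IsUnit (1 + (-(s : R) * (1 + t * s)) * ((s⁻¹ : Rˣ) + t')) := by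
    rcases IsLocalRing.isUnit_or_isUnit_of_add_one
      (a := (s : R) * (1 + t * s) * ((s⁻¹ : Rˣ) + t'))
      (b := 1 + (-(s : R) * (1 + t * s)) * ((s⁻¹ : Rˣ) + t')) (by ring) with h | h
    · exact absurd (isUnit_of_mul_isUnit_right (isUnit_of_mul_isUnit_left h)) h1
    · exact h
  obtain ⟨h, hh, a, b, e⟩ := r.x_y_mem _ _ hm
  have e1 : x s = wl x y s * x (-s) * y ((s⁻¹ : Rˣ) : R) := by
    rw [wl, r.x_neg, r.y_neg]; group
  have e2 : y t * wl x y s = wl x y s * x (-(s : R) ^ 2 * t) := by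
    have := r.wy (-s) t
    rw [r.w_neg, inv_inv] at this
    rw [← inv_mul_eq_iff_eq_mul, ← mul_assoc, this]
    simp
  have e3 : y t * x s * y t' = wl x y s * (x (-(s : R) * (1 + t * s)) * y ((s⁻¹ : Rˣ) + t')) := by
    rw [e1, r.y_add, ← mul_assoc, ← mul_assoc, e2]
    have : (-(s : R) * (1 + t * s)) = -(s : R) ^ 2 * t + -s := by ring
    rw [this, r.x_add]
    simp only [mul_assoc]
  obtain ⟨v, hv⟩ := r.Hs_act (inv_mem hh)
  have hv' : ∀ t, x t * h = h * x (v * t) := fun t => by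
    rw [← inv_mul_eq_iff_eq_mul, ← mul_assoc, (hv t).1, inv_mul_cancel_right]
  refine ⟨-(s : R) ^ 2 * a + s, -((s⁻¹ : Rˣ) : R), h, hh, v * s + b, ?_⟩
  rw [e3, e, ← mul_assoc, ← mul_assoc, r.w_y, wl, r.x_add, r.x_add]
  simp only [mul_assoc]
  rw [← mul_assoc (x (s : R)) h, hv', mul_assoc]

end Rank1

end RankOne

section Symbols

/-- Functions on units that are additive on squares, up to symbols. -/
structure SymbFn {R A : Type} [CommRing R] [AddCommGroup A] (φ : Rˣ → A) : Prop where
  one : φ 1 = 0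
  mul_sq : ∀ t s, φ (t * s ^ 2) = φ t + φ (s ^ 2)
  neg : ∀ s, φ s + φ (-s) = φ (-s ^ 2)

namespace SymbFn

variable {R A : Type} [CommRing R] [AddCommGroup A] {φ : Rˣ → A} (h : SymbFn φ)
include h

theorem symb_congr (a b s t : Rˣ) : φ (a * s ^ 2) + φ (b * t ^ 2) - φ (a * s ^ 2 * (b * t ^ 2)) =
    φ a + φ b - φ (a * b) := by
  have e : a * s ^ 2 * (b * t ^ 2) = a * b * s ^ 2 * t ^ 2 := by
    rw [mul_mul_mul_comm, mul_assoc (a * b)]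
  rw [e, h.mul_sq, h.mul_sq, h.mul_sq, h.mul_sq (a * b)]
  abel

theorem inv (a : Rˣ) : φ a⁻¹ = φ a - φ (a ^ 2) := by
  have := h.mul_sq a⁻¹ a
  rw [pow_two, inv_mul_cancel_left, ← pow_two] at this
  rw [this]; abel

theorem inv_sq (a : Rˣ) : φ (a⁻¹ ^ 2) = -φ (a ^ 2) := by
  have := h.mul_sq (a⁻¹ ^ 2) a
  rw [← mul_pow, inv_mul_cancel, one_pow, h.one] at this
  rw [eq_neg_iff_add_eq_zero, this]

/-- With a cyclic group of units, one trivial symbol of nonsquares makes all symbols trivial. -/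
theorem trivial_of_cyclic (ζ : Rˣ) (hζ : ∀ u : Rˣ, ∃ s, u = s ^ 2 ∨ u = ζ * s ^ 2) {s t : Rˣ}
    (hst : φ (ζ * s ^ 2) + φ (ζ * t ^ 2) = φ (ζ * s ^ 2 * (ζ * t ^ 2))) (u v : Rˣ) :
    φ u + φ v = φ (u * v) := by
  rw [← sub_eq_zero, h.symb_congr] at hst
  rw [← sub_eq_zero]
  obtain ⟨a, rfl | rfl⟩ := hζ u <;> obtain ⟨b, rfl | rfl⟩ := hζ v
  · rw [h.mul_sq]; abel
  · rw [mul_comm (a ^ 2), h.mul_sq (ζ * b ^ 2)]; abel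
  · rw [h.mul_sq (ζ * a ^ 2)]; abel
  · rw [h.symb_congr, hst]

/-- The 2-adic case: all symbols are multiples of one symbol of order two. -/
theorem two_adic (τ s : Rˣ) (hτ : ∀ u : Rˣ, ∃ s, u = s ^ 2 ∨ u = -s ^ 2 ∨ u = τ * s ^ 2 ∨ u = -τ * s ^ 2)
    (h1 : φ 1 - φ (1 * τ⁻¹) + (φ 1 - φ (1 * (-1)⁻¹)) =
      φ τ - φ (τ * (-1)⁻¹) + (φ (-1) - φ (-1 * τ⁻¹)))
    (h2 : φ 1 - φ (1 * (-s ^ 2)⁻¹) + (φ 1 - φ (1 * τ⁻¹)) =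
      φ τ - φ (τ * (τ * s ^ 2)⁻¹) + (φ (-1) - φ (-1 * (-1)⁻¹))) :
    2 • (φ τ + φ τ - φ (τ ^ 2)) = 0 ∧ ∀ u v, φ u + φ v - φ (u * v) = 0 ∨
      φ u + φ v - φ (u * v) = φ τ + φ τ - φ (τ ^ 2) := by
  have n1 : φ (-τ) = φ (-1) + φ (τ ^ 2) - φ τ := by
    have := h.neg τ
    rw [← neg_one_mul (τ ^ 2), h.mul_sq] at this
    rw [← this]; abel
  have e1 : (-1 : Rˣ)⁻¹ = -1 := by simp
  have e2 : -1 * τ⁻¹ = (-τ)⁻¹ := by simp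
  have e3 : (-s ^ 2)⁻¹ = -1 * s⁻¹ ^ 2 := by simp
  have e4 : τ * (τ * s ^ 2)⁻¹ = s⁻¹ ^ 2 := by simp
  rw [one_mul, one_mul, e1, mul_neg_one, e2, h.inv, h.inv, neg_sq, h.one, n1] at h1
  rw [one_mul, one_mul, e4, e3, e1, h.mul_sq, h.inv, h.inv_sq, h.one, neg_mul_neg, one_mul, h.one] at h2
  have m2 : φ τ + φ τ - φ (τ ^ 2) + (φ τ + φ τ - φ (τ ^ 2)) = 0 := by
    rw [← sub_eq_zero] at h1
    rw [← neg_eq_zero, ← h1]; abel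
  have m1 : φ (-1) + φ (-1) = φ τ + φ τ - φ (τ ^ 2) := by
    rw [← sub_eq_zero] at h2
    rw [eq_comm, eq_neg_of_add_eq_zero_left m2, ← sub_eq_zero, ← h2]; abel
  have q1 : φ τ + φ τ = φ (-1) + φ (-1) + φ (τ ^ 2) := by rw [m1]; abel
  refine ⟨by rw [two_nsmul, m2], fun u v => ?_⟩
  have cl : ∀ u : Rˣ, ∃ a, u = 1 * a ^ 2 ∨ u = -1 * a ^ 2 ∨ u = τ * a ^ 2 ∨ u = -τ * a ^ 2 := by
    intro u
    obtain ⟨a, ha⟩ := hτ u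
    exact ⟨a, by rwa [one_mul, neg_one_mul]⟩
  obtain ⟨a, ha⟩ := cl u
  obtain ⟨b, hb⟩ := cl v
  have z : ∀ r, φ 1 + φ r - φ (1 * r) = 0 := fun r => by rw [h.one, one_mul]; abel
  have z' : ∀ r, φ r + φ 1 - φ (r * 1) = 0 := fun r => by rw [h.one, mul_one]; abel
  have n2 : φ (-τ) = φ τ - (φ (-1) + φ (-1)) + φ (-1) := by rw [n1, m1]; abel
  have n3 : φ (-1) + φ (-1) + (φ (-1) + φ (-1)) = 0 := by rw [m1, m2]
  rcases ha with rfl | rfl | rfl | rfl <;> rcases hb with rfl | rfl | rfl | rfl <;>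
    rw [h.symb_congr] <;> try first | exact Or.inl (z _) | exact Or.inl (z' _)
  · right; rw [neg_mul_neg, one_mul, h.one, m1, sub_zero]
  · right; rw [neg_one_mul, n1]; abel
  · left; rw [neg_mul_neg, one_mul, n2]; abel
  · right; rw [mul_neg_one, n1]; abel
  · right; rw [← pow_two]
  · left; rw [mul_neg, ← pow_two, ← neg_one_mul (τ ^ 2), h.mul_sq, n1]; abel
  · left; rw [neg_mul_neg, mul_one, n2]; abel
  · left; rw [neg_mul, ← pow_two, ← neg_one_mul (τ ^ 2), h.mul_sq, n1]; abel
  · left; rw [neg_mul_neg, ← pow_two, n1]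
    rw [← sub_eq_zero] at q1
    rw [← neg_zero, ← q1]; abel

end SymbFn

namespace Rank1

variable {R E : Type} [CommRing R] [Group E] {x y : R → E} (r : Rank1 x y)
include r

theorem w_conj_w (s v : Rˣ) :
    wl x y s * wl x y v * (wl x y s)⁻¹ = wl x y (s ^ 2 * v⁻¹) := by
  rw [r.w_eq_y (s ^ 2 * v⁻¹)]
  nth_rewrite 2 [wl]
  have : wl x y s * (x v * y (-((v⁻¹ : Rˣ) : R)) * x v) * (wl x y s)⁻¹ =
      (wl x y s * x v * (wl x y s)⁻¹) * (wl x y s * y (-((v⁻¹ : Rˣ) : R)) * (wl x y s)⁻¹) *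
      (wl x y s * x v * (wl x y s)⁻¹) := by group
  rw [this, r.wx, r.wy]
  simp [mul_comm]

theorem h_w (s v : Rˣ) : hl x y s * wl x y v * (hl x y s)⁻¹ = wl x y (s ^ 2 * v) := by
  have : hl x y s * wl x y v * (hl x y s)⁻¹ =
      wl x y s * (wl x y (-1) * wl x y v * (wl x y (-1))⁻¹) * (wl x y s)⁻¹ := by
    rw [hl]; group
  rw [this, r.w_conj_w, r.w_conj_w]; simp

theorem h_h (s t : Rˣ) : hl x y s * hl x y t * (hl x y s)⁻¹ =
    hl x y (s ^ 2 * t) * (hl x y (s ^ 2))⁻¹ := by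
  have : hl x y s * hl x y t * (hl x y s)⁻¹ = (hl x y s * wl x y t * (hl x y s)⁻¹) *
      (hl x y s * wl x y (-1) * (hl x y s)⁻¹) := by nth_rewrite 2 [hl]; group
  rw [this, r.h_w, r.h_w, r.w_mul_w]; simp

theorem h_neg (s : Rˣ) : hl x y s * hl x y (-s) = hl x y (-s ^ 2) := by
  have : hl x y s * hl x y (-s) = wl x y s * wl x y (-1) * (wl x y s)⁻¹ * wl x y (-1) := by
    simp only [hl, r.w_neg]; group
  rw [this, r.w_conj_w, hl]; simp

theorem h_one_sub (u t : Rˣ) (h : (u : R) + t = 1) : hl x y u * hl x y t = hl x y (u * t) := by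
  have key : ∀ (v : Rˣ) s, x v * y s * x (-v) = y ((v⁻¹ : Rˣ) : R) * x (-(v : R) ^ 2 * s) *
      y (-((v⁻¹ : Rˣ) : R)) := by
    intro v s
    have e : x v = y ((v⁻¹ : Rˣ) : R) * wl x y v * y ((v⁻¹ : Rˣ) : R) := r.x_eq v
    rw [← r.wy, r.x_neg, e, r.y_neg]
    have : y ((v⁻¹ : Rˣ) : R) * y s = y s * y ((v⁻¹ : Rˣ) : R) := by
      rw [← r.y_add, add_comm, r.y_add]
    calc _ = y ((v⁻¹ : Rˣ) : R) * wl x y v * (y ((v⁻¹ : Rˣ) : R) * y s) * (y ((v⁻¹ : Rˣ) : R))⁻¹ *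
          (wl x y v)⁻¹ * (y ((v⁻¹ : Rˣ) : R))⁻¹ := by group
      _ = _ := by rw [this]; group
  have hw : wl x y u * wl x y (-1) * wl x y t = wl x y (u * t) := by
    have iu : ((u⁻¹ : Rˣ) : R) * u = 1 := u.inv_mul
    have it : ((t⁻¹ : Rˣ) : R) * t = 1 := t.inv_mul
    have a1 : y (-((u⁻¹ : Rˣ) : R)) * y 1 = y (-((u⁻¹ : Rˣ) : R) * t) := by
      rw [← r.y_add]; congr 1; linear_combination -iu + ((u⁻¹ : Rˣ) : R) * h
    have a2 : y 1 * y (-((t⁻¹ : Rˣ) : R)) = y (-((t⁻¹ : Rˣ) : R) * u) := by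
      rw [← r.y_add]; congr 1; linear_combination -it + ((t⁻¹ : Rˣ) : R) * h
    have a3 : x u * x (-1) = x (-t) := by
      rw [← r.x_add]; congr 1; linear_combination h
    have k1 := key u (-((u⁻¹ : Rˣ) : R) * t)
    have k2 := key (-t) (-((t⁻¹ : Rˣ) : R) * u)
    have b1 : -(u : R) ^ 2 * (-((u⁻¹ : Rˣ) : R) * t) = (u * t : Rˣ) := by
      rw [Units.val_mul]; linear_combination (u * t : R) * iu
    have b2 : -((-t : Rˣ) : R) ^ 2 * (-((t⁻¹ : Rˣ) : R) * u) = (u * t : Rˣ) := by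
      rw [Units.val_mul, Units.val_neg]; linear_combination (u * t : R) * it
    have b3 : y (-((u⁻¹ : Rˣ) : R)) * y (-((t⁻¹ : Rˣ) : R)) = y (-(((u * t)⁻¹ : Rˣ) : R)) := by
      rw [← r.y_add, mul_inv, Units.val_mul]; congr 1
      linear_combination -((u⁻¹ : Rˣ) : R) * ((t⁻¹ : Rˣ) : R) * h + ((t⁻¹ : Rˣ) : R) * iu +
        ((u⁻¹ : Rˣ) : R) * it
    rw [b1] at k1
    rw [b2, inv_neg, Units.val_neg, Units.val_neg, neg_neg, neg_neg] at k2
    have w1 : wl x y (-1) = y 1 * x (-1) * y 1 := by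
      rw [r.w_eq_y]; simp
    calc wl x y u * wl x y (-1) * wl x y t
        = y (-((u⁻¹ : Rˣ) : R)) * x u * (y (-((u⁻¹ : Rˣ) : R)) * y 1) * x (-1) *
          (y 1 * y (-((t⁻¹ : Rˣ) : R))) * x t * y (-((t⁻¹ : Rˣ) : R)) := by
            rw [w1, r.w_eq_y u, r.w_eq_y t]; group
      _ = y (-((u⁻¹ : Rˣ) : R)) * (x u * y (-((u⁻¹ : Rˣ) : R) * t) * x (-u)) * (x u * x (-1)) *
          y (-((t⁻¹ : Rˣ) : R) * u) * x t * y (-((t⁻¹ : Rˣ) : R)) := by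
            rw [a1, a2, r.x_neg u]; group
      _ = y (-((u⁻¹ : Rˣ) : R)) * (x u * y (-((u⁻¹ : Rˣ) : R) * t) * x (-u)) *
          (x (-t) * y (-((t⁻¹ : Rˣ) : R) * u) * x t) * y (-((t⁻¹ : Rˣ) : R)) := by
            rw [a3]; group
      _ = x (u * t : Rˣ) * (y (-((u⁻¹ : Rˣ) : R)) * y (-((t⁻¹ : Rˣ) : R))) * x (u * t : Rˣ) := by
            rw [k1, k2, r.y_neg, r.y_neg]; group
      _ = _ := by rw [b3, wl]
  rw [hl, hl, ← mul_assoc, hw, hl]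

/-- Both ways of splitting the first parameter give the same torus element. -/
theorem split_eq {a1 a2 u1 u2 : Rˣ} {b : R} (h2 : (u2 : R) = 1 + a2 * b)
    (h1 : (u1 * u2 : Rˣ) = 1 + ((a1 : R) + a2) * b) :
    (y (((u1 * u2)⁻¹ : Rˣ) * b))⁻¹ * (x (a1 + a2) * y b) *
      (x (((u1 * u2)⁻¹ : Rˣ) * (a1 + a2)))⁻¹ =
    hl x y a1 * (hl x y (a1 * u1⁻¹))⁻¹ * (hl x y a2 * (hl x y (a2 * u2⁻¹))⁻¹) := by
  have e2 := r.x_y_unit_left a2 u2 b h2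
  have i2 : ((u2⁻¹ : Rˣ) : R) * u2 = 1 := u2.inv_mul
  have i1 : ((u1⁻¹ : Rˣ) : R) * u1 = 1 := u1.inv_mul
  rw [Units.val_mul] at h1
  have e1 := r.x_y_unit_left a1 u1 (((u2⁻¹ : Rˣ) : R) * b) (by
    linear_combination ((u2⁻¹ : Rˣ) : R) * h1 - ((u2⁻¹ : Rˣ) : R) * h2 + (1 - (u1 : R)) * i2)
  rw [r.w_mul_w, neg_neg] at e1 e2
  have c1 : x (((u1⁻¹ : Rˣ) : R) * a1) * (hl x y a2 * (hl x y (a2 * u2⁻¹))⁻¹) =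
      (hl x y a2 * (hl x y (a2 * u2⁻¹))⁻¹) * x (((u2⁻¹ : Rˣ) : R) ^ 2 * ((u1⁻¹ : Rˣ) * a1)) := by
    have f1 := r.h_x a2 (((a2⁻¹ : Rˣ) : R) ^ 2 * ((u1⁻¹ : Rˣ) * a1))
    have f2 := r.h_x (a2 * u2⁻¹) (((u2⁻¹ : Rˣ) : R) ^ 2 * ((u1⁻¹ : Rˣ) * a1))
    have f3 := r.h_x (a2 * u2⁻¹) (((a2⁻¹ : Rˣ) : R) ^ 2 * ((u1⁻¹ : Rˣ) * a1))
    have e4 : ((a2 * u2⁻¹ : Rˣ) : R) ^ 2 * (((a2⁻¹ : Rˣ) : R) ^ 2 * ((u1⁻¹ : Rˣ) * a1)) =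
        ((u2⁻¹ : Rˣ) : R) ^ 2 * ((u1⁻¹ : Rˣ) * a1) := by
      rw [← mul_assoc, ← mul_pow, ← Units.val_mul, mul_right_comm, mul_inv_cancel, one_mul]
    have e5 : (a2 : R) ^ 2 * (((a2⁻¹ : Rˣ) : R) ^ 2 * ((u1⁻¹ : Rˣ) * a1)) = (u1⁻¹ : Rˣ) * a1 := by
      rw [← mul_assoc, ← mul_pow, Units.mul_inv, one_pow, one_mul]
    rw [e4] at f3
    rw [e5] at f1
    rw [← mul_assoc, ← f1, mul_assoc, mul_assoc, ← mul_inv_eq_iff_eq_mul.2 f3]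
    group
  have c2 : ((u2⁻¹ : Rˣ) : R) ^ 2 * ((u1⁻¹ : Rˣ) * a1) + ((u2⁻¹ : Rˣ) : R) * a2 =
      ((u1 * u2)⁻¹ : Rˣ) * (a1 + a2) := by
    rw [mul_inv, Units.val_mul]
    have i1' : (u1 : R) * ((u1⁻¹ : Rˣ) : R) = 1 := u1.mul_inv
    have i2' : (u2 : R) * ((u2⁻¹ : Rˣ) : R) = 1 := u2.mul_inv
    refine (u1 * u2 * u2).isUnit.mul_left_cancel ?_
    rw [Units.val_mul, Units.val_mul]
    trans (u1 : R) * u2 * a2 + a1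
    · linear_combination (a1 * u1 * ((u1⁻¹ : Rˣ) : R) * (u2 * ((u2⁻¹ : Rˣ) : R) + 1) + u1 * u2 * a2) * i2' + (a1 : R) * i1'
    · linear_combination (-(u1 : R) * ((u1⁻¹ : Rˣ) : R) * u2 * (a1 + a2)) * i2' - (u2 : R) * (a1 + a2) * i1' +
        (a2 : R) * h1 - (a1 + a2 : R) * h2
  have step : x (a1 + a2) * y b = x a1 * y (((u2⁻¹ : Rˣ) : R) * b) *
      (hl x y a2 * (hl x y (a2 * u2⁻¹))⁻¹) * x (((u2⁻¹ : Rˣ) : R) * a2) := by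
    rw [r.x_add, mul_assoc (x _), e2]
    simp only [mul_assoc]
  have step2 : x (a1 + a2) * y b = y (((u1 * u2)⁻¹ : Rˣ) * b) *
      (hl x y a1 * (hl x y (a1 * u1⁻¹))⁻¹ * (hl x y a2 * (hl x y (a2 * u2⁻¹))⁻¹)) *
      x (((u1 * u2)⁻¹ : Rˣ) * (a1 + a2)) := by
    rw [step, e1, mul_assoc _ (x _) (hl x y a2 * _), c1, ← c2, r.x_add, mul_inv, Units.val_mul,
      mul_assoc ((u1⁻¹ : Rˣ) : R)]
    simp only [mul_assoc]
  rw [step2]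
  group

end Rank1

end Symbols

section UnitsModPrimePower

theorem two_pow_units (k : ℕ) : ∃ ζ : (ZMod (2 ^ (k + 2)))ˣ, (ζ : ZMod (2 ^ (k + 2))) = 5 ∧
    ∀ u : (ZMod (2 ^ (k + 2)))ˣ, ∃ j : ℕ, u = ζ ^ j ∨ u = -ζ ^ j := by
  have hco : Nat.Coprime 5 (2 ^ (k + 2)) := Nat.Coprime.pow_right _ (by norm_num)
  have hζ : ((ZMod.unitOfCoprime 5 hco : (ZMod (2 ^ (k + 2)))ˣ) : ZMod (2 ^ (k + 2))) = 5 := by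
    rw [ZMod.coe_unitOfCoprime]; norm_cast
  refine ⟨ZMod.unitOfCoprime 5 hco, hζ, ?_⟩
  generalize ZMod.unitOfCoprime 5 hco = ζ at hζ
  have hord : Nat.card (Subgroup.zpowers ζ) = 2 ^ k := by
    rw [Nat.card_zpowers, ← orderOf_units, hζ, ZMod.orderOf_five]
  have hidx : (Subgroup.zpowers ζ).index = 2 := by
    have h1 := (Subgroup.zpowers ζ).card_mul_index
    rw [hord, Nat.card_eq_fintype_card, ZMod.card_units_eq_totient,
      Nat.totient_prime_pow_succ Nat.prime_two] at h1
    have h2 : 0 < 2 ^ k := by positivity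
    exact Nat.eq_of_mul_eq_mul_left h2 (h1.trans (by simp [pow_succ]))
  have hneg : (-1 : (ZMod (2 ^ (k + 2)))ˣ) ∉ Subgroup.zpowers ζ := by
    intro h
    have hd : 4 ∣ 2 ^ (k + 2) := Dvd.intro_left (2 ^ k) (by rw [pow_add]; rfl)
    let f : (ZMod (2 ^ (k + 2)))ˣ →* (ZMod 4)ˣ := Units.map (ZMod.castHom hd (ZMod 4)).toMonoidHom
    have hf : f ζ = 1 := by
      ext
      change ZMod.castHom hd (ZMod 4) (ζ : ZMod _) = 1
      rw [hζ, map_ofNat]; rfl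
    have h1 : f (-1) = 1 := by
      obtain ⟨j, hj⟩ := h
      rw [← hj]; simp [hf]
    have h2 : ZMod.castHom hd (ZMod 4) (-1) = 1 := congrArg Units.val h1
    rw [map_neg, map_one] at h2
    exact absurd h2 (by decide)
  have hpow : ∀ u ∈ Subgroup.zpowers ζ, ∃ j : ℕ, u = ζ ^ j := fun u hu => by
    obtain ⟨j, hj⟩ := mem_powers_iff_mem_zpowers.2 hu
    exact ⟨j, hj.symm⟩
  intro u
  by_cases hu : u ∈ Subgroup.zpowers ζ
  · obtain ⟨j, hj⟩ := hpow u hu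
    exact ⟨j, Or.inl hj⟩
  · have := (Subgroup.mul_mem_iff_of_index_two hidx (a := -1) (b := u)).2 (by simp [hneg, hu])
    obtain ⟨j, hj⟩ := hpow _ this
    exact ⟨j, Or.inr (by rw [← hj]; simp)⟩

/-- Square classes of the units modulo a power of two, in terms of `-1` and `3`. -/
theorem two_pow_classes (k : ℕ) : ∃ τ s : (ZMod (2 ^ (k + 2)))ˣ, (τ : ZMod (2 ^ (k + 2))) = 3 ∧
    (5 : ZMod (2 ^ (k + 2))) = -3 * (s : ZMod (2 ^ (k + 2))) ^ 2 ∧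
    ∀ u : (ZMod (2 ^ (k + 2)))ˣ, ∃ s,
      u = s ^ 2 ∨ u = -s ^ 2 ∨ u = τ * s ^ 2 ∨ u = -τ * s ^ 2 := by
  obtain ⟨ζ, hζ, hu⟩ := two_pow_units k
  have hco : Nat.Coprime 3 (2 ^ (k + 2)) := Nat.Coprime.pow_right _ (by norm_num)
  have hτ : ((ZMod.unitOfCoprime 3 hco : (ZMod (2 ^ (k + 2)))ˣ) : ZMod (2 ^ (k + 2))) = 3 := by
    rw [ZMod.coe_unitOfCoprime]; norm_cast
  generalize ZMod.unitOfCoprime 3 hco = τ at hτ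
  have key : ∃ s, ζ = -τ * s ^ 2 := by
    rcases Nat.eq_zero_or_pos k with rfl | hk
    · exact ⟨1, by ext; simp only [Units.val_mul, Units.val_neg, hτ, hζ]; simp; decide⟩
    have hd : 8 ∣ 2 ^ (k + 2) := by
      obtain ⟨m, rfl⟩ := Nat.exists_eq_succ_of_ne_zero hk.ne'
      exact Dvd.intro_left (2 ^ m) (by rw [Nat.succ_eq_add_one]; ring)
    let f := ZMod.castHom hd (ZMod 8)
    have hf5 : f (ζ : ZMod _) = 5 := by rw [hζ, map_ofNat]
    have hf3 : f (τ : ZMod _) = 3 := by rw [hτ, map_ofNat]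
    have h5 : ∀ i : ℕ, (5 : ZMod 8) ^ (2 * i) = 1 := fun i => by
      rw [pow_mul, show (5 : ZMod 8) ^ 2 = 1 by decide, one_pow]
    obtain ⟨j, hj⟩ := hu τ
    have hj' : (3 : ZMod 8) = 5 ^ j ∨ (3 : ZMod 8) = -5 ^ j := by
      refine hj.imp (fun h => ?_) (fun h => ?_)
      · rw [← hf3, h, ← hf5]; simp
      · rw [← hf3, h, ← hf5]; simp
    obtain ⟨i, rfl | rfl⟩ := Nat.even_or_odd' j
    · rw [h5] at hj'
      exact absurd hj' (by decide)
    · rw [pow_succ, h5] at hj'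
      rcases hj with hj | hj
      · have : (3 : ZMod 8) = 5 := by
          rw [← hf3, hj, ← hf5]
          simp only [Units.val_pow_eq_pow_val, map_pow, hf5]
          rw [pow_succ, h5, one_mul]
        exact absurd this (by decide)
      · refine ⟨(ζ ^ i)⁻¹, ?_⟩
        rw [hj, neg_neg, pow_succ ζ, mul_comm 2 i, pow_mul, mul_right_comm, ← mul_pow,
          mul_inv_cancel, one_pow, one_mul]
  obtain ⟨s, hs⟩ := key
  refine ⟨τ, s, hτ, ?_, fun u => ?_⟩
  · have := congrArg Units.val hs
    simpa [hτ, hζ] using this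
  · obtain ⟨j, hj⟩ := hu u
    obtain ⟨i, rfl | rfl⟩ := Nat.even_or_odd' j
    · refine ⟨ζ ^ i, ?_⟩
      rw [mul_comm 2 i, pow_mul] at hj
      tauto
    · refine ⟨s * ζ ^ i, ?_⟩
      have : ζ ^ (2 * i + 1) = -τ * (s * ζ ^ i) ^ 2 := by
        rw [mul_pow, ← mul_assoc, ← hs, pow_succ ζ, mul_comm 2 i, pow_mul, mul_comm]
      rw [this, neg_mul, neg_neg] at hj
      rw [neg_mul]; tauto

/-- Modulo an odd prime power, some two elements of the nontrivial square class have sum one, or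
they are negatives of one another. -/
theorem odd_pow_classes {p : ℕ} (hp : p.Prime) (hp2 : p ≠ 2) (k : ℕ) :
    ∃ ζ : (ZMod (p ^ (k + 1)))ˣ, (∀ u, ∃ j : ℕ, u = ζ ^ j) ∧
      (∀ u, ∃ s, u = s ^ 2 ∨ u = ζ * s ^ 2) ∧
      ∃ s t : (ZMod (p ^ (k + 1)))ˣ, ((ζ * s ^ 2 : (ZMod (p ^ (k + 1)))ˣ) : ZMod (p ^ (k + 1))) +
        ((ζ * t ^ 2 : (ZMod (p ^ (k + 1)))ˣ) : ZMod (p ^ (k + 1))) = 1 ∨ ζ * t ^ 2 = -(ζ * s ^ 2) := by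
  have : IsCyclic (ZMod (p ^ (k + 1)))ˣ := ZMod.isCyclic_units_of_prime_pow p hp hp2 _
  have : NeZero (p ^ (k + 1)) := ⟨pow_ne_zero _ hp.ne_zero⟩
  have : Fact p.Prime := ⟨hp⟩
  obtain ⟨ζ, hζ⟩ := IsCyclic.exists_generator (α := (ZMod (p ^ (k + 1)))ˣ)
  have hpow : ∀ u, ∃ j : ℕ, u = ζ ^ j := fun u => by
    obtain ⟨j, hj⟩ := mem_powers_iff_mem_zpowers.2 (hζ u)
    exact ⟨j, hj.symm⟩
  have hcl : ∀ u, ∃ s, u = s ^ 2 ∨ u = ζ * s ^ 2 := fun u => by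
    obtain ⟨j, rfl⟩ := hpow u
    obtain ⟨i, rfl | rfl⟩ := Nat.even_or_odd' j
    · exact ⟨ζ ^ i, Or.inl (by rw [← pow_mul, mul_comm])⟩
    · exact ⟨ζ ^ i, Or.inr (by rw [← pow_mul, mul_comm i, pow_succ ζ, mul_comm])⟩
  refine ⟨ζ, hpow, hcl, ?_⟩
  obtain ⟨b, hb | hb⟩ := hcl (-1)
  · exact ⟨1, b, Or.inr (by rw [← hb]; simp)⟩
  by_cases hn : ∃ a : (ZMod (p ^ (k + 1)))ˣ, -1 = a ^ 2
  · obtain ⟨a, ha⟩ := hn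
    exact ⟨1, a, Or.inr (by rw [← ha]; simp)⟩
  have hex : ∃ ν : ℕ, 1 ≤ ν ∧ ¬∃ s : (ZMod (p ^ (k + 1)))ˣ, (ν : ZMod (p ^ (k + 1))) = s ^ 2 := by
    refine ⟨p, hp.one_le, ?_⟩
    rintro ⟨s, hs⟩
    have h1 : IsUnit ((p : ℕ) : ZMod (p ^ (k + 1))) := by rw [hs]; exact s.isUnit.pow 2
    rw [ZMod.isUnit_iff_coprime] at h1
    exact hp.one_lt.ne' (Nat.Coprime.eq_one_of_dvd h1 (dvd_pow_self p (Nat.succ_ne_zero k)))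
  classical
  obtain ⟨hν1, hν⟩ := Nat.find_spec hex
  have hmin := fun m => Nat.find_min hex (m := m)
  generalize Nat.find hex = ν at hν1 hν hmin
  have hν2 : 2 ≤ ν := by
    by_contra h
    have : ν = 1 := by omega
    exact hν ⟨1, by simp [this]⟩
  have hpred : ∀ m, 1 ≤ m → m < ν → ∃ s : (ZMod (p ^ (k + 1)))ˣ, (m : ZMod (p ^ (k + 1))) = s ^ 2 :=
    fun m h1 h2 => by
      by_contra h3
      exact hmin m h2 ⟨h1, h3⟩
  obtain ⟨s, hs⟩ := hpred (ν - 1) (by omega) (by omega)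
  rw [Nat.cast_sub (by omega), Nat.cast_one] at hs
  have hu : IsUnit (ν : ZMod (p ^ (k + 1))) := by
    by_contra hnu
    rw [ZMod.isUnit_iff_coprime, Nat.coprime_pow_right_iff (Nat.succ_pos k), Nat.coprime_comm,
      hp.coprime_iff_not_dvd, not_not] at hnu
    have hpν : p ≤ ν := Nat.le_of_dvd (by omega) hnu
    obtain ⟨a, ha⟩ := hpred (p - 1) (by have := hp.two_le; omega) (by have := hp.two_le; omega)
    rw [Nat.cast_sub hp.one_le, Nat.cast_one] at ha
    have hodd : Odd (p ^ k) := (hp.odd_of_ne_two hp2).pow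
    have h1 : (-a ^ 2 : (ZMod (p ^ (k + 1)))ˣ) ^ p ^ k = 1 := by
      have := dvd_sub_pow_of_dvd_sub (R := ZMod (p ^ (k + 1))) (p := p) (a := -(a : ZMod (p ^ (k + 1))) ^ 2)
        (b := 1) ⟨-1, by rw [← ha]; ring⟩ k
      rw [← Nat.cast_pow, ZMod.natCast_self, zero_dvd_iff, sub_eq_zero, one_pow] at this
      ext
      simpa using this
    rw [hodd.neg_pow, ← pow_mul] at h1
    exact hn ⟨a ^ p ^ k, by rw [← pow_mul, mul_comm (p ^ k), ← h1, neg_neg]⟩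
  obtain ⟨u, hu⟩ := hu
  obtain ⟨c, hc | hc⟩ := hcl u
  · exact absurd ⟨c, by rw [← hu, hc]; simp⟩ hν
  · refine ⟨c, b * s, Or.inl ?_⟩
    rw [← hc, hu, mul_pow, ← mul_assoc, ← hb]
    simp only [Units.val_mul, Units.val_neg, Units.val_one, Units.val_pow_eq_pow_val]
    rw [← hs]; ring

end UnitsModPrimePower

section SymbolBound

/-- The symbol measuring the failure of `hl` to be multiplicative. -/
def sy {R E : Type} [CommRing R] [Group E] (x y : R → E) (s t : Rˣ) : E :=
  hl x y s * hl x y t * (hl x y (s * t))⁻¹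

namespace Rank1

variable {R E : Type} [CommRing R] [Group E] {x y : R → E} (r : Rank1 x y)
include r

theorem commute_hl (hc : ∀ s t, sy x y s t ∈ Subgroup.center E) {ζ : Rˣ}
    (hζ : ∀ u : Rˣ, ∃ j : ℕ, u = ζ ^ j ∨ u = -ζ ^ j) (s t : Rˣ) :
    Commute (hl x y s) (hl x y t) := by
  have hneg : ∀ t, Commute (hl x y (-1)) (hl x y t) := fun t => by
    have := r.h_h (-1) t
    rw [neg_one_sq, one_mul, r.hl_one, inv_one, mul_one] at this
    exact mul_inv_eq_iff_eq_mul.1 this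
  have hmul : ∀ g s t, Commute g (hl x y s) → Commute g (hl x y t) →
      Commute g (hl x y (s * t)) := fun g s t h1 h2 => by
    have h3 : Commute g (sy x y s t) := (Subgroup.mem_center_iff.1 (hc s t) g)
    have : hl x y (s * t) = (sy x y s t)⁻¹ * (hl x y s * hl x y t) := by rw [sy]; group
    rw [this]
    exact h3.inv_right.mul_right (h1.mul_right h2)
  have hpow : ∀ g, Commute g (hl x y ζ) → Commute g (hl x y (-1)) → ∀ u,
      Commute g (hl x y u) := fun g h1 h2 u => by
    have h3 : ∀ j : ℕ, Commute g (hl x y (ζ ^ j)) := fun j => by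
      induction j with
      | zero => rw [pow_zero, r.hl_one]; exact Commute.one_right g
      | succ j ih => rw [pow_succ]; exact hmul _ _ _ ih h1
    obtain ⟨j, rfl | rfl⟩ := hζ u
    · exact h3 j
    · rw [← neg_one_mul]; exact hmul _ _ _ h2 (h3 j)
  refine hpow _ ?_ (hneg s).symm t
  exact (hpow _ (Commute.refl _) (hneg ζ).symm s).symm

/-- The torus function in a commutative torus. -/
theorem exists_symbFn (hcomm : ∀ s t, Commute (hl x y s) (hl x y t)) :
    ∃ (A : Type) (_ : AddCommGroup A) (φ : Rˣ → A) (ι : Multiplicative A →* E), SymbFn φ ∧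
      Function.Injective ι ∧ ∀ u, ι (Multiplicative.ofAdd (φ u)) = hl x y u := by
  let _ : CommGroup (Hs x y) :=
    { (inferInstance : Group (Hs x y)) with
      mul_comm := (Subgroup.isMulCommutative_closure (by
        rintro _ ⟨s, rfl⟩ _ ⟨t, rfl⟩; exact hcomm s t)).is_comm.comm }
  let φ : Rˣ → Additive (Hs x y) := fun u =>
    Additive.ofMul ⟨hl x y u, Subgroup.subset_closure ⟨u, rfl⟩⟩
  refine ⟨Additive (Hs x y), inferInstance, φ, (Hs x y).subtype, ⟨?_, ?_, ?_⟩,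
    Subtype.val_injective, fun u => rfl⟩
  · exact Subtype.ext r.hl_one
  · intro t s
    refine Subtype.ext ?_
    have := r.h_h s t
    rw [(hcomm s t).eq, mul_inv_cancel_right, eq_mul_inv_iff_mul_eq, mul_comm (s ^ 2)] at this
    exact this.symm
  · intro s
    exact Subtype.ext (r.h_neg s)

theorem symbols_odd (hc : ∀ s t, sy x y s t ∈ Subgroup.center E) {ζ : Rˣ}
    (hζ : ∀ u : Rˣ, ∃ j : ℕ, u = ζ ^ j) (hcl : ∀ u : Rˣ, ∃ s, u = s ^ 2 ∨ u = ζ * s ^ 2)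
    {s t : Rˣ} (hst : ((ζ * s ^ 2 : Rˣ) : R) + ((ζ * t ^ 2 : Rˣ) : R) = 1 ∨
      ζ * t ^ 2 = -(ζ * s ^ 2)) (u v : Rˣ) : sy x y u v = 1 := by
  obtain ⟨A, _, φ, ι, hφ, hι, hu⟩ := r.exists_symbFn (r.commute_hl hc fun u => by
    obtain ⟨j, hj⟩ := hζ u; exact ⟨j, Or.inl hj⟩)
  have key : φ (ζ * s ^ 2) + φ (ζ * t ^ 2) = φ (ζ * s ^ 2 * (ζ * t ^ 2)) := by
    refine Multiplicative.ofAdd.injective (hι ?_)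
    rw [ofAdd_add, _root_.map_mul, hu, hu, hu]
    rcases hst with h | h
    · exact r.h_one_sub _ _ h
    · rw [h, r.h_neg, mul_neg, pow_two]
  have := hφ.trivial_of_cyclic ζ hcl key u v
  rw [sy, ← hu, ← hu, ← hu, ← _root_.map_mul, ← ofAdd_add, this, mul_inv_cancel]

omit r in
theorem symbols_two {k : ℕ} {x y : ZMod (2 ^ (k + 2)) → E} (r : Rank1 x y)
    (hc : ∀ s t, sy x y s t ∈ Subgroup.center E) :
    ∃ e : E, e ^ 2 = 1 ∧ ∀ u v, sy x y u v ∈ Subgroup.zpowers e := by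
  obtain ⟨ζ, -, hζ⟩ := two_pow_units k
  obtain ⟨τ, s, h3, h5, hcl⟩ := two_pow_classes k
  obtain ⟨A, _, φ, ι, hφ, hι, hu⟩ := r.exists_symbFn (r.commute_hl hc hζ)
  have conv : ∀ {a1 a2 u1 u2 a1' a2' u1' u2' : (ZMod (2 ^ (k + 2)))ˣ} {b : ZMod (2 ^ (k + 2))}
      (_ : (u2 : ZMod (2 ^ (k + 2))) = 1 + a2 * b)
      (_ : (u1 * u2 : (ZMod (2 ^ (k + 2)))ˣ) = 1 + ((a1 : ZMod (2 ^ (k + 2))) + a2) * b)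
      (_ : (u2' : ZMod (2 ^ (k + 2))) = 1 + a2' * b)
      (_ : (u1' * u2' : (ZMod (2 ^ (k + 2)))ˣ) = 1 + ((a1' : ZMod (2 ^ (k + 2))) + a2') * b)
      (_ : (a1 + a2 : ZMod (2 ^ (k + 2))) = a1' + a2'),
      φ a1 - φ (a1 * u1⁻¹) + (φ a2 - φ (a2 * u2⁻¹)) =
      φ a1' - φ (a1' * u1'⁻¹) + (φ a2' - φ (a2' * u2'⁻¹)) := by
    intro a1 a2 u1 u2 a1' a2' u1' u2' b c1 c2 c3 c4 c5
    have d1 := r.split_eq c1 c2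
    have d2 := r.split_eq c3 c4
    have d3 : u1 * u2 = u1' * u2' := Units.ext (by rw [c2, c4, c5])
    rw [c5, d3] at d1
    refine Multiplicative.ofAdd.injective (hι ?_)
    simp only [ofAdd_add, ofAdd_sub, _root_.map_mul, map_inv ι, hu, div_eq_mul_inv]
    exact d1.symm.trans d2
  obtain ⟨m2, hm⟩ := hφ.two_adic τ s hcl
    (conv (b := -2) (a1 := 1) (a2 := 1) (u1 := τ) (u2 := -1) (a1' := τ) (a2' := -1) (u1' := -1)
      (u2' := τ)
      (by simp; norm_num) (by simp [h3]; norm_num) (by simp [h3]; norm_num) (by simp [h3]; norm_num)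
      (by simp [h3]; norm_num))
    (conv (b := 2) (a1 := 1) (a2 := 1) (u1 := -s ^ 2) (u2 := τ) (a1' := τ) (a2' := -1)
      (u1' := τ * s ^ 2) (u2' := -1)
      (by simp [h3]; norm_num) (by simp [h3]; linear_combination -h5) (by simp; norm_num)
      (by simp [h3]; linear_combination -h5) (by simp [h3]; norm_num))
  refine ⟨ι (Multiplicative.ofAdd (φ τ + φ τ - φ (τ ^ 2))), ?_, fun u v => ?_⟩
  · rw [← map_pow, ← ofAdd_nsmul, m2]; simp
  · have : sy x y u v = ι (Multiplicative.ofAdd (φ u + φ v - φ (u * v))) := by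
      rw [ofAdd_sub, ofAdd_add, map_div, _root_.map_mul, hu, hu, hu, sy, div_eq_mul_inv]
    rw [this]
    rcases hm u v with h | h
    · rw [h]; simp
    · rw [h]; exact Subgroup.mem_zpowers _

omit r in
/-- The symbols modulo a prime power generate a group of order at most two, or one. -/
theorem symbols {p : ℕ} (hp : p.Prime) {n k : ℕ} (hn : n = p ^ (k + 1)) {x y : ZMod n → E}
    (r : Rank1 x y) (hc : ∀ s t, sy x y s t ∈ Subgroup.center E) :
    ∃ e : E, e ^ (if 4 ∣ n then 2 else 1) = 1 ∧
      ∀ u v, sy x y u v ∈ Subgroup.zpowers e := by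
  subst hn
  by_cases hp2 : p = 2
  · subst hp2
    obtain rfl | ⟨k, rfl⟩ : k = 0 ∨ ∃ m, k = m + 1 := by cases k <;> simp
    · refine ⟨1, one_pow _, fun u v => ?_⟩
      have hu : ∀ u : (ZMod (2 ^ (0 + 1)))ˣ, u = 1 := by decide
      rw [hu u, hu v, sy, mul_one, r.hl_one]; simp
    · rw [if_pos (Dvd.intro_left (2 ^ k) (by rw [pow_add, pow_add, mul_assoc]; rfl))]
      exact r.symbols_two hc
  · obtain ⟨ζ, h1, h2, s, t, h3⟩ := odd_pow_classes hp hp2 k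
    exact ⟨1, one_pow _, fun u v => by rw [r.symbols_odd hc h1 h2 h3]; exact one_mem _⟩

end Rank1

end SymbolBound

section PowerMod

variable {n : ℕ} [NeZero n] {E : Type} [Group E]

/-- Powers with exponent a residue class. -/
def pw (g : E) (c : ZMod n) : E := g ^ c.val

theorem pw_natCast {g : E} (hg : g ^ n = 1) (k : ℕ) : pw g (k : ZMod n) = g ^ k := by
  rw [pw, ZMod.val_natCast]
  conv_rhs => rw [← Nat.mod_add_div k n, pow_add, pow_mul, hg, one_pow, mul_one]

theorem pw_add {g : E} (hg : g ^ n = 1) (a b : ZMod n) : pw g (a + b) = pw g a * pw g b := by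
  have : a + b = ((a.val + b.val : ℕ) : ZMod n) := by simp
  rw [this, pw_natCast hg, pow_add]; rfl

theorem pw_zero (g : E) : pw g (0 : ZMod n) = 1 := by rw [pw, ZMod.val_zero, pow_zero]

theorem pw_one {g : E} (hg : g ^ n = 1) : pw g (1 : ZMod n) = g := by
  simpa using pw_natCast hg 1

theorem pw_neg {g : E} (hg : g ^ n = 1) (a : ZMod n) : pw g (-a) = (pw g a)⁻¹ := by
  rw [eq_inv_iff_mul_eq_one, ← pw_add hg, neg_add_cancel, pw_zero]

theorem pw_pw {g : E} (hg : g ^ n = 1) (a b : ZMod n) : pw (pw g a) b = pw g (a * b) := by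
  have : a * b = ((a.val * b.val : ℕ) : ZMod n) := by simp
  rw [this, pw_natCast hg, pow_mul]; rfl

theorem pw_conj (z g : E) (a : ZMod n) : z * pw g a * z⁻¹ = pw (z * g * z⁻¹) a := by
  rw [pw, pw, conj_pow]

theorem pw_mem {g : E} {P : Subgroup E} (h : g ∈ P) (a : ZMod n) : pw g a ∈ P := P.pow_mem h _

end PowerMod

section FrameRelations

variable {l : Type} [Fintype l] [DecidableEq l] {n : ℕ} [NeZero n] [IsLocalRing (ZMod n)]
variable {E : Type} [Group E]
variable {π : E →* symplecticGroup l (ZMod n)} {q : (l ⊕ l → ZMod n) → E}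
variable {u v w : l ⊕ l → ZMod n}

/-- A pair of vectors which is part of a `Tri` triple. -/
def Fr {R : Type} [CommRing R] (u v : l ⊕ l → R) : Prop := ∃ w, Tri u v w

theorem Fr.symm {R : Type} [CommRing R] {u v : l ⊕ l → R} : Fr u v → Fr v u :=
  fun ⟨w, t⟩ => ⟨w, t.swap12⟩

theorem Fr.uni {R : Type} [CommRing R] [IsLocalRing R] {u v : l ⊕ l → R} : Fr u v → Uni u :=
  fun ⟨_, t⟩ => t.uni

theorem Fr.om_eq {R : Type} [CommRing R] {u v : l ⊕ l → R} : Fr u v → om u v = 0 :=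
  fun ⟨_, t⟩ => t.om12

theorem Fr.smul {R : Type} [CommRing R] {u v : l ⊕ l → R} (f : Fr u v) (c : Rˣ) :
    Fr ((c : R) • u) v := f.imp fun _ t => t.smul c

/-- A `QLift` along a central extension. -/
structure FLift (π : E →* symplecticGroup l (ZMod n)) (q : (l ⊕ l → ZMod n) → E) : Prop
    extends QLift π q where
  surj : Function.Surjective π
  cent : π.ker ≤ Subgroup.center E

namespace FLift

variable (h : FLift π q)
include h

theorem q_pow (f : Fr u v) : q u ^ n = 1 := by
  obtain ⟨w, t⟩ := f
  exact (h.quadratic h.surj h.cent t.swap12).1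

theorem b_pow (f : Fr u v) : bq q u v ^ n = 1 := by
  obtain ⟨w, t⟩ := f
  exact (h.quadratic h.surj h.cent t).2.1

theorem b_symm (f : Fr u v) : bq q u v = bq q v u := by
  rw [bq, bq, add_comm, mul_assoc, mul_assoc,
    ((h.commute f.uni f.symm.uni f.om_eq).inv_inv).eq]

theorem b_equi (f : Fr u v) (z : E) :
    z * bq q u v * z⁻¹ = bq q (ac (π z) u) (ac (π z) v) := by
  have u1 : Uni (u + v) := by obtain ⟨w, t⟩ := f; exact t.uniAdd
  rw [bq, bq, ← map_add, ← h.equi z _ u1, ← h.equi z _ f.uni, ← h.equi z _ f.symm.uni]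
  group

theorem q_add (f : Fr u v) (c : ZMod n) :
    q (u + c • v) = q u * pw (bq q u v) c * pw (q v) (c ^ 2) := by
  have hv := h.q_pow f.symm
  obtain ⟨w, t⟩ := f
  have h1 := (h.quadratic h.surj h.cent t).2.2.1 c.val
  have e : c ^ 2 = ((c.val ^ 2 : ℕ) : ZMod n) := by simp
  rw [← Nat.cast_smul_eq_nsmul (ZMod n), ZMod.natCast_zmod_val] at h1
  rw [h1, e, pw_natCast hv]; rfl

theorem q_smul (f : Fr u v) (c : (ZMod n)ˣ) : q ((c : ZMod n) • u) = pw (q u) ((c : ZMod n) ^ 2) := by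
  have hv := h.q_pow f
  obtain ⟨w, t⟩ := f
  have h1 := (h.quadratic h.surj h.cent t.swap12).2.2.2.1 (c : ZMod n).val (by simp)
  have e : (c : ZMod n) ^ 2 = (((c : ZMod n).val ^ 2 : ℕ) : ZMod n) := by simp
  rw [← Nat.cast_smul_eq_nsmul (ZMod n), ZMod.natCast_zmod_val] at h1
  rw [h1, e, pw_natCast hv]

theorem commute_b (f : Fr u v) {z : E} (hu : ac (π z) u = u) (hv : ac (π z) v = v) :
    Commute z (bq q u v) := by
  have := h.b_equi f z
  rwa [hu, hv, mul_inv_eq_iff_eq_mul] at this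

theorem commute_q (hw : Uni w) {z : E} (hu : ac (π z) w = w) : Commute z (q w) := by
  have := h.equi z w hw
  rwa [hu, mul_inv_eq_iff_eq_mul] at this

theorem q_act (hu : Uni u) (x : l ⊕ l → ZMod n) : ac (π (q u)) x = x + om u x • u := by
  rw [h.lift u hu, ac_T, one_mul]

theorem pi_b (f : Fr u v) : π (bq q u v) = EE u v f.om_eq 1 := by
  have u1 : Uni (u + v) := by obtain ⟨w, t⟩ := f; exact t.uniAdd
  rw [bq, map_mul π, map_mul π, map_inv π, map_inv π, h.lift _ u1, h.lift _ f.uni, h.lift _ f.symm.uni,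
    T_add_vec _ _ f.om_eq, mul_assoc, mul_assoc, mul_assoc,
    ((T_comm u v f.om_eq 1 1).inv_inv).eq, ← mul_assoc (EE _ _ _ _),
    ← (T_comm_EE v u v f.om_eq f.symm.om_eq (om_self v) 1 1).inv_left.eq,
    ← mul_assoc, ← mul_assoc, ← mul_assoc, mul_inv_cancel_right,
    (T_comm_EE u u v f.om_eq (om_self u) f.om_eq 1 1).eq, mul_inv_cancel_right]

theorem b_act (f : Fr u v) (x : l ⊕ l → ZMod n) :
    ac (π (bq q u v)) x = x + om u x • v + om v x • u := by
  rw [h.pi_b f, ac_EE, one_mul, one_mul]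

theorem pw_q_act (f : Fr u v) (c : ZMod n) (x : l ⊕ l → ZMod n) :
    ac (π (pw (q u) c)) x = x + (c * om u x) • u := by
  rw [pw, map_pow, h.lift u f.uni, T_pow, ac_T, mul_one, ZMod.natCast_zmod_val]

theorem pw_b_act (f : Fr u v) (c : ZMod n) (x : l ⊕ l → ZMod n) :
    ac (π (pw (bq q u v) c)) x = x + (c * om u x) • v + (c * om v x) • u := by
  have key : ∀ k : ℕ, ac (π (bq q u v ^ k)) x = x + (k * om u x) • v + (k * om v x) • u := by
    intro k
    induction k with
    | zero => simp
    | succ k ih =>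
      rw [pow_succ', map_mul π, ac_mul, ih, h.b_act f]
      simp only [om_add_right, om_smul_right, f.om_eq, f.symm.om_eq, om_self, mul_zero, add_zero]
      push_cast; module
  rw [pw, key, ZMod.natCast_zmod_val]

theorem b_smul (f : Fr u v) (c d : (ZMod n)ˣ) :
    bq q ((c : ZMod n) • u) ((d : ZMod n) • v) = pw (bq q u v) (c * d : ZMod n) := by
  have key : ∀ {u v} (_ : Fr u v) (c : (ZMod n)ˣ),
      bq q u ((c : ZMod n) • v) = pw (bq q u v) (c : ZMod n) := by
    intro u v f c
    have h1 := (h.commute f.uni f.symm.uni f.om_eq).pow_right ((c : ZMod n) ^ 2).val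
    have h2 := (h.commute_b f (z := q u) (by rw [h.q_act f.uni]; simp)
      (by rw [h.q_act f.uni, f.om_eq]; simp)).pow_right (c : ZMod n).val
    rw [bq, h.q_add f, h.q_smul f.symm c]
    simp only [pw] at *
    rw [h2.eq, mul_assoc _ (q u), h1.eq]
    group
  rw [key (f.smul c), h.b_symm (f.smul c), key f.symm, h.b_symm f.symm, pw_pw (h.b_pow f)]

theorem b_smul_right (f : Fr u v) (c : (ZMod n)ˣ) :
    bq q u ((c : ZMod n) • v) = pw (bq q u v) (c : ZMod n) := by
  simpa using h.b_smul f 1 c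

theorem b_add (t : Tri u v w) (c : ZMod n) :
    bq q (u + c • w) v = bq q u v * pw (bq q w v) c := by
  have key : ∀ k : ℕ, bq q (u + (k : ZMod n) • w) v = bq q u v * bq q w v ^ k := by
    intro k
    induction k with
    | zero => simp
    | succ k ih =>
      have := (h.quadratic h.surj h.cent (t.swap23.add (k : ZMod n)).swap23).2.2.2.2
      rw [Nat.cast_succ, add_smul, one_smul, ← add_assoc, this, ih, pow_succ, mul_assoc]
  have := key c.val
  rw [ZMod.natCast_zmod_val] at this
  exact this

theorem b_add_self (f : Fr u v) (c : ZMod n) :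
    bq q (u + c • v) v = bq q u v * pw (q v) (2 * c) := by
  have e : u + c • v + v = u + (c + 1) • v := by module
  have hv := h.q_pow f.symm
  have h1 := h.commute f.uni f.symm.uni f.om_eq
  have h2 := (h.commute_b f (z := q u) (by rw [h.q_act f.uni]; simp)
    (by rw [h.q_act f.uni, f.om_eq]; simp))
  have h3 := (h.commute_b f (z := q v) (by rw [h.q_act f.symm.uni, f.symm.om_eq]; simp)
    (by rw [h.q_act f.symm.uni]; simp))
  have e2 : (c + 1) ^ 2 = c ^ 2 + 2 * c + 1 := by ring
  rw [bq, e, h.q_add f, h.q_add f, e2, pw_add hv, pw_add hv, pw_add (h.b_pow f), pw_one hv,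
    pw_one (h.b_pow f)]
  simp only [pw]
  set B := bq q u v
  set U := q u
  set V := q v
  have c1 : ∀ k, Commute (U * B ^ k) (V) := fun k => h1.mul_left (h3.symm.pow_left k)
  have c2 : ∀ k m, Commute (U * B ^ k) (V ^ m) := fun k m => (c1 k).pow_right m
  calc U * (B ^ c.val * B) * (V ^ (c ^ 2).val * V ^ (2 * c).val * V) *
        (U * B ^ c.val * V ^ (c ^ 2).val)⁻¹ * V⁻¹
      = (B * (U * B ^ c.val)) * V ^ (2 * c).val * (V ^ (c ^ 2).val * V) *
        (U * B ^ c.val * V ^ (c ^ 2).val)⁻¹ * V⁻¹ := by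
        have : B * (U * B ^ c.val) = U * (B ^ c.val * B) := by
          rw [← mul_assoc, ← h2.eq, mul_assoc, ← pow_succ, ← pow_succ']
        rw [this, ((Commute.refl V).pow_pow (c ^ 2).val (2 * c).val).eq]
        simp only [mul_assoc]
    _ = B * V ^ (2 * c).val * (U * B ^ c.val * V ^ (c ^ 2).val) * V *
        (U * B ^ c.val * V ^ (c ^ 2).val)⁻¹ * V⁻¹ := by
        rw [mul_assoc B, (c2 _ _).eq]; simp only [mul_assoc]
    _ = _ := by
        have : Commute (U * B ^ c.val * V ^ (c ^ 2).val) V :=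
          (c1 _).mul_left ((Commute.refl V).pow_left _)
        rw [mul_assoc (B * V ^ (2 * c).val), this.eq]
        group

end FLift

end FrameRelations

section HyperbolicPairs

variable {l : Type} [Fintype l] [DecidableEq l] {n : ℕ} [NeZero n] [IsLocalRing (ZMod n)]
variable {E : Type} [Group E]
variable {π : E →* symplecticGroup l (ZMod n)} {q : (l ⊕ l → ZMod n) → E}
variable {a a' b b' c d : l ⊕ l → ZMod n}

/-- Long root family. -/
def xl (q : (l ⊕ l → ZMod n) → E) (a : l ⊕ l → ZMod n) (t : ZMod n) : E := pw (q a) t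

/-- Short root family. -/
def xs (q : (l ⊕ l → ZMod n) → E) (a b : l ⊕ l → ZMod n) (t : ZMod n) : E := pw (bq q a b) t

namespace FLift

variable (h : FLift π q)
include h

theorem wl_long_act (fa : Fr a c) (fa' : Fr a' d) (haa : om a a' = 1) (u : (ZMod n)ˣ) :
    ac (π (wl (xl q a) (fun t => xl q a' (-t)) u)) a = (-((u⁻¹ : (ZMod n)ˣ) : ZMod n)) • a' ∧
    ac (π (wl (xl q a) (fun t => xl q a' (-t)) u)) a' = (u : ZMod n) • a ∧
    ∀ x, om a x = 0 → om a' x = 0 →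
      ac (π (wl (xl q a) (fun t => xl q a' (-t)) u)) x = x := by
  have haa' : om a' a = -1 := by rw [om_swap, haa]
  simp only [wl, map_mul π, ac_mul, xl, h.pw_q_act fa, h.pw_q_act fa', om_add_right,
    om_smul_right, om_self, haa, haa', neg_neg]
  refine ⟨?_, ?_, fun x h1 h2 => ?_⟩
  · have := u.inv_mul
    match_scalars <;> grind
  · have := u.inv_mul
    match_scalars <;> grind
  · simp only [h1, h2]; simp

theorem rank1_long (fa : Fr a c) (fa' : Fr a' d) (haa : om a a' = 1) :
    Rank1 (xl q a) (fun t => xl q a' (-t)) where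
  x_add := pw_add (h.q_pow fa)
  y_add s t := by rw [neg_add]; exact pw_add (h.q_pow fa') _ _
  wx u t := by
    rw [xl, pw_conj, h.equi _ _ fa.uni, (h.wl_long_act fa fa' haa u).1, ← Units.val_neg,
      h.q_smul fa', pw_pw (h.q_pow fa')]
    simp only [xl]; congr 1; push_cast; ring
  wy u t := by
    rw [xl, pw_conj, h.equi _ _ fa'.uni, (h.wl_long_act fa fa' haa u).2.1,
      h.q_smul fa, pw_pw (h.q_pow fa)]
    simp only [xl]; congr 1; ring

theorem hl_long_act (fa : Fr a c) (fa' : Fr a' d) (haa : om a a' = 1) (u : (ZMod n)ˣ) :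
    ac (π (hl (xl q a) (fun t => xl q a' (-t)) u)) a = (u : ZMod n) • a ∧
    ac (π (hl (xl q a) (fun t => xl q a' (-t)) u)) a' = ((u⁻¹ : (ZMod n)ˣ) : ZMod n) • a' ∧
    ∀ x, om a x = 0 → om a' x = 0 →
      ac (π (hl (xl q a) (fun t => xl q a' (-t)) u)) x = x := by
  obtain ⟨h1, h2, h3⟩ := h.wl_long_act fa fa' haa u
  obtain ⟨k1, k2, k3⟩ := h.wl_long_act fa fa' haa (-1)
  simp only [hl, map_mul π, ac_mul, k1, k2, map_smul, h1, h2]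
  refine ⟨by simp, by simp, fun x hx hx' => by rw [k3 x hx hx', h3 x hx hx']⟩

theorem wl_short_act (f : Fr a b') (f' : Fr a' b) (haa : om a a' = 1) (hbb : om b b' = 1)
    (hab : om a b = 0) (hab' : om a' b' = 0) (u : (ZMod n)ˣ) :
    ac (π (wl (fun t => xs q a b' (-t)) (fun t => xs q a' b (-t)) u)) a =
      (-((u⁻¹ : (ZMod n)ˣ) : ZMod n)) • b ∧
    ac (π (wl (fun t => xs q a b' (-t)) (fun t => xs q a' b (-t)) u)) b = (u : ZMod n) • a ∧
    ac (π (wl (fun t => xs q a b' (-t)) (fun t => xs q a' b (-t)) u)) a' = (-(u : ZMod n)) • b' ∧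
    ac (π (wl (fun t => xs q a b' (-t)) (fun t => xs q a' b (-t)) u)) b' =
      ((u⁻¹ : (ZMod n)ˣ) : ZMod n) • a' ∧
    ∀ x, om a x = 0 → om a' x = 0 → om b x = 0 → om b' x = 0 →
      ac (π (wl (fun t => xs q a b' (-t)) (fun t => xs q a' b (-t)) u)) x = x := by
  have e1 : om a' a = -1 := by rw [om_swap, haa]
  have e2 : om b' b = -1 := by rw [om_swap, hbb]
  have e3 : om b a = 0 := by rw [om_swap, hab, neg_zero]
  have e4 : om b' a' = 0 := by rw [om_swap, hab', neg_zero]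
  have e5 := f.om_eq
  have e6 := f'.om_eq
  have e7 := f.symm.om_eq
  have e8 := f'.symm.om_eq
  have e9 := u.inv_mul
  simp only [wl, map_mul π, ac_mul, xs, h.pw_b_act f, h.pw_b_act f', om_add_right,
    om_smul_right, om_self, haa, hbb, hab, hab', e1, e2, e3, e4, e5, e6, e7, e8, neg_neg]
  refine ⟨?_, ?_, ?_, ?_, fun x h1 h2 h3 h4 => ?_⟩
  · match_scalars <;> grind
  · match_scalars <;> grind
  · match_scalars <;> grind
  · match_scalars <;> grind
  · simp only [h1, h2, h3, h4]; simp

theorem rank1_short (f : Fr a b') (f' : Fr a' b) (haa : om a a' = 1) (hbb : om b b' = 1)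
    (hab : om a b = 0) (hab' : om a' b' = 0) :
    Rank1 (fun t => xs q a b' (-t)) (fun t => xs q a' b (-t)) where
  x_add s t := by rw [neg_add]; exact pw_add (h.b_pow f) _ _
  y_add s t := by rw [neg_add]; exact pw_add (h.b_pow f') _ _
  wx u t := by
    obtain ⟨h1, h2, h3, h4, -⟩ := h.wl_short_act f f' haa hbb hab hab' u
    simp only [xs]
    rw [pw_conj, h.b_equi f]
    simp only [xs] at h1 h4
    rw [h1, h4, ← Units.val_neg, h.b_smul f'.symm, pw_pw (h.b_pow f'.symm), h.b_symm f']
    congr 1; push_cast; ring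
  wy u t := by
    obtain ⟨h1, h2, h3, h4, -⟩ := h.wl_short_act f f' haa hbb hab hab' u
    simp only [xs]
    rw [pw_conj, h.b_equi f']
    simp only [xs] at h2 h3
    rw [h2, h3, ← Units.val_neg, h.b_smul f.symm, pw_pw (h.b_pow f.symm), h.b_symm f]
    congr 1; push_cast; ring

end FLift

end HyperbolicPairs

section SignedBasis

variable {l : Type} [Fintype l] [DecidableEq l] {R : Type} [CommRing R]

/-- Standard basis vectors. -/
def bv (R : Type) [CommRing R] (s : l ⊕ l) : l ⊕ l → R := Pi.single s 1

/-- The plane of a basis vector. -/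
def ix (s : l ⊕ l) : l := Sum.elim id id s

/-- The sign of a basis vector. -/
def sg (R : Type) [CommRing R] (s : l ⊕ l) : Rˣ := Sum.elim (fun _ => 1) (fun _ => -1) s

@[simp] theorem ix_swap (s : l ⊕ l) : ix s.swap = ix s := by cases s <;> rfl
@[simp] theorem ix_inl (i : l) : ix (.inl i : l ⊕ l) = i := rfl
@[simp] theorem ix_inr (i : l) : ix (.inr i : l ⊕ l) = i := rfl
@[simp] theorem sg_inl (i : l) : sg R (.inl i : l ⊕ l) = 1 := rfl
@[simp] theorem sg_inr (i : l) : sg R (.inr i : l ⊕ l) = -1 := rfl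
@[simp] theorem bv_inl (i : l) : bv R (.inl i : l ⊕ l) = ve R i := rfl
@[simp] theorem bv_inr (i : l) : bv R (.inr i : l ⊕ l) = vf R i := rfl

theorem sg_sq (s : l ⊕ l) : (sg R s : R) * sg R s = 1 := by cases s <;> simp

theorem sg_swap (s : l ⊕ l) : sg R s.swap = -sg R s := by cases s <;> simp

theorem swap_ne (s : l ⊕ l) : s.swap ≠ s := by cases s <;> simp

theorem om_bv_left (s : l ⊕ l) (x : l ⊕ l → R) : om (bv R s) x = sg R s * x s.swap := by
  cases s <;> simp

theorem om_bv (s t : l ⊕ l) : om (bv R s) (bv R t) = if s.swap = t then (sg R s : R) else 0 := by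
  rw [om_bv_left, bv, Pi.single_apply]; split_ifs <;> simp

theorem om_bv_swap (s : l ⊕ l) : om (bv R s) (bv R s.swap) = sg R s := by
  rw [om_bv, if_pos rfl]

theorem om_bv_of_ne {s t : l ⊕ l} (h : s.swap ≠ t) : om (bv R s) (bv R t) = 0 := by
  rw [om_bv, if_neg h]

theorem om_bv_of_ix {s t : l ⊕ l} (h : ix s ≠ ix t) : om (bv R s) (bv R t) = 0 :=
  om_bv_of_ne (by rintro rfl; simp at h)

theorem ix_eq_iff {s t : l ⊕ l} : ix s = ix t ↔ t = s ∨ t = s.swap := by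
  cases s <;> cases t <;> simp [eq_comm]

theorem exists_flip (s : l ⊕ l) : ∃ M : symplecticGroup l R, ac M (ve R (ix s)) = bv R s ∧
    ∀ t, ix t ≠ ix s → ac M (bv R t) = bv R t := by
  cases s with
  | inl i => exact ⟨1, by simp⟩
  | inr i =>
    refine ⟨Fl R i, ac_Fl_ve i, fun t ht => ?_⟩
    cases t with
    | inl j => exact ac_Fl_ve_ne (Ne.symm ht)
    | inr j => exact ac_Fl_vf_ne (Ne.symm ht)

theorem tri_bv {r s t : l ⊕ l} (h1 : ix r ≠ ix s) (h2 : ix r ≠ ix t) (h3 : ix s ≠ ix t) :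
    Tri (bv R r) (bv R s) (bv R t) := by
  have h0 := tri_ve (R := R) h1 h2 h3
  obtain ⟨M, hM, hM'⟩ := exists_flip (R := R) r
  obtain ⟨N, hN, hN'⟩ := exists_flip (R := R) s
  obtain ⟨K, hK, hK'⟩ := exists_flip (R := R) t
  have e1 := hM' (.inl (ix s)) h1.symm
  have e2 := hM' (.inl (ix t)) h2.symm
  have e3 := hN' (.inl (ix t)) h3.symm
  simp only [bv_inl] at e1 e2 e3
  have := ((h0.map M).map N).map K
  rwa [hM, e1, e2, hN, hN' r h1, e3, hK, hK' r h2, hK' s h3] at this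

/-- The index set has at least three elements. -/
class Big (l : Type) [Fintype l] : Prop where
  card : 3 ≤ Fintype.card l

theorem fr_bv [Big l] {r s : l ⊕ l} (h : ix r ≠ ix s) : Fr (bv R r) (bv R s) := by
  obtain ⟨k, hk⟩ : ∃ k, k ∉ ({ix r, ix s} : Finset l) := by
    by_contra! hk
    have h1 : (Finset.univ : Finset l) ⊆ {ix r, ix s} := fun k _ => hk k
    have h2 := Finset.card_le_card h1
    have h3 : ({ix r, ix s} : Finset l).card ≤ 2 := Finset.card_le_two
    have h4 := Big.card (l := l)
    rw [Finset.card_univ] at h2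
    omega
  simp only [Finset.mem_insert, Finset.mem_singleton, not_or] at hk
  exact ⟨bv R (.inl k), tri_bv h (Ne.symm hk.1) (Ne.symm hk.2)⟩

theorem exists_ix_ne [Big l] (k : l) : ∃ j : l, j ≠ k := by
  have : Nontrivial l := Fintype.one_lt_card_iff_nontrivial.1 (by have := Big.card (l := l); omega)
  exact exists_ne k

theorem exists_fr_bv [Big l] (r : l ⊕ l) : ∃ s, Fr (bv R r) (bv R s) := by
  obtain ⟨j, hj⟩ := exists_ix_ne (ix r)
  exact ⟨.inl j, fr_bv (Ne.symm hj)⟩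

end SignedBasis

section AbstractGauss

open Subgroup

variable {E : Type} [Group E]

/-- Products of the shape `u v l u'`. -/
def GP (U V L : Subgroup E) : Set E :=
  {z | ∃ u ∈ U, ∃ v ∈ V, ∃ l ∈ L, ∃ w ∈ U, z = u * v * l * w}

/-- The elements that preserve a set under left multiplication, together with their inverses. -/
def Stb (P : Set E) : Subgroup E where
  carrier := {g | (∀ x ∈ P, g * x ∈ P) ∧ ∀ x ∈ P, g⁻¹ * x ∈ P}
  one_mem' := by simp
  mul_mem' := by
    rintro a b ⟨ha, ha'⟩ ⟨hb, hb'⟩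
    refine ⟨fun x hx => ?_, fun x hx => ?_⟩
    · rw [mul_assoc]; exact ha _ (hb _ hx)
    · rw [_root_.mul_inv_rev, mul_assoc]; exact hb' _ (ha' _ hx)
  inv_mem' := by
    rintro a ⟨ha, ha'⟩
    exact ⟨ha', by simpa using ha⟩

theorem le_Stb {P : Set E} {H : Subgroup E} (h : ∀ g ∈ H, ∀ x ∈ P, g * x ∈ P) : H ≤ Stb P :=
  fun g hg => ⟨h g hg, h g⁻¹ (inv_mem hg)⟩

theorem le_Stb_left (U V L : Subgroup E) : U ≤ Stb (GP U V L) := by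
  refine le_Stb ?_
  rintro g hg _ ⟨u, hu, v, hv, l, hl, u', hu', rfl⟩
  exact ⟨g * u, mul_mem hg hu, v, hv, l, hl, u', hu', by group⟩

theorem le_Stb_mid {U V L : Subgroup E} (hU : L ≤ normalizer (U : Set E))
    (hV : L ≤ normalizer (V : Set E)) : L ≤ Stb (GP U V L) := by
  refine le_Stb ?_
  rintro g hg _ ⟨u, hu, v, hv, l, hl, u', hu', rfl⟩
  exact ⟨g * u * g⁻¹, le_normalizer_iff.1 hU g hg u hu, g * v * g⁻¹,
    le_normalizer_iff.1 hV g hg v hv, g * l, mul_mem hg hl, u', hu', by group⟩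

theorem mem_GP_of_le {U V L N : Subgroup E} (h : N ≤ Stb (GP U V L)) {z : E} (hz : z ∈ N) :
    z ∈ GP U V L := by
  have := (h hz).1 1 ⟨1, one_mem _, 1, one_mem _, 1, one_mem _, 1, one_mem _, by simp⟩
  rwa [mul_one] at this

/-- Closure of Gauss products under a rank one subgroup. -/
theorem gauss {U V L X Y Wp Wm : Subgroup E} (hLU : L ≤ normalizer (U : Set E))
    (hLV : L ≤ normalizer (V : Set E)) (hX : X ≤ U) (hY : Y ≤ V) (hWp : Wp ≤ U ⊔ L)
    (hWm : Wm ≤ V ⊔ L) (hXp : X ≤ normalizer (Wp : Set E)) (hYp : Y ≤ normalizer (Wp : Set E))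
    (hXm : X ≤ normalizer (Wm : Set E))
    (hYm : Y ≤ normalizer (Wm : Set E)) (hU : U ≤ Wp ⊔ X) (hV : V ≤ Wm ⊔ Y)
    (ex : ∀ y ∈ Y, ∀ x ∈ X, ∀ y' ∈ Y, ∃ x1 ∈ X, ∃ y1 ∈ Y, ∃ h ∈ L, ∃ x2 ∈ X,
      y * x * y' = x1 * y1 * h * x2) : Y ≤ Stb (GP U V L) := by
  refine le_Stb ?_
  rintro y hy _ ⟨u, hu, v, hv, l, hl, u', hu', rfl⟩
  have m1 : u ∈ ((Wp ⊔ X : Subgroup E) : Set E) := hU hu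
  rw [coe_mul_of_right_le_normalizer_left _ _ hXp] at m1
  obtain ⟨w, hw, x, hx, rfl⟩ := m1
  have m2 : v ∈ ((Y ⊔ Wm : Subgroup E) : Set E) := by rw [sup_comm]; exact hV hv
  rw [coe_mul_of_left_le_normalizer_right _ _ hYm] at m2
  obtain ⟨y', hy', w', hw', rfl⟩ := m2
  obtain ⟨x1, hx1, y1, hy1, h, hh, x2, hx2, e⟩ := ex y hy x hx y' hy'
  have m3 : y * w * y⁻¹ ∈ ((U ⊔ L : Subgroup E) : Set E) :=
    hWp (le_normalizer_iff.1 hYp y hy w hw)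
  rw [coe_mul_of_right_le_normalizer_left _ _ hLU] at m3
  obtain ⟨u1, hu1, l1, hl1, e1⟩ := m3
  have m4 : x2 * w' * x2⁻¹ ∈ ((V ⊔ L : Subgroup E) : Set E) :=
    hWm (le_normalizer_iff.1 hXm x2 hx2 w' hw')
  rw [coe_mul_of_right_le_normalizer_left _ _ hLV] at m4
  obtain ⟨v1, hv1, l2, hl2, e2⟩ := m4
  simp only at e1 e2
  refine ⟨u1 * (l1 * x1 * l1⁻¹), mul_mem hu1 (le_normalizer_iff.1 hLU l1 hl1 x1 (hX hx1)),
    (l1 * y1 * l1⁻¹) * (l1 * h * v1 * (l1 * h)⁻¹),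
    mul_mem (le_normalizer_iff.1 hLV l1 hl1 y1 (hY hy1))
      (le_normalizer_iff.1 hLV _ (mul_mem hl1 hh) v1 hv1),
    l1 * h * l2 * l, mul_mem (mul_mem (mul_mem hl1 hh) hl2) hl,
    l⁻¹ * x2 * l⁻¹⁻¹ * u', mul_mem (le_normalizer_iff.1 hLU _ (inv_mem hl) x2 (hX hx2)) hu', ?_⟩
  calc y * (w * x * (y' * w') * l * u') = y * w * y⁻¹ * (y * x * y') * w' * l * u' := by group
    _ = u1 * l1 * (x1 * y1 * h * x2) * w' * l * u' := by rw [e, e1]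
    _ = u1 * l1 * x1 * y1 * h * (x2 * w' * x2⁻¹) * x2 * l * u' := by group
    _ = u1 * l1 * x1 * y1 * h * (v1 * l2) * x2 * l * u' := by rw [← e2]
    _ = _ := by group

theorem closure_le_normalizer_closure {S S' : Set E} {n : ℕ} [NeZero n]
    (hn : ∀ g ∈ S, g ^ n = 1)
    (h : ∀ g ∈ S, ∀ s ∈ S', g * s * g⁻¹ ∈ closure S') :
    closure S ≤ normalizer (closure S' : Set E) := by
  rw [closure_le]
  intro g hg
  have key : ∀ m : ℕ, ∀ x ∈ closure S', g ^ m * x * (g ^ m)⁻¹ ∈ closure S' := by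
    intro m
    induction m with
    | zero => simp
    | succ m ih =>
      intro x hx
      have h1 : g * x * g⁻¹ ∈ closure S' := by
        induction hx using closure_induction with
        | mem x hx => exact h g hg x hx
        | one => simp
        | mul a b _ _ ha hb =>
          have := mul_mem ha hb
          simpa [mul_assoc] using this
        | inv a _ ha =>
          have := inv_mem ha
          simpa [mul_assoc] using this
      have := ih _ h1
      rw [pow_succ, _root_.mul_inv_rev]
      simpa only [mul_assoc] using this
  have hinv : g ^ (n - 1) = g⁻¹ := by
    rw [eq_inv_iff_mul_eq_one, ← pow_succ, Nat.sub_add_cancel (NeZero.one_le), hn g hg]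
  refine mem_normalizer_iff.2 fun x => ⟨fun hx => by simpa using key 1 x hx, fun hx => ?_⟩
  have := key (n - 1) _ hx
  rw [hinv] at this
  have e : g⁻¹ * (g * x * g⁻¹) * g⁻¹⁻¹ = x := by group
  rwa [e] at this

end AbstractGauss

section RootSubgroups

open Subgroup

variable {l : Type} [Fintype l] [DecidableEq l] [Big l] {n : ℕ} [NeZero n] [IsLocalRing (ZMod n)]
variable {E : Type} [Group E]
variable {π : E →* symplecticGroup l (ZMod n)} {q : (l ⊕ l → ZMod n) → E}
variable {a b s t : l ⊕ l} {F : Finset l}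

/-- Long root element. -/
def qb (q : (l ⊕ l → ZMod n) → E) (s : l ⊕ l) : E := q (bv (ZMod n) s)

/-- Short root element. -/
def BB (q : (l ⊕ l → ZMod n) → E) (s t : l ⊕ l) : E := bq q (bv (ZMod n) s) (bv (ZMod n) t)

/-- The subgroup generated by the root elements in the planes of `F`. -/
def NN (q : (l ⊕ l → ZMod n) → E) (F : Finset l) : Subgroup E :=
  closure {g | (∃ t, ix t ∈ F ∧ g = qb q t) ∨
    ∃ s t, ix s ∈ F ∧ ix t ∈ F ∧ ix s ≠ ix t ∧ g = BB q s t}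

/-- The unipotent radical attached to the isotropic vector `a`. -/
def UU (q : (l ⊕ l → ZMod n) → E) (a : l ⊕ l) (F : Finset l) : Subgroup E :=
  closure {g | g = qb q a ∨ ∃ t, ix t ∈ F ∧ g = BB q a t}

/-- An abelian-by-abelian piece normalised by the rank one subgroup of the roots `a ± b`. -/
def WW (q : (l ⊕ l → ZMod n) → E) (a b : l ⊕ l) (F : Finset l) : Subgroup E :=
  closure {g | (g = qb q a ∨ g = qb q b ∨ g = BB q a b) ∨
    ∃ t, ix t ∈ F ∧ ix t ≠ ix a ∧ ix t ≠ ix b ∧ (g = BB q a t ∨ g = BB q b t)}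

theorem qb_mem_NN (ht : ix t ∈ F) : qb q t ∈ NN q F := subset_closure (.inl ⟨t, ht, rfl⟩)

theorem BB_mem_NN (hs : ix s ∈ F) (ht : ix t ∈ F) (h : ix s ≠ ix t) : BB q s t ∈ NN q F :=
  subset_closure (.inr ⟨s, t, hs, ht, h, rfl⟩)

theorem qb_mem_UU : qb q a ∈ UU q a F := subset_closure (.inl rfl)

theorem BB_mem_UU (ht : ix t ∈ F) : BB q a t ∈ UU q a F := subset_closure (.inr ⟨t, ht, rfl⟩)

theorem WW_symm (h : BB q a b = BB q b a) : WW q a b F = WW q b a F := by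
  unfold WW
  congr 1
  ext g
  simp only [Set.mem_ofPred_eq, h]
  refine or_congr (by tauto) (exists_congr fun t => by tauto)

namespace FLift

variable (h : FLift π q)
include h

theorem qb_pow (s : l ⊕ l) : qb q s ^ n = 1 := by
  obtain ⟨t, f⟩ := exists_fr_bv (R := ZMod n) s
  exact h.q_pow f

theorem BB_pow (hst : ix s ≠ ix t) : BB q s t ^ n = 1 := h.b_pow (fr_bv hst)

theorem BB_symm (hst : ix s ≠ ix t) : BB q s t = BB q t s := h.b_symm (fr_bv hst)

theorem qb_act (s : l ⊕ l) (x : l ⊕ l → ZMod n) :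
    ac (π (qb q s)) x = x + om (bv (ZMod n) s) x • bv (ZMod n) s := by
  obtain ⟨t, f⟩ := exists_fr_bv (R := ZMod n) s
  exact h.q_act f.uni x

theorem BB_act (hst : ix s ≠ ix t) (x : l ⊕ l → ZMod n) :
    ac (π (BB q s t)) x = x + om (bv (ZMod n) s) x • bv (ZMod n) t
      + om (bv (ZMod n) t) x • bv (ZMod n) s := h.b_act (fr_bv hst) x

theorem qb_fix (hst : s.swap ≠ t) : ac (π (qb q s)) (bv (ZMod n) t) = bv (ZMod n) t := by
  rw [h.qb_act, om_bv_of_ne hst, zero_smul, add_zero]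

theorem BB_fix {r : l ⊕ l} (hst : ix s ≠ ix t) (h1 : s.swap ≠ r) (h2 : t.swap ≠ r) :
    ac (π (BB q s t)) (bv (ZMod n) r) = bv (ZMod n) r := by
  rw [h.BB_act hst, om_bv_of_ne h1, om_bv_of_ne h2]; simp

theorem BB_move (hst : ix s ≠ ix t) : ac (π (BB q s t)) (bv (ZMod n) s.swap) =
    bv (ZMod n) s.swap + (sg (ZMod n) s : ZMod n) • bv (ZMod n) t := by
  rw [h.BB_act hst, om_bv_swap, om_bv_of_ix (by simpa using hst.symm)]; simp

theorem qb_conj (s : l ⊕ l) (z : E) :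
    z * qb q s * z⁻¹ = q (ac (π z) (bv (ZMod n) s)) := by
  obtain ⟨t, f⟩ := exists_fr_bv (R := ZMod n) s
  exact h.equi z _ f.uni

theorem BB_conj (hst : ix s ≠ ix t) (z : E) :
    z * BB q s t * z⁻¹ = bq q (ac (π z) (bv (ZMod n) s)) (ac (π z) (bv (ZMod n) t)) :=
  h.b_equi (fr_bv hst) z

theorem NN_pow : ∀ g ∈ {g | (∃ t, ix t ∈ F ∧ g = qb q t) ∨
    ∃ s t, ix s ∈ F ∧ ix t ∈ F ∧ ix s ≠ ix t ∧ g = BB q s t}, g ^ n = 1 := by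
  rintro g (⟨t, -, rfl⟩ | ⟨s, t, -, -, hst, rfl⟩)
  exacts [h.qb_pow t, h.BB_pow hst]

/-- Conjugates of short root elements, additively in the first vector. -/
theorem b_add_bv {r : l ⊕ l} (h1 : ix r ≠ ix a) (h2 : ix t ≠ ix a) (h3 : ix r ≠ ix t) (c : ZMod n) :
    bq q (bv (ZMod n) a) (bv (ZMod n) r + c • bv (ZMod n) t) =
      BB q a r * pw (BB q a t) c := by
  have f : Fr (bv (ZMod n) r + c • bv (ZMod n) t) (bv (ZMod n) a) :=
    ⟨_, ((tri_bv h3 h1 h2).add c).swap23⟩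
  rw [h.b_symm f.symm, h.b_add (tri_bv h1 h3 h2.symm), h.b_symm (fr_bv h1), h.b_symm (fr_bv h2)]
  rfl

theorem qb_conj_BB_mem (ha : ix a ∉ F) {r : l ⊕ l} (hr : ix r ∈ F) :
    qb q r * BB q a r.swap * (qb q r)⁻¹ ∈ UU q a F := by
  have har : ix a ≠ ix r := by rintro e; rw [e] at ha; exact ha hr
  set g := qb q r with hg
  set b := BB q a r.swap with hb
  have hb' : (b⁻¹ : E) = pw b (-1 : ZMod n) := by
    rw [pw_neg (h.BB_pow (by simpa using har)), pw_one (h.BB_pow (by simpa using har))]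
  have e1 : b⁻¹ * g * b = g * pw (BB q r a) (sg (ZMod n) r : ZMod n) *
      pw (qb q a) ((sg (ZMod n) r : ZMod n) ^ 2) := by
    have h1 := h.qb_conj r b⁻¹
    rw [inv_inv] at h1
    have h2 : ac (π b⁻¹) (bv (ZMod n) r) = bv (ZMod n) r + (sg (ZMod n) r : ZMod n) • bv (ZMod n) a := by
      rw [hb', hb, BB, h.pw_b_act (fr_bv (by simpa using har)), om_bv_of_ix har, om_bv_left, sg_swap]
      simp [bv]
    rw [hg, h1, h2, h.q_add (fr_bv har.symm)]
    rfl
  have c1 : Commute g (pw (BB q r a) (sg (ZMod n) r : ZMod n)) :=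
    (h.commute_b (fr_bv har.symm) (h.qb_fix (swap_ne r))
      (h.qb_fix (by rintro rfl; simp at har))).pow_right _
  have c2 : Commute g (pw (qb q a) ((sg (ZMod n) r : ZMod n) ^ 2)) :=
    (h.commute_q (fr_bv (R := ZMod n) har).uni
      (h.qb_fix (by rintro rfl; simp at har))).pow_right _
  have e2 : g * b * g⁻¹ = b * (pw (BB q r a) (sg (ZMod n) r : ZMod n) *
      pw (qb q a) ((sg (ZMod n) r : ZMod n) ^ 2)) := by
    calc g * b * g⁻¹ = b * (b⁻¹ * g * b) * g⁻¹ := by group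
      _ = b * (g * (pw (BB q r a) (sg (ZMod n) r : ZMod n) *
      pw (qb q a) ((sg (ZMod n) r : ZMod n) ^ 2))) * g⁻¹ := by rw [e1]; simp only [mul_assoc]
      _ = _ := by rw [(c1.mul_right c2).eq]; group
  rw [e2, h.BB_symm har.symm]
  exact mul_mem (BB_mem_UU (by simpa using hr)) (mul_mem (pw_mem (BB_mem_UU hr) _) (pw_mem qb_mem_UU _))

theorem NN_le_normalizer_UU (ha : ix a ∉ F) : NN q F ≤ normalizer (UU q a F : Set E) := by
  refine closure_le_normalizer_closure (n := n) h.NN_pow ?_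
  have hne : ∀ {t : l ⊕ l}, ix t ∈ F → ix t ≠ ix a := fun ht e => ha (e ▸ ht)
  have hsw : ∀ {t : l ⊕ l}, ix t ∈ F → t.swap ≠ a := fun ht e => ha (by rw [← e]; simpa using ht)
  change ∀ g ∈ _, ∀ s ∈ _, _ ∈ UU q a F
  rintro g (⟨r, hr, rfl⟩ | ⟨s, t, hs, ht, hst, rfl⟩)
  · rintro _ (rfl | ⟨t, ht, rfl⟩)
    · rw [h.qb_conj, h.qb_fix (hsw hr)]; exact qb_mem_UU
    · by_cases hrt : r.swap = t
      · subst hrt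
        exact h.qb_conj_BB_mem ha hr
      · rw [h.BB_conj (hne ht).symm, h.qb_fix (hsw hr), h.qb_fix hrt]
        exact BB_mem_UU ht
  · have key : ∀ s t : l ⊕ l, ix s ∈ F → ix t ∈ F → ix s ≠ ix t →
        BB q s t * BB q a s.swap * (BB q s t)⁻¹ ∈ UU q a F := by
      intro s t hs ht hst
      rw [h.BB_conj (by simpa using (hne hs).symm), h.BB_fix hst (hsw hs) (hsw ht), h.BB_move hst,
        h.b_add_bv (by simpa using hne hs) (hne ht) (by simpa using hst)]
      exact mul_mem (BB_mem_UU (by simpa using hs)) (pw_mem (BB_mem_UU ht) _)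
    rintro _ (rfl | ⟨r, hr, rfl⟩)
    · rw [h.qb_conj, h.BB_fix hst (hsw hs) (hsw ht)]; exact qb_mem_UU
    · by_cases h1 : s.swap = r
      · subst h1; exact key s t hs ht hst
      by_cases h2 : t.swap = r
      · subst h2; rw [h.BB_symm hst]; exact key t s ht hs hst.symm
      rw [h.BB_conj (hne hr).symm, h.BB_fix hst (hsw hs) (hsw ht), h.BB_fix hst h1 h2]
      exact BB_mem_UU hr

theorem BB_normalizes_WW (hab : ix a ≠ ix b) :
    zpowers (BB q a.swap b) ≤ normalizer (WW q a b F : Set E) := by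
  have hab' : ix a.swap ≠ ix b := by simpa using hab
  rw [zpowers_eq_closure]
  refine closure_le_normalizer_closure (n := n) (by rintro _ rfl; exact h.BB_pow hab') ?_
  change ∀ g ∈ _, ∀ s ∈ _, _ ∈ WW q a b F
  rintro _ rfl
  have ma := h.BB_move hab'
  rw [Sum.swap_swap] at ma
  have mb : ac (π (BB q a.swap b)) (bv (ZMod n) b) = bv (ZMod n) b :=
    h.BB_fix hab' (by rintro e; apply_fun ix at e; simp at e; exact hab e) (swap_ne b)
  have m1 : qb q a ∈ WW q a b F := subset_closure (.inl (.inl rfl))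
  have m2 : qb q b ∈ WW q a b F := subset_closure (.inl (.inr (.inl rfl)))
  have m3 : BB q a b ∈ WW q a b F := subset_closure (.inl (.inr (.inr rfl)))
  rintro _ ((rfl | rfl | rfl) | ⟨t, ht, h1, h2, (rfl | rfl)⟩)
  · rw [h.qb_conj, ma, h.q_add (fr_bv hab)]
    exact mul_mem (mul_mem m1 (pw_mem m3 _)) (pw_mem m2 _)
  · rw [h.qb_conj, mb]; exact m2
  · rw [h.BB_conj hab, ma, mb, h.b_add_self (fr_bv hab)]
    exact mul_mem m3 (pw_mem m2 _)
  · have mt : ac (π (BB q a.swap b)) (bv (ZMod n) t) = bv (ZMod n) t :=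
      h.BB_fix hab' (by rintro e; simp at e; exact h1 (by rw [e])) (by rintro rfl; simp at h2)
    rw [h.BB_conj h1.symm, ma, mt, h.b_add (tri_bv h1.symm hab h2)]
    exact mul_mem (subset_closure (.inr ⟨t, ht, h1, h2, .inl rfl⟩))
      (pw_mem (subset_closure (.inr ⟨t, ht, h1, h2, .inr rfl⟩)) _)
  · have mt : ac (π (BB q a.swap b)) (bv (ZMod n) t) = bv (ZMod n) t :=
      h.BB_fix hab' (by rintro e; simp at e; exact h1 (by rw [e])) (by rintro rfl; simp at h2)
    rw [h.BB_conj h2.symm, mb, mt]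
    exact subset_closure (.inr ⟨t, ht, h1, h2, .inr rfl⟩)

omit h in
theorem WW_le (hb : ix b ∈ F) : WW q a b F ≤ UU q a F ⊔ NN q F := by
  refine (closure_le _).2 ?_
  rintro _ ((rfl | rfl | rfl) | ⟨t, ht, h1, h2, (rfl | rfl)⟩)
  · exact mem_sup_left qb_mem_UU
  · exact mem_sup_right (qb_mem_NN hb)
  · exact mem_sup_left (BB_mem_UU hb)
  · exact mem_sup_left (BB_mem_UU ht)
  · exact mem_sup_right (BB_mem_NN hb ht h2.symm)

omit h in
theorem UU_le (ha : ix a ∉ F) : UU q a F ≤ WW q a b F ⊔ zpowers (BB q a b.swap) := by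
  refine (closure_le _).2 ?_
  rintro _ (rfl | ⟨t, ht, rfl⟩)
  · exact mem_sup_left (subset_closure (.inl (.inl rfl)))
  · by_cases h1 : ix b = ix t
    · rcases ix_eq_iff.1 h1 with rfl | rfl
      · exact mem_sup_left (subset_closure (.inl (.inr (.inr rfl))))
      · exact mem_sup_right (mem_zpowers _)
    · exact mem_sup_left (subset_closure
        (.inr ⟨t, ht, by rintro e; exact ha (e ▸ ht), Ne.symm h1, .inl rfl⟩))

end FLift

end RootSubgroups

section GaussDecomposition

open Subgroup

theorem mem_zpowers_pw {n : ℕ} [NeZero n] {E : Type} [Group E] {g x : E} (hg : g ^ n = 1)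
    (hx : x ∈ zpowers g) : ∃ c : ZMod n, x = pw g c := by
  have hf : IsOfFinOrder g := isOfFinOrder_iff_pow_eq_one.2 ⟨n, Nat.pos_of_ne_zero (NeZero.ne n), hg⟩
  obtain ⟨k, rfl⟩ := (hf.mem_powers_iff_mem_zpowers).2 hx
  exact ⟨k, (pw_natCast hg k).symm⟩

variable {l : Type} [Fintype l] [DecidableEq l] [Big l] {n : ℕ} [NeZero n] [IsLocalRing (ZMod n)]
variable {E : Type} [Group E]
variable {π : E →* symplecticGroup l (ZMod n)} {q : (l ⊕ l → ZMod n) → E}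
variable {a b s t : l ⊕ l} {F : Finset l}

/-- The dual basis vector. -/
def dv (R : Type) [CommRing R] (s : l ⊕ l) : l ⊕ l → R := (sg R s : R) • bv R s.swap

theorem om_dv (R : Type) [CommRing R] (s : l ⊕ l) : om (bv R s) (dv R s) = 1 := by
  rw [dv, om_smul_right, om_bv_swap, sg_sq]

theorem fr_dv {R : Type} [CommRing R] (h : ix s ≠ ix t) : Fr (bv R s) (dv R t) :=
  ((fr_bv (R := R) (s := t.swap) (r := s) (by simpa using h)).symm.smul (sg R t)).symm

theorem exists_fr_dv {R : Type} [CommRing R] (s : l ⊕ l) : ∃ v, Fr (dv R s) v := by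
  obtain ⟨v, f⟩ := exists_fr_bv (R := R) s.swap
  exact ⟨_, f.smul _⟩

theorem om_dv_of_ix {R : Type} [CommRing R] (h : ix s ≠ ix t) : om (dv R s) (bv R t) = 0 := by
  rw [dv, om_smul_left, om_bv_of_ix (by simpa using h), mul_zero]

theorem om_dv_dv_of_ix {R : Type} [CommRing R] (h : ix s ≠ ix t) : om (dv R s) (dv R t) = 0 := by
  rw [dv, dv, om_smul_left, om_smul_right, om_bv_of_ix (by simpa using h), mul_zero, mul_zero]

/-- Torus elements. -/
def hk (q : (l ⊕ l → ZMod n) → E) (a : l ⊕ l) (u : (ZMod n)ˣ) : E :=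
  hl (xl q (bv (ZMod n) a)) (fun t => xl q (dv (ZMod n) a) (-t)) u

/-- The Levi factor in the Gauss decomposition. -/
def LL (q : (l ⊕ l → ZMod n) → E) (a : l ⊕ l) (F : Finset l) : Subgroup E :=
  closure (Set.range (hk q a)) ⊔ NN q F

namespace FLift

variable (h : FLift π q)
include h

theorem q_dv (s : l ⊕ l) : q (dv (ZMod n) s) = qb q s.swap := by
  obtain ⟨v, f⟩ := exists_fr_bv (R := ZMod n) s.swap
  rw [dv, h.q_smul f, pow_two, sg_sq, pw_one (h.q_pow f)]; rfl

theorem rank1_hk (a : l ⊕ l) :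
    Rank1 (xl q (bv (ZMod n) a)) (fun t => xl q (dv (ZMod n) a) (-t)) := by
  obtain ⟨s, f⟩ := exists_fr_bv (R := ZMod n) a
  obtain ⟨s', f'⟩ := exists_fr_dv (R := ZMod n) a
  exact h.rank1_long f f' (om_dv _ a)

theorem hk_act (a : l ⊕ l) (u : (ZMod n)ˣ) :
    ac (π (hk q a u)) (bv (ZMod n) a) = (u : ZMod n) • bv (ZMod n) a ∧
    ac (π (hk q a u)) (dv (ZMod n) a) = ((u⁻¹ : (ZMod n)ˣ) : ZMod n) • dv (ZMod n) a ∧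
    ∀ t, ix a ≠ ix t → ac (π (hk q a u)) (bv (ZMod n) t) = bv (ZMod n) t := by
  obtain ⟨s, f⟩ := exists_fr_bv (R := ZMod n) a
  obtain ⟨s', f'⟩ := exists_fr_dv (R := ZMod n) a
  obtain ⟨h1, h2, h3⟩ := h.hl_long_act f f' (om_dv _ a) u
  exact ⟨h1, h2, fun t ht => h3 _ (om_bv_of_ix ht) (om_dv_of_ix ht)⟩

theorem hk_act_swap (a : l ⊕ l) (u : (ZMod n)ˣ) :
    ac (π (hk q a u)) (bv (ZMod n) a.swap) =
      ((u⁻¹ : (ZMod n)ˣ) : ZMod n) • bv (ZMod n) a.swap := by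
  have h1 := (h.hk_act a u).2.1
  have h2 := congrArg (fun x => (sg (ZMod n) a : ZMod n) • x) h1
  simpa only [dv, map_smul, smul_smul, sg_sq, one_smul, mul_left_comm (sg (ZMod n) a : ZMod n),
    mul_one] using h2

theorem mem_normalizer_UU (ha : ix a ∉ F) {z : E} {c : (ZMod n)ˣ}
    (hz : ac (π z) (bv (ZMod n) a) = (c : ZMod n) • bv (ZMod n) a)
    (hz' : ∀ t, ix a ≠ ix t → ac (π z) (bv (ZMod n) t) = bv (ZMod n) t) :
    z ∈ normalizer (UU q a F : Set E) := by
  have key : ∀ (z : E) (c : (ZMod n)ˣ),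
      ac (π z) (bv (ZMod n) a) = (c : ZMod n) • bv (ZMod n) a →
      (∀ t, ix a ≠ ix t → ac (π z) (bv (ZMod n) t) = bv (ZMod n) t) →
      ∀ x ∈ UU q a F, z * x * z⁻¹ ∈ UU q a F := by
    intro z c hz hz' x hx
    induction hx using closure_induction with
    | mem x hx =>
      rcases hx with rfl | ⟨t, ht, rfl⟩
      · obtain ⟨s, f⟩ := exists_fr_bv (R := ZMod n) a
        rw [h.qb_conj, hz, h.q_smul f]
        exact pw_mem qb_mem_UU _
      · have hat : ix a ≠ ix t := fun e => ha (by rw [e]; exact ht)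
        have := h.b_smul (fr_bv hat) c 1
        rw [Units.val_one, one_smul, mul_one] at this
        rw [h.BB_conj hat, hz, hz' t hat, this]
        exact pw_mem (BB_mem_UU ht) _
    | one => simp
    | mul a b _ _ ha hb =>
      have := mul_mem ha hb
      simpa [mul_assoc] using this
    | inv a _ ha =>
      have := inv_mem ha
      simpa [mul_assoc] using this
  refine mem_normalizer_iff.2 fun x => ⟨key z c hz hz' x, fun hx => ?_⟩
  have := key z⁻¹ c⁻¹ ?_ ?_ _ hx
  · have e : z⁻¹ * (z * x * z⁻¹) * z⁻¹⁻¹ = x := by group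
    rwa [e] at this
  · rw [map_inv π]
    apply ac_inv_eq
    rw [map_smul, hz, smul_smul, Units.inv_mul, one_smul]
  · intro t ht
    rw [map_inv π]
    exact ac_inv_eq (hz' t ht)

theorem LL_le_normalizer (ha : ix a ∉ F) : LL q a F ≤ normalizer (UU q a F : Set E) := by
  refine sup_le ((closure_le _).2 ?_) (h.NN_le_normalizer_UU ha)
  rintro _ ⟨u, rfl⟩
  exact h.mem_normalizer_UU ha (h.hk_act a u).1 (h.hk_act a u).2.2

theorem LL_le_normalizer_swap (ha : ix a ∉ F) : LL q a F ≤ normalizer (UU q a.swap F : Set E) := by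
  refine sup_le ((closure_le _).2 ?_) (h.NN_le_normalizer_UU (by simpa using ha))
  rintro _ ⟨u, rfl⟩
  exact h.mem_normalizer_UU (by simpa using ha) (h.hk_act_swap a u)
    (fun t ht => (h.hk_act a u).2.2 t (by simpa using ht))

theorem rank1_ab (hab : ix a ≠ ix b) :
    Rank1 (fun t => xs q (bv (ZMod n) a) (dv (ZMod n) b) (-t))
      (fun t => xs q (dv (ZMod n) a) (bv (ZMod n) b) (-t)) :=
  h.rank1_short (fr_dv hab) (fr_dv hab.symm).symm (om_dv _ a) (om_dv _ b) (om_bv_of_ix hab)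
    (om_dv_dv_of_ix hab)

theorem xs_eq (hab : ix a ≠ ix b) (t : ZMod n) : xs q (bv (ZMod n) a) (dv (ZMod n) b) (-t) =
    pw (BB q a b.swap) (-(sg (ZMod n) b : ZMod n) * t) := by
  have f : Fr (bv (ZMod n) a) (bv (ZMod n) b.swap) := fr_bv (by simpa using hab)
  rw [xs, dv, h.b_smul_right f, pw_pw (h.b_pow f), mul_neg, neg_mul]; rfl

theorem ys_eq (hab : ix a ≠ ix b) (t : ZMod n) : xs q (dv (ZMod n) a) (bv (ZMod n) b) (-t) =
    pw (BB q a.swap b) (-(sg (ZMod n) a : ZMod n) * t) := by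
  rw [xs, h.b_symm (fr_dv hab.symm).symm, BB, h.b_symm (fr_bv (by simpa using hab)),
    ← xs, h.xs_eq hab.symm]; rfl

theorem hl_short_mem (hab : ix a ≠ ix b) (hb : ix b ∈ F) (u : (ZMod n)ˣ) :
    hl (fun t => xs q (bv (ZMod n) a) (dv (ZMod n) b) (-t))
      (fun t => xs q (dv (ZMod n) a) (bv (ZMod n) b) (-t)) u ∈ LL q a F := by
  have r := h.rank1_ab hab
  have f : Fr (bv (ZMod n) a) (dv (ZMod n) b) := fr_dv hab
  have f' : Fr (dv (ZMod n) a) (bv (ZMod n) b) := (fr_dv hab.symm).symm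
  obtain ⟨k1, k2, k3⟩ := h.hk_act a u
  obtain ⟨w1, w2, w3, w4, -⟩ := h.wl_short_act f f' (om_dv _ a) (om_dv _ b) (om_bv_of_ix hab)
    (om_dv_dv_of_ix hab) 1
  set x := (fun t => xs q (bv (ZMod n) a) (dv (ZMod n) b) (-t)) with hx
  set y := (fun t => xs q (dv (ZMod n) a) (bv (ZMod n) b) (-t)) with hy
  have k3' : ac (π (hk q a u)) (dv (ZMod n) b) = dv (ZMod n) b := by
    rw [dv, map_smul, k3 _ (by simpa using hab)]
  have ex : ∀ t, hk q a u * x t * (hk q a u)⁻¹ = x (u * t) := by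
    intro t
    have := h.b_smul f u 1
    rw [Units.val_one, one_smul, mul_one] at this
    simp only [hx, xs]
    rw [pw_conj, h.b_equi f, k1, k3', this, pw_pw (h.b_pow f), mul_neg]
  have ey : ∀ t, hk q a u * y t * (hk q a u)⁻¹ = y ((u⁻¹ : (ZMod n)ˣ) * t) := by
    intro t
    have := h.b_smul f' u⁻¹ 1
    rw [Units.val_one, one_smul, mul_one] at this
    simp only [hy, xs]
    rw [pw_conj, h.b_equi f', k2, k3 _ hab, this, pw_pw (h.b_pow f'), mul_neg]
  have ew : wl x y u = hk q a u * wl x y 1 * (hk q a u)⁻¹ := by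
    have : hk q a u * wl x y 1 * (hk q a u)⁻¹ = hk q a u * x 1 * (hk q a u)⁻¹ *
      (hk q a u * y (-1) * (hk q a u)⁻¹) * (hk q a u * x 1 * (hk q a u)⁻¹) := by
      simp only [wl, Units.val_one, inv_one]; group
    rw [this, ex, ey, wl, mul_one, mul_neg_one]
  have m1 : hk q a u ∈ LL q a F := mem_sup_left (subset_closure ⟨u, rfl⟩)
  have el : ∀ t, wl x y 1 * xl q (bv (ZMod n) a) t * (wl x y 1)⁻¹ = xl q (bv (ZMod n) b) t := by
    intro t
    obtain ⟨s, g⟩ := exists_fr_bv (R := ZMod n) b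
    rw [xl, pw_conj, h.equi _ _ f.uni, w1, inv_one, Units.val_one, neg_smul, one_smul,
      h.even _ g.uni]; rfl
  have el' : ∀ t, wl x y 1 * xl q (dv (ZMod n) a) t * (wl x y 1)⁻¹ = xl q (dv (ZMod n) b) t := by
    intro t
    obtain ⟨s, g⟩ := exists_fr_dv (R := ZMod n) b
    rw [xl, pw_conj, h.equi _ _ f'.uni, w3, Units.val_one, neg_smul, one_smul,
      h.even _ g.uni]; rfl
  have conj : ∀ g1 g2 : E, wl x y 1 * (g1 * g2) * (wl x y 1)⁻¹ =
      (wl x y 1 * g1 * (wl x y 1)⁻¹) * (wl x y 1 * g2 * (wl x y 1)⁻¹) := fun g1 g2 => by group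
  have m2 : wl x y 1 * hk q a u * (wl x y 1)⁻¹ ∈ LL q a F := by
    refine mem_sup_right ?_
    have : wl x y 1 * hk q a u * (wl x y 1)⁻¹ = hk q b u := by
      simp only [hk, hl, wl, conj] at conj el el' ⊢
      simp only [el, el']
    rw [this]
    have mx : ∀ t, xl q (bv (ZMod n) b) t ∈ NN q F := fun t => pw_mem (qb_mem_NN hb) _
    have my : ∀ t, xl q (dv (ZMod n) b) t ∈ NN q F := fun t => by
      rw [xl, h.q_dv]; exact pw_mem (qb_mem_NN (by simpa using hb)) _
    exact mul_mem (mul_mem (mul_mem (mx _) (my _)) (mx _)) (mul_mem (mul_mem (mx _) (my _)) (mx _))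
  have e : hl x y u = hk q a u * (wl x y 1 * hk q a u * (wl x y 1)⁻¹)⁻¹ := by
    rw [hl, r.w_neg, ew]; group
  rw [e]
  exact mul_mem m1 (inv_mem m2)

theorem gauss_short (ha : ix a ∉ F) (hb : ix b ∈ F) :
    zpowers (BB q a.swap b) ≤ Stb (GP (UU q a F) (UU q a.swap F) (LL q a F)) := by
  have hab : ix a ≠ ix b := fun e => ha (by rw [e]; exact hb)
  have n1 : zpowers (BB q a b.swap) ≤ normalizer (WW q a.swap b.swap F : Set E) := by
    simpa using h.BB_normalizes_WW (a := a.swap) (b := b.swap) (F := F) (by simpa using hab)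
  have n2 : zpowers (BB q a b.swap) ≤ normalizer (WW q a b F : Set E) := by
    rw [h.BB_symm (by simpa using hab), WW_symm (h.BB_symm hab)]
    exact h.BB_normalizes_WW hab.symm
  have n3 : zpowers (BB q a.swap b) ≤ normalizer (WW q a.swap b.swap F : Set E) := by
    rw [h.BB_symm (by simpa using hab), WW_symm (h.BB_symm (by simpa using hab))]
    simpa using h.BB_normalizes_WW (a := b.swap) (b := a.swap) (F := F) (by simpa using hab.symm)
  have hW : WW q a.swap b.swap F ≤ UU q a.swap F ⊔ LL q a F :=
    (WW_le (by simpa using hb)).trans (sup_le_sup_left le_sup_right _)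
  have hU := UU_le (q := q) (b := b.swap) (a := a.swap) (F := F) (by simpa using ha)
  rw [Sum.swap_swap] at hU
  refine gauss (h.LL_le_normalizer ha) (h.LL_le_normalizer_swap ha)
    (zpowers_le.2 (BB_mem_UU (by simpa using hb))) (zpowers_le.2 (BB_mem_UU hb))
    ((WW_le hb).trans (sup_le_sup_left le_sup_right _)) hW n2 (h.BB_normalizes_WW hab) n1 n3
    (UU_le ha) hU ?_
  have hX := h.BB_pow (s := a) (t := b.swap) (by simpa using hab)
  have hY := h.BB_pow (s := a.swap) (t := b) (by simpa using hab)
  have r := h.rank1_ab hab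
  have eX : ∀ c, pw (BB q a b.swap) c = xs q (bv (ZMod n) a) (dv (ZMod n) b)
      (-(-(sg (ZMod n) b : ZMod n) * c)) := fun c => by
    rw [h.xs_eq hab, ← mul_assoc, neg_mul_neg, sg_sq, one_mul]
  have eY : ∀ c, pw (BB q a.swap b) c = xs q (dv (ZMod n) a) (bv (ZMod n) b)
      (-(-(sg (ZMod n) a : ZMod n) * c)) := fun c => by
    rw [h.ys_eq hab, ← mul_assoc, neg_mul_neg, sg_sq, one_mul]
  intro y hy x hx y' hy'
  obtain ⟨t, rfl⟩ := mem_zpowers_pw hY hy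
  obtain ⟨s, rfl⟩ := mem_zpowers_pw hX hx
  obtain ⟨t', rfl⟩ := mem_zpowers_pw hY hy'
  obtain ⟨c, d, g, hg, e, heq⟩ := r.yxy_mem (-(sg (ZMod n) a : ZMod n) * t)
    (-(sg (ZMod n) b : ZMod n) * s) (-(sg (ZMod n) a : ZMod n) * t')
  rw [eY, eX, eY, heq]
  refine ⟨_, ?_, _, ?_, g, ?_, _, ?_, rfl⟩
  · rw [h.xs_eq hab]; exact pw_mem (mem_zpowers _) _
  · rw [h.ys_eq hab]; exact pw_mem (mem_zpowers _) _
  · refine (closure_le _).2 ?_ hg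
    rintro _ ⟨u, rfl⟩
    exact h.hl_short_mem hab hb u
  · rw [h.xs_eq hab]; exact pw_mem (mem_zpowers _) _

theorem gauss_long (a : l ⊕ l) :
    zpowers (qb q a.swap) ≤ Stb (GP (UU q a ∅) (UU q a.swap ∅) (LL q a ∅)) := by
  have e0 : ∀ a, UU q a ∅ = zpowers (qb q a) := fun a => by
    rw [UU, zpowers_eq_closure]; congr 1; ext; simp
  have hN : ∀ X : Subgroup E, X ≤ normalizer ((⊥ : Subgroup E) : Set E) := fun X =>
    le_normalizer_of_normal
  refine gauss (h.LL_le_normalizer (Finset.notMem_empty _))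
    (h.LL_le_normalizer_swap (Finset.notMem_empty _))
    (X := zpowers (qb q a)) (e0 _).ge (e0 _).ge bot_le bot_le (hN _) (hN _) (hN _) (hN _)
    (by rw [e0]; exact le_sup_right) (by rw [e0]; exact le_sup_right) ?_
  intro y hy x hx y' hy'
  obtain ⟨t, rfl⟩ := mem_zpowers_pw (h.qb_pow _) hy
  obtain ⟨s, rfl⟩ := mem_zpowers_pw (h.qb_pow _) hx
  obtain ⟨t', rfl⟩ := mem_zpowers_pw (h.qb_pow _) hy'
  obtain ⟨c, d, g, hg, e, heq⟩ := (h.rank1_hk a).yxy_mem (-t) s (-t')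
  simp only [xl, h.q_dv, neg_neg] at heq
  refine ⟨_, pw_mem (mem_zpowers _) _, _, pw_mem (mem_zpowers _) _, g, ?_, _,
    pw_mem (mem_zpowers _) _, heq⟩
  refine (closure_le _).2 ?_ hg
  rintro _ ⟨u, rfl⟩
  exact mem_sup_left (subset_closure ⟨u, rfl⟩)

/-- Gauss decomposition of the group of root elements. -/
theorem gauss_NN (ha : ix a ∉ F) {z : E} (hz : z ∈ NN q (insert (ix a) F)) :
    z ∈ GP (UU q a F) (UU q a.swap F) (LL q a F) := by
  refine mem_GP_of_le ((closure_le _).2 ?_) hz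
  have hL : LL q a F ≤ Stb (GP (UU q a F) (UU q a.swap F) (LL q a F)) :=
    le_Stb_mid (h.LL_le_normalizer ha) (h.LL_le_normalizer_swap ha)
  have hU : UU q a F ≤ Stb (GP (UU q a F) (UU q a.swap F) (LL q a F)) := le_Stb_left _ _ _
  have hB : ∀ t, ix t ∈ F → BB q a.swap t ∈ Stb (GP (UU q a F) (UU q a.swap F) (LL q a F)) :=
    fun t ht => h.gauss_short ha ht (mem_zpowers _)
  have hq : qb q a.swap ∈ Stb (GP (UU q a F) (UU q a.swap F) (LL q a F)) := by
    rcases F.eq_empty_or_nonempty with rfl | ⟨j, hj⟩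
    · exact h.gauss_long a (mem_zpowers _)
    · have hja : ix (.inl j : l ⊕ l) ≠ ix a.swap := by
        rintro e; rw [ix_swap] at e; exact ha (by rw [← e]; exact hj)
      have h1 := h.qb_conj (.inl j) (BB q a.swap (.inr j))
      have h2 := h.BB_move (s := (.inr j : l ⊕ l)) (t := a.swap) hja
      rw [← h.BB_symm (by exact hja.symm)] at h2
      simp only [Sum.swap_inr, sg_inr] at h2
      rw [h2, h.q_add (fr_bv hja)] at h1
      have e3 : ((-1 : (ZMod n)ˣ) : ZMod n) ^ 2 = 1 := by simp
      rw [e3, pw_one (show q (bv (ZMod n) a.swap) ^ n = 1 from h.qb_pow a.swap)] at h1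
      have e4 : q (bv (ZMod n) a.swap) = (qb q (.inl j) * pw (BB q (.inl j) a.swap)
          ((-1 : (ZMod n)ˣ) : ZMod n))⁻¹ *
          (BB q a.swap (.inr j) * qb q (.inl j) * (BB q a.swap (.inr j))⁻¹) := by
        rw [h1]; simp only [qb, BB]; group
      have m1 : qb q (.inl j) ∈ Stb (GP (UU q a F) (UU q a.swap F) (LL q a F)) :=
        hL (mem_sup_right (qb_mem_NN hj))
      rw [qb, e4, h.BB_symm hja]
      exact mul_mem (inv_mem (mul_mem m1 (pw_mem (hB (.inl j) hj) _)))
        (mul_mem (mul_mem (hB (.inr j) hj) m1) (inv_mem (hB (.inr j) hj)))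
  have hAB : ∀ s t, ix s = ix a → ix t ∈ F →
      BB q s t ∈ Stb (GP (UU q a F) (UU q a.swap F) (LL q a F)) := by
    intro s t hs ht
    rcases ix_eq_iff.1 hs.symm with rfl | rfl
    · exact hU (BB_mem_UU ht)
    · exact hB t ht
  rintro g (⟨t, ht, rfl⟩ | ⟨s, t, hs, ht, hst, rfl⟩)
  · rcases Finset.mem_insert.1 ht with ht | ht
    · rcases ix_eq_iff.1 ht.symm with rfl | rfl
      · exact hU qb_mem_UU
      · exact hq
    · exact hL (mem_sup_right (qb_mem_NN ht))
  · rcases Finset.mem_insert.1 hs with hs | hs <;> rcases Finset.mem_insert.1 ht with ht | ht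
    · exact absurd (hs.trans ht.symm) hst
    · exact hAB s t hs ht
    · rw [h.BB_symm hst]; exact hAB t s ht hs
    · exact hL (mem_sup_right (BB_mem_NN hs ht hst))

end FLift

end GaussDecomposition

section Kernel

open Subgroup

variable {l : Type} [Fintype l] [DecidableEq l] [Big l] {n : ℕ} [NeZero n] [IsLocalRing (ZMod n)]
variable {E : Type} [Group E]
variable {π : E →* symplecticGroup l (ZMod n)} {q : (l ⊕ l → ZMod n) → E}
variable {a b s t : l ⊕ l} {F : Finset l}

namespace FLift

variable (h : FLift π q)
include h

omit h in
theorem fix_closure {S : Set E} {x : l ⊕ l → ZMod n} (hS : ∀ g ∈ S, ac (π g) x = x) {z : E}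
    (hz : z ∈ closure S) : ac (π z) x = x := by
  induction hz using closure_induction with
  | mem z hz => exact hS z hz
  | one => simp
  | mul a b _ _ ha hb => rw [map_mul π, ac_mul, hb, ha]
  | inv a _ ha => rw [map_inv π]; exact ac_inv_eq ha

theorem UU_fix (ha : ix a ∉ F) {z : E} (hz : z ∈ UU q a F) (ht : ix t ∉ F) (hat : a.swap ≠ t) :
    ac (π z) (bv (ZMod n) t) = bv (ZMod n) t := by
  refine fix_closure ?_ hz
  rintro _ (rfl | ⟨r, hr, rfl⟩)
  · exact h.qb_fix hat
  · exact h.BB_fix (by rintro e; rw [e] at ha; exact ha hr) hat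
      (by rintro rfl; simp at ht; exact ht hr)

theorem NN_fix {z : E} (hz : z ∈ NN q F) (ht : ix t ∉ F) :
    ac (π z) (bv (ZMod n) t) = bv (ZMod n) t := by
  have hsw : ∀ {r : l ⊕ l}, ix r ∈ F → r.swap ≠ t := fun hr e => ht (by rw [← e]; simpa using hr)
  refine fix_closure ?_ hz
  rintro _ (⟨r, hr, rfl⟩ | ⟨r, s, hr, hs, hrs, rfl⟩)
  · exact h.qb_fix (hsw hr)
  · exact h.BB_fix hrs (hsw hr) (hsw hs)

theorem UU_insert {j : l} (ha : ix a ∉ insert j F) (hj : j ∉ F) {z : E}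
    (hz : z ∈ UU q a (insert j F)) : ∃ w ∈ UU q a F, ∃ c d : ZMod n,
      z = w * pw (BB q a (.inl j)) c * pw (BB q a (.inr j)) d := by
  simp only [Finset.mem_insert, not_or] at ha
  obtain ⟨haj, haF⟩ := ha
  have hne : ∀ {t : l ⊕ l}, ix t ∈ F → ix a ≠ ix t := fun ht e => haF (by rw [e]; exact ht)
  have h1 : ∀ s : l ⊕ l, ix s = j → ∀ x ∈ UU q a F,
      BB q a s * x * (BB q a s)⁻¹ = x := by
    intro s hs x hx
    have has : ix a ≠ ix s := by rwa [hs]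
    refine mul_inv_eq_iff_eq_mul.2 (Commute.eq ?_)
    have : UU q a F ≤ centralizer {BB q a s} := by
      refine (closure_le _).2 ?_
      rintro _ (rfl | ⟨t, ht, rfl⟩)
      · obtain ⟨r, f⟩ := exists_fr_bv (R := ZMod n) a
        exact mem_centralizer_singleton_iff.2
          (h.commute_q f.uni (h.BB_fix has (swap_ne a) (by rintro e; apply_fun ix at e; simp at e; exact has e.symm))).eq.symm
      · refine mem_centralizer_singleton_iff.2 (h.commute_b (fr_bv (hne ht))
          (h.BB_fix has (swap_ne a) (by rintro e; apply_fun ix at e; simp at e; exact has e.symm))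
          (h.BB_fix has ?_ ?_)).eq.symm
        · rintro e; apply_fun ix at e; simp at e; exact hne ht e
        · rintro e; apply_fun ix at e; simp at e; rw [← hs, e] at hj; exact hj ht
    exact (mem_centralizer_singleton_iff.1 (this hx)).symm
  have hl : ix a ≠ ix (.inl j : l ⊕ l) := haj
  have hr : ix a ≠ ix (.inr j : l ⊕ l) := haj
  have n1 : zpowers (BB q a (.inl j)) ≤ normalizer (UU q a F : Set E) := by
    rw [zpowers_eq_closure]
    refine closure_le_normalizer_closure (n := n) (by rintro _ rfl; exact h.BB_pow hl) ?_
    rintro _ rfl x hx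
    change _ ∈ UU q a F
    rw [h1 _ rfl x (subset_closure hx)]; exact subset_closure hx
  have n2 : zpowers (BB q a (.inr j)) ≤
      normalizer ((UU q a F ⊔ zpowers (BB q a (.inl j)) : Subgroup E) : Set E) := by
    have e : UU q a F ⊔ zpowers (BB q a (.inl j)) = closure ({g | g = qb q a ∨ ∃ t, ix t ∈ F ∧
        g = BB q a t} ∪ {BB q a (.inl j)}) := by
      rw [Subgroup.closure_union, ← zpowers_eq_closure]; rfl
    rw [e, zpowers_eq_closure]
    refine closure_le_normalizer_closure (n := n) (by rintro _ rfl; exact h.BB_pow hr) ?_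
    rw [← e]
    rintro _ rfl x (hx | rfl)
    · rw [h1 _ rfl x (subset_closure hx)]; exact mem_sup_left (subset_closure hx)
    · have := h.BB_move hr.symm
      rw [← h.BB_symm hr] at this
      rw [h.BB_symm hl, h.BB_conj hl.symm, h.BB_fix hr (swap_ne a)
        (by rintro e; apply_fun ix at e; simp at e; exact haj e.symm)]
      simp only [Sum.swap_inr] at this
      rw [this, h.b_add_self (fr_bv hl.symm)]
      change BB q (.inl j) a * _ ∈ _
      rw [← h.BB_symm hl]
      exact mul_mem (mem_sup_right (mem_zpowers _)) (pw_mem (mem_sup_left qb_mem_UU) _)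
  have hz' : z ∈ ((UU q a F ⊔ zpowers (BB q a (.inl j)) ⊔ zpowers (BB q a (.inr j)) :
      Subgroup E) : Set E) := by
    refine (closure_le _).2 ?_ hz
    rintro _ (rfl | ⟨t, ht, rfl⟩)
    · exact mem_sup_left (mem_sup_left qb_mem_UU)
    · rcases Finset.mem_insert.1 ht with ht | ht
      · cases t with
        | inl i => obtain rfl : i = j := ht; exact mem_sup_left (mem_sup_right (mem_zpowers _))
        | inr i => obtain rfl : i = j := ht; exact mem_sup_right (mem_zpowers _)
      · exact mem_sup_left (mem_sup_left (BB_mem_UU ht))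
  rw [coe_mul_of_right_le_normalizer_left _ _ n2] at hz'
  obtain ⟨x, hx, y, hy, rfl⟩ := hz'
  rw [coe_mul_of_right_le_normalizer_left _ _ n1] at hx
  obtain ⟨w, hw, x, hx, rfl⟩ := hx
  obtain ⟨c, rfl⟩ := mem_zpowers_pw (h.BB_pow hl) hx
  obtain ⟨d, rfl⟩ := mem_zpowers_pw (h.BB_pow hr) hy
  exact ⟨w, hw, c, d, rfl⟩

theorem UU_eq_one : ∀ (F : Finset l), ix a ∉ F → ∀ z ∈ UU q a F,
    ac (π z) (bv (ZMod n) a.swap) = bv (ZMod n) a.swap → z = 1 := by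
  intro F
  induction F using Finset.induction_on with
  | empty =>
    intro _ z hz hfix
    have e0 : UU q a ∅ = zpowers (qb q a) := by rw [UU, zpowers_eq_closure]; congr 1; ext; simp
    rw [e0] at hz
    obtain ⟨c, rfl⟩ := mem_zpowers_pw (h.qb_pow a) hz
    obtain ⟨s, f⟩ := exists_fr_bv (R := ZMod n) a
    have h1 := h.pw_q_act f c (bv (ZMod n) a.swap)
    rw [qb] at hfix
    rw [hfix, om_bv_swap, left_eq_add] at h1
    have h2 := congrFun h1 a
    simp [bv] at h2
    rw [h2, pw_zero]
  | insert j F hj ih =>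
    intro ha z hz hfix
    obtain ⟨w, hw, c, d, rfl⟩ := h.UU_insert ha hj hz
    simp only [Finset.mem_insert, not_or] at ha
    obtain ⟨haj, haF⟩ := ha
    have hl : ix a ≠ ix (.inl j : l ⊕ l) := haj
    have hr : ix a ≠ ix (.inr j : l ⊕ l) := haj
    have wa := h.UU_fix haF hw haF (swap_ne a)
    have wl := h.UU_fix haF hw (t := .inl j) hj (by rintro e; apply_fun ix at e; simp at e; exact haj e)
    have wr := h.UU_fix haF hw (t := .inr j) hj (by rintro e; apply_fun ix at e; simp at e; exact haj e)
    have al := h.pw_b_act (fr_bv hl)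
    have ar := h.pw_b_act (fr_bv hr)
    have key : ∀ x, om (ac (π (w * pw (BB q a (.inl j)) c * pw (BB q a (.inr j)) d)) x)
        (bv (ZMod n) a.swap) = om x (bv (ZMod n) a.swap) := by
      intro x
      conv_lhs => rw [← hfix]
      exact om_ac _ _ _
    have o1 : om (bv (ZMod n) a) (bv (ZMod n) (.inl j)) = 0 := om_bv_of_ix hl
    have o2 : om (bv (ZMod n) a) (bv (ZMod n) (.inr j)) = 0 := om_bv_of_ix hr
    have o3 : om (bv (ZMod n) (.inl j : l ⊕ l)) (bv (ZMod n) a) = 0 := om_bv_of_ix hl.symm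
    have o4 : om (bv (ZMod n) (.inl j : l ⊕ l)) (bv (ZMod n) (.inr j)) = 1 := om_bv_swap (.inl j)
    have o5 : om (bv (ZMod n) (.inr j : l ⊕ l)) (bv (ZMod n) (.inl j)) = -1 := by
      rw [om_swap, o4]
    have hs : IsUnit (om (bv (ZMod n) a) (bv (ZMod n) a.swap)) := by
      rw [om_bv_swap]; exact Units.isUnit _
    have d0 : d = 0 := by
      have := key (bv (ZMod n) (.inl j))
      simp only [map_mul π, ac_mul, BB, al, ar, o1, o3, o5, om_self, mul_zero, zero_smul,
        add_zero, map_add, map_smul, wa, wl, om_add_left, om_smul_left, add_eq_left] at this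
      simpa using (hs.mul_left_eq_zero.1 this)
    have c0 : c = 0 := by
      have := key (bv (ZMod n) (.inr j))
      simp only [map_mul π, ac_mul, BB, al, ar, o2, o4, d0, om_self, mul_zero, zero_smul,
        add_zero, map_add, map_smul, wa, wr, om_add_left, om_smul_left, add_eq_left] at this
      simpa using (hs.mul_left_eq_zero.1 this)
    subst c0 d0
    rw [pw_zero, pw_zero, mul_one, mul_one] at hfix ⊢
    exact ih haF w hw hfix

theorem map_NN_univ : (NN q (Finset.univ : Finset l)).map π = ⊤ := by
  rw [← Gn_univ, eq_comm]
  refine le_antisymm ((closure_le _).2 ?_) (by rw [Gn_univ]; exact le_top)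
  rintro _ ⟨w, t, ⟨s, hs⟩, -, rfl⟩
  set P := (NN q (Finset.univ : Finset l)).map π with hP
  have pq : ∀ (r : l ⊕ l) (c : ZMod n), π (pw (qb q r) c) ∈ P := fun r c =>
    mem_map_of_mem π (pw_mem (qb_mem_NN (Finset.mem_univ _)) c)
  have pb : ∀ (r r' : l ⊕ l) (c : ZMod n), ix r ≠ ix r' → π (pw (BB q r r') c) ∈ P := fun r r' c hr =>
    mem_map_of_mem π (pw_mem (BB_mem_NN (Finset.mem_univ _) (Finset.mem_univ _) hr) c)
  obtain ⟨u, hu⟩ := hs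
  have step : ∀ G : Finset (l ⊕ l), ∃ M ∈ P, ac M w s = u ∧
      ∀ r ∈ G, ix r ≠ ix s → ac M w r = 0 := by
    intro G
    induction G using Finset.induction_on with
    | empty => exact ⟨1, one_mem _, by simp [hu], by simp⟩
    | insert r G hr ih =>
      obtain ⟨M, hM, h1, h2⟩ := ih
      by_cases hrs : ix r = ix s
      · exact ⟨M, hM, h1, fun r' hr' h' => by
          rcases Finset.mem_insert.1 hr' with rfl | hr'
          · exact absurd hrs h'
          · exact h2 r' hr' h'⟩
      · have hsr : ix s.swap ≠ ix r := by simpa using Ne.symm hrs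
        have act := h.pw_b_act (fr_bv hsr) (sg (ZMod n) s * (u⁻¹ : (ZMod n)ˣ) * ac M w r) (ac M w)
        rw [om_bv_left s.swap, Sum.swap_swap, h1, sg_swap] at act
        have e : (sg (ZMod n) s * (u⁻¹ : (ZMod n)ˣ) * ac M w r) * (((-sg (ZMod n) s : (ZMod n)ˣ) : ZMod n) * u)
            = - ac M w r := by
          have e1 := sg_sq (R := ZMod n) s
          have e2 := u.inv_mul
          push_cast
          linear_combination (-(((u⁻¹ : (ZMod n)ˣ) : ZMod n) * u * ac M w r)) * e1 - ac M w r * e2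
        rw [e] at act
        refine ⟨_, mul_mem (pb s.swap r ((sg (ZMod n) s : ZMod n) * (u⁻¹ : (ZMod n)ˣ) * ac M w r) hsr) hM, ?_, ?_⟩
        · rw [ac_mul, BB, act]
          have g1 : s ≠ r := by rintro rfl; exact hrs rfl
          simp [bv, g1, h1, (swap_ne s).symm]
        · intro r' hr' h'
          have g1 : r' ≠ s.swap := by rintro rfl; simp at h'
          rw [ac_mul, BB, act]
          rcases Finset.mem_insert.1 hr' with rfl | hr''
          · simp [bv, g1]
          · have g2 : r' ≠ r := by rintro rfl; exact hr hr''
            simp [bv, g1, g2, h2 r' hr'' h']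
  obtain ⟨M, hM, h1, h2⟩ := step Finset.univ
  obtain ⟨s', f⟩ := exists_fr_bv (R := ZMod n) s.swap
  have act := h.pw_q_act f (sg (ZMod n) s * (u⁻¹ : (ZMod n)ˣ) * ac M w s.swap) (ac M w)
  obtain ⟨M', hM', e⟩ : ∃ M' ∈ P, ac M' w = (u : ZMod n) • bv (ZMod n) s := by
    refine ⟨_, mul_mem (pq s.swap ((sg (ZMod n) s : ZMod n) * (u⁻¹ : (ZMod n)ˣ) * ac M w s.swap)) hM, ?_⟩
    rw [ac_mul, qb, act, om_bv_left s.swap, Sum.swap_swap, h1, sg_swap]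
    have e : (sg (ZMod n) s * (u⁻¹ : (ZMod n)ˣ) * ac M w s.swap) * (((-sg (ZMod n) s : (ZMod n)ˣ) : ZMod n) * u)
        = - ac M w s.swap := by
      have e1 := sg_sq (R := ZMod n) s
      have e2 := u.inv_mul
      push_cast
      linear_combination (-(((u⁻¹ : (ZMod n)ˣ) : ZMod n) * u * ac M w s.swap)) * e1 - ac M w s.swap * e2
    rw [e]
    ext r
    by_cases hr : ix s = ix r
    · rcases ix_eq_iff.1 hr with rfl | rfl
      · simp [bv, (swap_ne r).symm, h1]
      · simp [bv, swap_ne s]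
    · have g1 : r ≠ s.swap := by rintro rfl; simp at hr
      have g2 : r ≠ s := by rintro rfl; simp at hr
      simp [bv, g1, g2, h2 r (Finset.mem_univ _) (Ne.symm hr)]
  have hT : T w t = M'⁻¹ * T ((u : ZMod n) • bv (ZMod n) s) t * M'⁻¹⁻¹ := by
    rw [T_conj, ← e, ac_inv_ac]
  obtain ⟨s'', f'⟩ := exists_fr_bv (R := ZMod n) s
  have hT' : ∀ c, T (bv (ZMod n) s) c = π (pw (qb q s) c) := fun c => by
    refine sp_ext fun v => ?_
    rw [ac_T, qb, h.pw_q_act f']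
  rw [hT, T_smul, hT']
  exact mul_mem (mul_mem (inv_mem hM') (pq _ _)) (inv_mem (inv_mem hM'))

end FLift

end Kernel

section SymbolKernel

open Subgroup

variable {l : Type} [Fintype l] [DecidableEq l] [Big l] {n : ℕ} [NeZero n] [IsLocalRing (ZMod n)]
variable {E : Type} [Group E]
variable {π : E →* symplecticGroup l (ZMod n)} {q : (l ⊕ l → ZMod n) → E}
variable {a b s t : l ⊕ l} {F : Finset l}

/-- The symbols of the long root `a`. -/
def sk (q : (l ⊕ l → ZMod n) → E) (a : l ⊕ l) (u v : (ZMod n)ˣ) : E :=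
  sy (xl q (bv (ZMod n) a)) (fun t => xl q (dv (ZMod n) a) (-t)) u v

/-- The subgroup generated by the symbols. -/
def SK (q : (l ⊕ l → ZMod n) → E) (a : l ⊕ l) : Subgroup E :=
  closure {g | ∃ u v, g = sk q a u v}

theorem sk_eq (q : (l ⊕ l → ZMod n) → E) (a : l ⊕ l) (u v : (ZMod n)ˣ) :
    sk q a u v = hk q a u * hk q a v * (hk q a (u * v))⁻¹ := rfl

theorem sp_ext_bv {M N : symplecticGroup l (ZMod n)}
    (h : ∀ s, ac M (bv (ZMod n) s) = ac N (bv (ZMod n) s)) : M = N :=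
  sp_ext_basis (fun i => h (.inl i)) fun i => h (.inr i)

namespace FLift

variable (h : FLift π q)
include h

theorem sk_ker (a : l ⊕ l) (u v : (ZMod n)ˣ) : sk q a u v ∈ π.ker := by
  rw [MonoidHom.mem_ker, sk_eq, map_mul π, map_mul π, map_inv π, mul_inv_eq_one]
  refine sp_ext_bv fun s => ?_
  rw [ac_mul]
  by_cases hs : ix a = ix s
  · rcases ix_eq_iff.1 hs with rfl | rfl
    · rw [(h.hk_act s v).1, map_smul, (h.hk_act s u).1, (h.hk_act s _).1, smul_smul, Units.val_mul,
        mul_comm]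
    · rw [h.hk_act_swap, map_smul, h.hk_act_swap, h.hk_act_swap, smul_smul, mul_inv, Units.val_mul,
        mul_comm]
  · rw [(h.hk_act a v).2.2 s hs, (h.hk_act a u).2.2 s hs, (h.hk_act a _).2.2 s hs]

theorem sk_center (a : l ⊕ l) (u v : (ZMod n)ˣ) : sk q a u v ∈ center E := h.cent (h.sk_ker a u v)

theorem hk_conj (z : E) (ha : ac (π z) (bv (ZMod n) a) = bv (ZMod n) b)
    (ha' : ac (π z) (dv (ZMod n) a) = dv (ZMod n) b) (u : (ZMod n)ˣ) :
    z * hk q a u * z⁻¹ = hk q b u := by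
  have conj : ∀ g1 g2 : E, z * (g1 * g2) * z⁻¹ = (z * g1 * z⁻¹) * (z * g2 * z⁻¹) :=
    fun g1 g2 => by group
  obtain ⟨s, f⟩ := exists_fr_bv (R := ZMod n) a
  obtain ⟨s', f'⟩ := exists_fr_dv (R := ZMod n) a
  have el : ∀ t, z * xl q (bv (ZMod n) a) t * z⁻¹ = xl q (bv (ZMod n) b) t := by
    intro t
    rw [xl, pw_conj, h.equi _ _ f.uni, ha]; rfl
  have el' : ∀ t, z * xl q (dv (ZMod n) a) t * z⁻¹ = xl q (dv (ZMod n) b) t := by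
    intro t
    rw [xl, pw_conj, h.equi _ _ f'.uni, ha']; rfl
  simp only [hk, hl, wl, conj, el, el']

theorem SK_eq (i j : l) : SK q (.inl i) = SK q (.inl j) := by
  obtain ⟨z, hz⟩ := h.surj (Pm (ZMod n) (Equiv.swap i j))
  have h1 : ac (π z) (bv (ZMod n) (.inl i)) = bv (ZMod n) (.inl j) := by
    rw [hz, bv_inl, ac_Pm_ve]; simp
  have h2 : ac (π z) (dv (ZMod n) (.inl i)) = dv (ZMod n) (.inl j) := by
    rw [hz, dv, dv]; simp only [Sum.swap_inl, sg_inl, Units.val_one, one_smul, bv_inr, ac_Pm_vf]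
    simp
  have h3 := h.hk_conj z h1 h2
  have h4 : ∀ u v, sk q (.inl i) u v = sk q (.inl j) u v := fun u v => by
    have e : z * sk q (.inl i) u v * z⁻¹ = sk q (.inl j) u v := by
      rw [sk_eq, sk_eq, ← h3, ← h3, ← h3]; group
    rw [← e, mem_center_iff.1 (h.sk_center (.inl i) u v) z, mul_inv_cancel_right]
  simp only [SK, h4]

theorem closure_hk {z : E} (hz : z ∈ closure (Set.range (hk q a))) :
    ∃ s ∈ SK q a, ∃ u, z = s * hk q a u := by
  have h1 : hk q a 1 = 1 := (h.rank1_hk a).hl_one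
  have m : ∀ u v, sk q a u v ∈ SK q a := fun u v => subset_closure ⟨u, v, rfl⟩
  have hc : SK q a ≤ center E := (closure_le _).2 (by rintro _ ⟨u, v, rfl⟩; exact h.sk_center a u v)
  induction hz using closure_induction with
  | mem z hz => obtain ⟨u, rfl⟩ := hz; exact ⟨1, one_mem _, u, by simp⟩
  | one => exact ⟨1, one_mem _, 1, by simp [h1]⟩
  | mul x y _ _ hx hy =>
    obtain ⟨s, hs, u, rfl⟩ := hx
    obtain ⟨s', hs', u', rfl⟩ := hy
    refine ⟨s * s' * sk q a u u', mul_mem (mul_mem hs hs') (m _ _), u * u', ?_⟩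
    rw [sk_eq]
    have := mem_center_iff.1 (hc hs') (hk q a u)
    calc s * hk q a u * (s' * hk q a u') = s * (hk q a u * s') * hk q a u' := by group
      _ = _ := by rw [this]; group
  | inv x _ hx =>
    obtain ⟨s, hs, u, rfl⟩ := hx
    refine ⟨s⁻¹ * (sk q a u u⁻¹)⁻¹, mul_mem (inv_mem hs) (inv_mem (m _ _)), u⁻¹, ?_⟩
    have e : (hk q a u)⁻¹ = (sk q a u⁻¹ u)⁻¹ * hk q a u⁻¹ := by
      rw [sk_eq, inv_mul_cancel, h1]; group
    have e2 : sk q a u u⁻¹ = sk q a u⁻¹ u := by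
      have := mem_center_iff.1 (h.sk_center a u u⁻¹) (hk q a u)
      rw [sk_eq, mul_inv_cancel, h1] at this
      rw [sk_eq, sk_eq, mul_inv_cancel, inv_mul_cancel, h1]
      simp only [inv_one, mul_one] at this ⊢
      rw [mul_assoc] at this
      exact (mul_left_cancel this)
    rw [_root_.mul_inv_rev, e, e2, mul_assoc, mul_assoc]
    have h5 := mem_center_iff.1 (hc (inv_mem hs)) (hk q a u⁻¹)
    have h6 := mem_center_iff.1 (hc (inv_mem hs)) (sk q a u⁻¹ u)⁻¹
    rw [h5, ← mul_assoc, h6, mul_assoc]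

theorem NN_ker {i0 : l} : ∀ (F : Finset l), ∀ z ∈ NN q F, π z = 1 → z ∈ SK q (.inl i0) := by
  intro F
  induction F using Finset.induction_on with
  | empty =>
    intro z hz _
    have : NN q ∅ = ⊥ := by rw [NN]; simp
    rw [this, mem_bot] at hz
    rw [hz]; exact one_mem _
  | insert k F hk ih =>
    intro z hz hπ
    set a : l ⊕ l := .inl k with ha
    have haF : ix a ∉ F := hk
    have haF' : ix a.swap ∉ F := hk
    obtain ⟨u, hu, v, hv, g, hg, u', hu', rfl⟩ := h.gauss_NN (a := a) haF hz
    have hzc := h.cent (MonoidHom.mem_ker.2 hπ)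
    have e1 : u * v * g * u' = u' * u * v * g := by
      have := mem_center_iff.1 hzc u'
      calc u * v * g * u' = (u * v * g * u' * u') * u'⁻¹ := by group
        _ = _ := by rw [← this]; group
    rw [e1] at hπ ⊢
    have nm : closure (Set.range (SpH2.hk q a)) ≤ normalizer (NN q F : Set E) := by
      have : closure (Set.range (SpH2.hk q a)) ≤ centralizer (NN q F : Set E) := by
        refine (closure_le _).2 ?_
        rintro _ ⟨c, rfl⟩
        rw [SetLike.mem_coe, mem_centralizer_iff]
        intro x hx
        have : NN q F ≤ centralizer {SpH2.hk q a c} := by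
          have fx : ∀ t, ix t ∈ F → ac (π (SpH2.hk q a c)) (bv (ZMod n) t) = bv (ZMod n) t :=
            fun t ht => (h.hk_act a c).2.2 t (by rintro e; rw [e] at haF; exact haF ht)
          refine (closure_le _).2 ?_
          rintro _ (⟨t, ht, rfl⟩ | ⟨s, t, hs, ht, hst, rfl⟩)
          · obtain ⟨r, f⟩ := exists_fr_bv (R := ZMod n) t
            exact mem_centralizer_singleton_iff.2 (h.commute_q f.uni (fx t ht)).eq.symm
          · exact mem_centralizer_singleton_iff.2
              (h.commute_b (fr_bv hst) (fx s hs) (fx t ht)).eq.symm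
        exact mem_centralizer_singleton_iff.1 (this hx)
      intro x hx
      refine mem_normalizer_iff.2 fun y => ?_
      have key : ∀ x ∈ closure (Set.range (SpH2.hk q a)), ∀ y ∈ NN q F, x * y * x⁻¹ = y :=
        fun x hx y hy => by
          rw [← mem_centralizer_iff.1 (this hx) y hy, mul_inv_cancel_right]
      refine ⟨fun hy => by rwa [key x hx y hy], fun hy => ?_⟩
      have := key x⁻¹ (inv_mem hx) _ hy
      have e : x⁻¹ * (x * y * x⁻¹) * x⁻¹⁻¹ = y := by group
      rw [e] at this
      rw [this]; exact hy
    have hg' : g ∈ ((closure (Set.range (SpH2.hk q a)) ⊔ NN q F : Subgroup E) : Set E) := hg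
    rw [coe_mul_of_left_le_normalizer_right _ _ nm] at hg'
    obtain ⟨y, hy, x, hx, rfl⟩ := hg'
    obtain ⟨s, hs, c, rfl⟩ := h.closure_hk hy
    have hs1 : π s = 1 := by
      have : SK q a ≤ π.ker := (closure_le _).2 (by rintro _ ⟨u, v, rfl⟩; exact h.sk_ker a u v)
      exact this hs
    have hu2 : u' * u ∈ UU q a F := mul_mem hu' hu
    have fu := h.UU_fix haF hu2 haF (swap_ne a)
    have fv := h.UU_fix haF' hv haF' (swap_ne a.swap)
    have fx := h.NN_fix hx haF
    have fx' := h.NN_fix hx haF'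
    have act : ∀ w, ac (π (u' * u)) (ac (π v) (ac (π (SpH2.hk q a c)) (ac (π x) w))) = w := by
      intro w
      have := congrArg (fun M => ac M w) hπ
      simpa only [map_mul π, ac_mul, hs1, ac_one] using this
    have a1 := act (bv (ZMod n) a)
    rw [fx, (h.hk_act a c).1] at a1
    have a2 : ac (π v) ((c : ZMod n) • bv (ZMod n) a) = bv (ZMod n) a := by
      rw [← ac_inv_ac (π (u' * u)) (ac (π v) _), a1, ac_inv_eq fu]
    have c1 : c = 1 := by
      have e2 := om_ac (π v) (bv (ZMod n) a.swap) ((c : ZMod n) • bv (ZMod n) a)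
      rw [fv, a2, om_smul_right] at e2
      have hs : IsUnit (om (bv (ZMod n) a.swap) (bv (ZMod n) a)) := by
        rw [om_swap]
        refine IsUnit.neg ?_
        rw [om_bv_swap]; exact Units.isUnit _
      refine Units.ext (hs.mul_right_cancel ?_)
      rw [← e2, Units.val_one, one_mul]
    subst c1
    rw [Units.val_one, one_smul] at a2
    have v1 := h.UU_eq_one F haF' v hv (by rwa [Sum.swap_swap])
    have k1 : SpH2.hk q a 1 = 1 := (h.rank1_hk a).hl_one
    subst v1
    have a3 := act (bv (ZMod n) a.swap)
    rw [fx', k1, map_one, ac_one, ac_one] at a3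
    have u1 := h.UU_eq_one F haF _ hu2 a3
    have x1 : π x = 1 := by
      rw [u1, k1] at hπ
      simpa [map_mul π, hs1] using hπ
    rw [u1, k1]
    simp only [one_mul, mul_one]
    exact mul_mem (by rw [h.SK_eq i0 k]; exact hs) (ih x hx x1)

theorem kernel_bound (i0 : l) {p k : ℕ} (hp : p.Prime) (hn : n = p ^ (k + 1)) :
    ∃ N : Subgroup E, N.map π = ⊤ ∧ ∃ e : E, e ^ (if 4 ∣ n then 2 else 1) = 1 ∧
      N ⊓ π.ker ≤ zpowers e := by
  obtain ⟨e, he, hs⟩ := (h.rank1_hk (.inl i0)).symbols hp hn (h.sk_center _)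
  refine ⟨NN q Finset.univ, h.map_NN_univ, e, he, ?_⟩
  rintro z ⟨hz, hz'⟩
  have := h.NN_ker (i0 := i0) _ z hz hz'
  refine (closure_le _).2 ?_ this
  rintro _ ⟨u, v, rfl⟩
  exact hs u v

end FLift

/-- Every central extension contains a subgroup that maps onto the base and meets the kernel in a
cyclic group of exponent dividing `n`. -/
def CentBound (G : Type) [Group G] (n : ℕ) : Prop :=
  ∀ (E : Type) [Group E] (π : E →* G), Function.Surjective π → π.ker ≤ center E →
    ∃ N : Subgroup E, N.map π = ⊤ ∧ ∃ e : E, e ^ n = 1 ∧ N ⊓ π.ker ≤ zpowers e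

theorem isLocalRing_zmod {p k : ℕ} (hp : p.Prime) : IsLocalRing (ZMod (p ^ (k + 1))) := by
  have : Fact p.Prime := ⟨hp⟩
  have : Nontrivial (ZMod (p ^ (k + 1))) :=
    ZMod.nontrivial_iff.2 (Nat.one_lt_pow (Nat.succ_ne_zero _) hp.one_lt).ne'
  exact IsLocalRing.of_surjective' (PadicInt.toZModPow (p := p) (k + 1))
    (ZMod.ringHom_surjective _)

theorem centBound_prime_pow {g p k : ℕ} (hg : 4 ≤ g) (hp : p.Prime) :
    CentBound (symplecticGroup (Fin g) (ZMod (p ^ (k + 1)))) (if 4 ∣ p ^ (k + 1) then 2 else 1) := by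
  intro E _ π hπ hc
  have := isLocalRing_zmod (k := k) hp
  have : NeZero (p ^ (k + 1)) := ⟨pow_ne_zero _ hp.ne_zero⟩
  have : Big (Fin g) := ⟨by rw [Fintype.card_fin]; omega⟩
  obtain ⟨q, hq⟩ := exists_QLift (k := (⟨0, by omega⟩ : Fin g)) (m := ⟨1, by omega⟩)
    (a := ⟨2, by omega⟩) (b := ⟨3, by omega⟩) hπ hc (by simp) (by simp) (by simp) (by simp)
    (by simp) (by simp)
  exact FLift.kernel_bound ⟨hq, hπ, hc⟩ ⟨0, by omega⟩ hp rfl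

end SymbolKernel

section Products

open Subgroup

theorem commutator_symplectic_eq_top {l R : Type} [Fintype l] [DecidableEq l] [CommRing R]
    [IsLocalRing R] {m a b : l} (hma : m ≠ a) (hmb : m ≠ b) (hab : a ≠ b)
    (hR : ∀ t : R, ∃ k : ℕ, (k : R) = t) :
    commutator (symplecticGroup l R) = ⊤ := by
  have h1 : T (ve R m) 1 ∈ commutator (symplecticGroup l R) := by
    rw [T_eq_commutators hma hmb hab]
    exact mul_mem (commutator_mem_commutator (mem_top _) (mem_top _))
      (inv_mem (commutator_mem_commutator (mem_top _) (mem_top _)))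
  rw [← top_le_iff, ← Gn_univ, Gn, closure_le]
  rintro _ ⟨v, t, hv, -, rfl⟩
  obtain ⟨M, rfl⟩ := exists_ac_ve m hv
  obtain ⟨k, rfl⟩ := hR t
  have h2 : T (ac M (ve R m)) (k : R) = (M * T (ve R m) 1 * M⁻¹) ^ k := by
    rw [T_conj, T_pow, mul_one]
  rw [h2]
  exact pow_mem (Normal.conj_mem inferInstance _ h1 M) k

open scoped commutatorElement in
theorem commute_of_perfect {G H E : Type} [Group G] [Group H] [Group E] {π : E →* G × H}
    (hc : π.ker ≤ center E) (hπ : Function.Surjective π) (hG : commutator G = ⊤) {x y : E}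
    (hx : (π x).2 = 1) (hy : (π y).1 = 1) : Commute x y := by
  have hk : ∀ x : E, (π x).2 = 1 → ⁅x, y⁆ ∈ π.ker := fun x hx => by
    rw [MonoidHom.mem_ker, map_commutatorElement, commutatorElement_eq_one_iff_mul_comm]
    exact Prod.ext (by simp [hy]) (by simp [hx])
  let K : Subgroup E := ((MonoidHom.snd G H).comp π).ker
  have hmul : ∀ a b : E, a ∈ K → b ∈ K → ⁅a * b, y⁆ = ⁅a, y⁆ * ⁅b, y⁆ := fun a b ha hb => by
    have := mem_center_iff.1 (hc (hk b hb)) a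
    have e : ⁅a * b, y⁆ = a * ⁅b, y⁆ * a⁻¹ * ⁅a, y⁆ := by simp only [commutatorElement_def]; group
    rw [e, this, mul_inv_cancel_right, mem_center_iff.1 (hc (hk a ha)) _]
  let φ : K →* π.ker.map (MonoidHom.id E) :=
    { toFun := fun a => ⟨⁅(a : E), y⁆, ⟨_, hk a a.2, rfl⟩⟩
      map_one' := Subtype.ext (by simp)
      map_mul' := fun a b => Subtype.ext (hmul a b a.2 b.2) }
  have hcomm : ∀ a b : π.ker.map (MonoidHom.id E), a * b = b * a := by
    rintro ⟨a, a', ha, rfl⟩ ⟨b, b', hb, rfl⟩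
    exact Subtype.ext (mem_center_iff.1 (hc hb) a')
  have hφ : commutator K ≤ φ.ker := by
    rw [_root_.commutator_def, commutator_le]
    intro a _ b _
    rw [MonoidHom.mem_ker, map_commutatorElement, commutatorElement_eq_one_iff_mul_comm]
    exact hcomm _ _
  let p : K →* G := (MonoidHom.fst G H).comp (π.comp K.subtype)
  have hp : Function.Surjective p := fun g => by
    obtain ⟨z, hz⟩ := hπ (g, 1)
    exact ⟨⟨z, by simp [K, MonoidHom.mem_ker, hz]⟩, by simp [p, hz]⟩
  have h1 : p ⟨x, hx⟩ ∈ (commutator K).map p := by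
    have : (commutator K).map p = ⊤ := by
      rw [_root_.commutator_def, map_commutator, ← MonoidHom.range_eq_map, MonoidHom.range_eq_top.2 hp,
        ← _root_.commutator_def, hG]
    rw [this]; trivial
  obtain ⟨⟨c, hcK⟩, hc', e⟩ := h1
  have h2 : ⁅c, y⁆ = 1 := congrArg Subtype.val (hφ hc')
  have h3 : c⁻¹ * x ∈ center E := by
    refine hc ?_
    rw [MonoidHom.mem_ker, map_mul π, map_inv π, inv_mul_eq_one]
    exact Prod.ext e (by rw [hx]; exact hcK)
  have h4 : Commute c y := commutatorElement_eq_one_iff_mul_comm.1 h2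
  have h5 : x = c * (c⁻¹ * x) := by group
  rw [h5]
  exact h4.mul_left (mem_center_iff.1 h3 y).symm

theorem CentBound.exists_lift {G G' E : Type} [Group G] [Group G'] [Group E] {n : ℕ}
    (hG : CentBound G n) {π : E →* G'} (hc : π.ker ≤ center E) (hπ : Function.Surjective π)
    {i : G →* G'} (p : G' →* G) (hp : ∀ g, p (i g) = g) :
    ∃ N : Subgroup E, N.map π = i.range ∧ ∃ e : E, e ^ n = 1 ∧ N ⊓ π.ker ≤ zpowers e := by
  let K : Subgroup E := i.range.comap π
  let ρ : K →* G := p.comp (π.comp K.subtype)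
  have hK : ∀ k : K, π k = i (ρ k) := by
    rintro ⟨k, g, hg⟩
    change π k = i (p (π k))
    rw [← hg, hp]
  have h1 : Function.Surjective ρ := fun g => by
    obtain ⟨z, hz⟩ := hπ (i g)
    exact ⟨⟨z, g, hz.symm⟩, by simp [ρ, hz, hp]⟩
  have hker : ∀ k ∈ ρ.ker, (k : E) ∈ π.ker := fun k hk => by
    rw [MonoidHom.mem_ker, hK, MonoidHom.mem_ker.1 hk, map_one]
  have h2 : ρ.ker ≤ center K := fun k hk => mem_center_iff.2 fun z => Subtype.ext
    (mem_center_iff.1 (hc (hker k hk)) z)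
  obtain ⟨N, hN, e, he, hNe⟩ := hG K ρ h1 h2
  refine ⟨N.map K.subtype, ?_, e, by exact_mod_cast congrArg Subtype.val he, ?_⟩
  · ext g
    constructor
    · rintro ⟨_, ⟨k, hk, rfl⟩, rfl⟩
      exact ⟨ρ k, (hK k).symm⟩
    · rintro ⟨g, rfl⟩
      obtain ⟨k, hk, e⟩ : g ∈ N.map ρ := by rw [hN]; trivial
      exact ⟨k, ⟨k, hk, rfl⟩, by rw [hK, e]⟩
  · rintro _ ⟨⟨k, hk, rfl⟩, hk'⟩
    obtain ⟨j, hj⟩ := hNe ⟨hk, by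
      change p (π k) = 1
      rw [show π k = 1 from hk', map_one]⟩
    exact ⟨j, congrArg Subtype.val hj⟩

theorem CentBound.prod {G H : Type} [Group G] [Group H] {n : ℕ} (hG : CentBound G n)
    (hH : CentBound H 1) (hperf : commutator G = ⊤) : CentBound (G × H) n := by
  intro E _ π hπ hc
  obtain ⟨N₁, h1, e, he, hN⟩ := hG.exists_lift hc hπ (i := MonoidHom.inl G H) (MonoidHom.fst G H)
    fun g => rfl
  obtain ⟨N₂, h2, e', he', hN'⟩ := hH.exists_lift hc hπ (i := MonoidHom.inr G H) (MonoidHom.snd G H)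
    fun g => rfl
  rw [pow_one] at he'
  subst he'
  rw [zpowers_one_eq_bot, le_bot_iff] at hN'
  have p1 : ∀ x ∈ N₁, (π x).2 = 1 := fun x hx => by
    obtain ⟨g, hg⟩ : π x ∈ (MonoidHom.inl G H).range := h1 ▸ mem_map_of_mem π hx
    rw [← hg]; rfl
  have p2 : ∀ x ∈ N₂, (π x).1 = 1 := fun x hx => by
    obtain ⟨g, hg⟩ : π x ∈ (MonoidHom.inr G H).range := h2 ▸ mem_map_of_mem π hx
    rw [← hg]; rfl
  refine ⟨N₁ ⊔ N₂, ?_, e, he, ?_⟩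
  · rw [Subgroup.map_sup, h1, h2, eq_top_iff]
    rintro ⟨g, h⟩ -
    have : (g, h) = MonoidHom.inl G H g * MonoidHom.inr G H h := by simp
    rw [this]
    exact mul_mem (mem_sup_left ⟨g, rfl⟩) (mem_sup_right ⟨h, rfl⟩)
  · have hnorm : N₂ ≤ normalizer (N₁ : Set E) := by
      refine le_normalizer_iff.2 fun y hy x hx => ?_
      rw [← (commute_of_perfect hc hπ hperf (p1 x hx) (p2 y hy)).eq, mul_inv_cancel_right]
      exact hx
    rintro z ⟨hz, hz'⟩
    replace hz : z ∈ ((N₁ ⊔ N₂ : Subgroup E) : Set E) := hz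
    rw [coe_mul_of_right_le_normalizer_left _ _ hnorm] at hz
    obtain ⟨x, hx, y, hy, rfl⟩ := hz
    have hxy : π x * π y = 1 := by rw [← map_mul π]; exact hz'
    have x1 : π x = 1 := Prod.ext (by simpa [p2 y hy] using congrArg Prod.fst hxy) (p1 x hx)
    have y1 : π y = 1 := by rwa [x1, one_mul] at hxy
    have : y ∈ N₂ ⊓ π.ker := ⟨hy, y1⟩
    rw [hN', mem_bot] at this
    change x * y ∈ _
    rw [this, mul_one]
    exact hN ⟨hx, x1⟩

theorem CentBound.of_mulEquiv {G H : Type} [Group G] [Group H] {n : ℕ} (hG : CentBound G n)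
    (f : G ≃* H) : CentBound H n := by
  intro E _ π hπ hc
  have hk : (f.symm.toMonoidHom.comp π).ker = π.ker := by ext; simp [MonoidHom.mem_ker]
  obtain ⟨N, hN, e, he, h⟩ := hG E (f.symm.toMonoidHom.comp π) (f.symm.surjective.comp hπ)
    (hk.trans_le hc)
  refine ⟨N, ?_, e, he, by rwa [hk] at h⟩
  rw [eq_top_iff]
  intro x _
  obtain ⟨y, hy, e⟩ : f.symm x ∈ N.map (f.symm.toMonoidHom.comp π) := by rw [hN]; trivial
  exact ⟨y, hy, f.symm.injective e⟩

theorem commutator_eq_top_of_mulEquiv {G H : Type} [Group G] [Group H]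
    (hG : commutator G = ⊤) (f : G ≃* H) : commutator H = ⊤ := by
  have := congrArg (Subgroup.map f.toMonoidHom) hG
  rwa [_root_.commutator_def, map_commutator, ← MonoidHom.range_eq_map,
    MonoidHom.range_eq_top.2 f.surjective, ← _root_.commutator_def] at this

theorem commutator_prod_eq_top {G H : Type} [Group G] [Group H]
    (hG : commutator G = ⊤) (hH : commutator H = ⊤) : commutator (G × H) = ⊤ := by
  rw [_root_.commutator_def, ← top_prod_top, commutator_prod_prod, ← _root_.commutator_def, ← _root_.commutator_def, hG,
    hH]

/-- The symplectic group over a product of rings. -/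
theorem nonempty_symplectic_prod {g : ℕ} {R S S' : Type} [CommRing R] [CommRing S] [CommRing S']
    (e : R ≃+* S × S') : Nonempty (Sp g R ≃* Sp g S × Sp g S') := by
  let f₁ : R →+* S := (RingHom.fst S S').comp e
  let f₂ : R →+* S' := (RingHom.snd S S').comp e
  let F : Sp g R →* Sp g S × Sp g S' := (SpAux.SpMap f₁ g).prod (SpAux.SpMap f₂ g)
  have ext : ∀ A B : Matrix (Fin g ⊕ Fin g) (Fin g ⊕ Fin g) R, A.map f₁ = B.map f₁ →
      A.map f₂ = B.map f₂ → A = B := fun A B h1 h2 => by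
    ext i j
    exact e.injective (Prod.ext (congrFun (congrFun h1 i) j) (congrFun (congrFun h2 i) j))
  refine ⟨MulEquiv.ofBijective F ⟨fun A B h => ?_, ?_⟩⟩
  · exact Subtype.ext (ext _ _ (congrArg (fun x => x.1.1) h) (congrArg (fun x => x.2.1) h))
  · rintro ⟨A, B⟩
    let M : Matrix (Fin g ⊕ Fin g) (Fin g ⊕ Fin g) R := fun i j => e.symm (A.1 i j, B.1 i j)
    have m1 : M.map f₁ = A.1 := by
      ext i j
      change (e (e.symm (A.1 i j, B.1 i j))).1 = _
      rw [e.apply_symm_apply]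
    have m2 : M.map f₂ = B.1 := by
      ext i j
      change (e (e.symm (A.1 i j, B.1 i j))).2 = _
      rw [e.apply_symm_apply]
    have hM : M ∈ Sp g R := by
      rw [SymplecticGroup.mem_iff]
      refine ext _ _ ?_ ?_
      · rw [Matrix.map_mul, Matrix.map_mul, Matrix.transpose_map, SpAux.J_map, m1]
        exact SymplecticGroup.mem_iff.1 A.2
      · rw [Matrix.map_mul, Matrix.map_mul, Matrix.transpose_map, SpAux.J_map, m2]
        exact SymplecticGroup.mem_iff.1 B.2
    exact ⟨⟨M, hM⟩, Prod.ext (Subtype.ext m1) (Subtype.ext m2)⟩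

theorem centBound_zmod {g : ℕ} (hg : 4 ≤ g) {D : ℕ} (hD : 1 ≤ D) :
    CentBound (Sp g (ZMod D)) (if 4 ∣ D then 2 else 1) ∧ commutator (Sp g (ZMod D)) = ⊤ := by
  induction D using Nat.recOnPosPrimePosCoprime with
  | prime_pow p k hp hk =>
    obtain ⟨k, rfl⟩ := Nat.exists_eq_succ_of_ne_zero hk.ne'
    refine ⟨centBound_prime_pow hg hp, ?_⟩
    have := isLocalRing_zmod (k := k) hp
    have : NeZero (p ^ (k + 1)) := ⟨pow_ne_zero _ hp.ne_zero⟩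
    exact commutator_symplectic_eq_top (m := (⟨0, by omega⟩ : Fin g)) (a := ⟨1, by omega⟩)
      (b := ⟨2, by omega⟩) (by simp) (by simp) (by simp) fun t => ⟨t.val, ZMod.natCast_zmod_val t⟩
  | zero => omega
  | one =>
    have : Subsingleton (Sp g (ZMod 1)) := ⟨fun A B => Subtype.ext (Matrix.ext fun i j =>
      Subsingleton.elim (α := ZMod 1) _ _)⟩
    refine ⟨fun E _ π _ _ => ⟨⊥, ?_, 1, one_pow _, by simp⟩, ?_⟩
    · exact Subsingleton.elim _ _
    · exact Subsingleton.elim _ _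
  | coprime a b ha hb hab iha ihb =>
    obtain ⟨a1, a2⟩ := iha ha.le
    obtain ⟨b1, b2⟩ := ihb hb.le
    obtain ⟨f⟩ := nonempty_symplectic_prod (g := g) (ZMod.chineseRemainder hab)
    refine ⟨?_, commutator_eq_top_of_mulEquiv (commutator_prod_eq_top a2 b2) f.symm⟩
    by_cases h4 : 4 ∣ b
    · have h2 : ¬ 2 ∣ a := fun h => by
        have := Nat.dvd_gcd h ((by norm_num : 2 ∣ 4).trans h4)
        rw [hab] at this; omega
      have h3 : ¬ 4 ∣ a := fun h => h2 ((by norm_num : 2 ∣ 4).trans h)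
      rw [if_neg h3] at a1
      rw [if_pos h4] at b1
      rw [if_pos (h4.mul_left a)]
      exact (b1.prod a1 b2).of_mulEquiv (MulEquiv.prodComm.trans f.symm)
    · rw [if_neg h4] at b1
      have e : 4 ∣ a * b ↔ 4 ∣ a := by
        refine ⟨fun h => ?_, fun h => h.mul_right b⟩
        by_cases h2 : 2 ∣ b
        · have h2' : ¬ 2 ∣ a := fun h => by
            have := Nat.dvd_gcd h h2
            rw [hab] at this; omega
          have hc : Nat.Coprime 4 a := by
            have := (Nat.prime_two.coprime_iff_not_dvd.2 h2').pow_left 2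
            simpa using this
          exact absurd (hc.dvd_of_dvd_mul_left h) h4
        · have hc : Nat.Coprime 4 b := by
            have := (Nat.prime_two.coprime_iff_not_dvd.2 h2).pow_left 2
            simpa using this
          exact hc.dvd_of_dvd_mul_right h
      simp only [e]
      exact (a1.prod b1 a2).of_mulEquiv f.symm

end Products

section BarResolution

open Subgroup GpH2

variable {G : Type} [Group G] {A : Type} [AddCommGroup A]

/-- A 2-cocycle on `G` with values in the trivial module `A`. -/
structure Cocycle (G A : Type) [Group G] [AddCommGroup A] where
  /-- the underlying function -/
  r : G → G → A
  cocycle : ∀ g h k, r g h + r (g * h) k = r h k + r g (h * k)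

/-- The central extension of `G` by `A` defined by a cocycle. -/
@[ext]
structure Cocycle.Ext (c : Cocycle G A) where
  /-- the component in `A` -/
  a : A
  /-- the component in `G` -/
  g : G

theorem Cocycle.r_one_left (c : Cocycle G A) (g : G) : c.r 1 g = c.r 1 1 := by
  simpa using (c.cocycle 1 1 g).symm

theorem Cocycle.r_one_right (c : Cocycle G A) (g : G) : c.r g 1 = c.r 1 1 := by
  simpa using c.cocycle g 1 1

instance (c : Cocycle G A) : Group c.Ext :=
  let _ : Mul c.Ext := ⟨fun x y => ⟨x.a + y.a + c.r x.g y.g, x.g * y.g⟩⟩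
  let _ : One c.Ext := ⟨⟨-c.r 1 1, 1⟩⟩
  let _ : Inv c.Ext := ⟨fun x => ⟨-x.a - c.r x.g⁻¹ x.g - c.r 1 1, x.g⁻¹⟩⟩
  Group.ofLeftAxioms
    (fun x y z => by
      refine Cocycle.Ext.ext ?_ (mul_assoc _ _ _)
      change x.a + y.a + c.r x.g y.g + z.a + c.r (x.g * y.g) z.g
        = x.a + (y.a + z.a + c.r y.g z.g) + c.r x.g (y.g * z.g)
      rw [add_right_comm _ _ z.a, add_assoc _ (c.r _ _), c.cocycle]
      abel)
    (fun x => by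
      refine Cocycle.Ext.ext ?_ (one_mul _)
      change -c.r 1 1 + x.a + c.r 1 x.g = x.a
      rw [c.r_one_left x.g]; abel)
    (fun x => by
      refine Cocycle.Ext.ext ?_ (inv_mul_cancel _)
      change -x.a - c.r x.g⁻¹ x.g - c.r 1 1 + x.a + c.r x.g⁻¹ x.g = -c.r 1 1
      abel)

theorem Cocycle.Ext.mul_a {c : Cocycle G A} (x y : c.Ext) : (x * y).a = x.a + y.a + c.r x.g y.g :=
  rfl

theorem Cocycle.Ext.mul_g {c : Cocycle G A} (x y : c.Ext) : (x * y).g = x.g * y.g :=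
  rfl

theorem Cocycle.Ext.one_a {c : Cocycle G A} : (1 : c.Ext).a = -c.r 1 1 :=
  rfl

/-- The projection of the extension onto `G`. -/
def Cocycle.proj (c : Cocycle G A) : c.Ext →* G where
  toFun x := x.g
  map_one' := rfl
  map_mul' _ _ := rfl

theorem Cocycle.ker_proj_le_center (c : Cocycle G A) : c.proj.ker ≤ center c.Ext := by
  intro x hx
  have hx : x.g = 1 := hx
  refine mem_center_iff.2 fun y => ?_
  refine Cocycle.Ext.ext ?_ ?_
  · rw [Cocycle.Ext.mul_a, Cocycle.Ext.mul_a, hx, c.r_one_left, c.r_one_right]; abel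
  · rw [Cocycle.Ext.mul_g, Cocycle.Ext.mul_g, hx, one_mul, mul_one]

theorem d2_single (g h : G) : d2 G (Finsupp.single (g, h) 1) =
    Finsupp.single h 1 - Finsupp.single (g * h) 1 + Finsupp.single g 1 := by
  simp [d2]

theorem d3_single (g h k : G) : d3 G (Finsupp.single (g, h, k) 1) =
    Finsupp.single (h, k) 1 - Finsupp.single (g * h, k) 1 + Finsupp.single (g, h * k) 1
      - Finsupp.single (g, h) 1 := by
  simp [d3]

theorem exists_extend_H2 [Finite G] :
    ∃ ρ : ((G × G) →₀ ℤ) →ₗ[ℤ] H2 G, ∀ z : Z2 G, ρ z = Submodule.Quotient.mk z := by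
  obtain ⟨s, hs⟩ := Module.projective_lifting_property (d2 G).rangeRestrict LinearMap.id
    (d2 G).surjective_rangeRestrict
  have h : ∀ x, x - s ((d2 G).rangeRestrict x) ∈ Z2 G := fun x => by
    have := congrArg Subtype.val (LinearMap.congr_fun hs ((d2 G).rangeRestrict x))
    change (d2 G) _ = (d2 G) x at this
    rw [Z2, LinearMap.mem_ker, map_sub, this, sub_self]
  refine ⟨(Submodule.mkQ _).comp ((LinearMap.id - s.comp (d2 G).rangeRestrict).codRestrict _ h),
    fun z => ?_⟩
  have hz : (d2 G).rangeRestrict z = 0 := Subtype.ext z.2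
  refine congrArg (Submodule.Quotient.mk (p := (B2 G).comap (Z2 G).subtype)) (Subtype.ext ?_)
  change (z : (G × G) →₀ ℤ) - s ((d2 G).rangeRestrict z) = z
  rw [hz, map_zero, sub_zero]

/-- The second homology is controlled by central extensions. -/
theorem CentBound.card_H2_dvd [Finite G] {n : ℕ} (hG : CentBound G n) : Nat.card (H2 G) ∣ n := by
  obtain ⟨ρ, hρ⟩ := exists_extend_H2 (G := G)
  let c : Cocycle G (H2 G) :=
    { r := fun g h => ρ (Finsupp.single (g, h) 1)
      cocycle := fun g h k => by
        have hz : d3 G (Finsupp.single (g, h, k) 1) ∈ Z2 G := by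
          rw [Z2, LinearMap.mem_ker, d3_single]
          simp only [map_sub, map_add, d2_single, mul_assoc]
          abel
        have h1 : ρ (d3 G (Finsupp.single (g, h, k) 1)) = 0 := by
          refine (hρ ⟨_, hz⟩).trans ((Submodule.Quotient.mk_eq_zero _).2 ?_)
          exact ⟨_, rfl⟩
        rw [d3_single] at h1
        simp only [map_sub, map_add] at h1
        have h2 := sub_eq_zero.1 h1
        rw [← h2]; abel }
  have hsurj : Function.Surjective c.proj := fun g => ⟨⟨0, g⟩, rfl⟩
  obtain ⟨N, hN, e, he, hNe⟩ := hG c.Ext c.proj hsurj c.ker_proj_le_center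
  let K : AddSubgroup (H2 G) :=
    { carrier := {a | (⟨a - c.r 1 1, 1⟩ : c.Ext) ∈ N}
      zero_mem' := by
        have : (⟨0 - c.r 1 1, 1⟩ : c.Ext) = 1 := Cocycle.Ext.ext (by rw [zero_sub]; rfl) rfl
        change _ ∈ N
        rw [this]; exact N.one_mem
      add_mem' := fun {a b} ha hb => by
        have : (⟨a + b - c.r 1 1, 1⟩ : c.Ext) = ⟨a - c.r 1 1, 1⟩ * ⟨b - c.r 1 1, 1⟩ :=
          Cocycle.Ext.ext (by
            change a + b - c.r 1 1 = a - c.r 1 1 + (b - c.r 1 1) + c.r 1 1; abel)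
            (by rw [Cocycle.Ext.mul_g, one_mul])
        change _ ∈ N
        rw [this]; exact N.mul_mem ha hb
      neg_mem' := fun {a} ha => by
        have : (⟨-a - c.r 1 1, 1⟩ : c.Ext) = (⟨a - c.r 1 1, 1⟩ : c.Ext)⁻¹ := by
          rw [eq_inv_iff_mul_eq_one]
          exact Cocycle.Ext.ext (by
              change -a - c.r 1 1 + (a - c.r 1 1) + c.r 1 1 = -c.r 1 1; abel)
            (by rw [Cocycle.Ext.mul_g, one_mul]; rfl)
        change _ ∈ N
        rw [this]; exact N.inv_mem ha }
  have hφ : ∀ g : G, ∃ a : H2 G, (⟨a, g⟩ : c.Ext) ∈ N := fun g => by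
    obtain ⟨⟨a, _⟩, hx, rfl⟩ : g ∈ N.map c.proj := by rw [hN]; trivial
    exact ⟨a, hx⟩
  choose φ hφ using hφ
  let Φ : (G →₀ ℤ) →ₗ[ℤ] H2 G := Finsupp.linearCombination ℤ φ
  have hΦ : ∀ g, Φ (Finsupp.single g 1) = φ g := fun g => by simp [Φ]
  have h1 : (AddSubgroup.toIntSubmodule K).mkQ.comp (ρ + Φ.comp (d2 G)) = 0 := by
    refine Finsupp.lhom_ext' fun ⟨g, h⟩ => LinearMap.ext_ring ?_
    simp only [LinearMap.comp_apply, Finsupp.lsingle_apply, LinearMap.zero_apply]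
    refine (Submodule.Quotient.mk_eq_zero _).2 ?_
    change (⟨ρ (Finsupp.single (g, h) 1) + Φ (d2 G (Finsupp.single (g, h) 1)) - c.r 1 1, 1⟩ : c.Ext)
      ∈ N
    have h3 : (⟨ρ (Finsupp.single (g, h) 1) + Φ (d2 G (Finsupp.single (g, h) 1)) - c.r 1 1, 1⟩ :
        c.Ext) = ⟨φ g, g⟩ * ⟨φ h, h⟩ * (⟨φ (g * h), g * h⟩ : c.Ext)⁻¹ := by
      rw [eq_mul_inv_iff_mul_eq]
      refine Cocycle.Ext.ext ?_ ?_
      · rw [Cocycle.Ext.mul_a, Cocycle.Ext.mul_a, d2_single, map_add, map_sub, hΦ, hΦ, hΦ]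
        change ρ (Finsupp.single (g, h) 1) + (φ h - φ (g * h) + φ g) - c.r 1 1 + φ (g * h)
          + c.r 1 (g * h) = φ g + φ h + ρ (Finsupp.single (g, h) 1)
        rw [c.r_one_left (g * h)]; abel
      · rw [Cocycle.Ext.mul_g, Cocycle.Ext.mul_g, one_mul]
    rw [h3]
    exact N.mul_mem (N.mul_mem (hφ g) (hφ h)) (N.inv_mem (hφ _))
  have hK : ∀ y : H2 G, y ∈ K := fun y => by
    obtain ⟨z, rfl⟩ := Submodule.Quotient.mk_surjective _ y
    have h2 := LinearMap.congr_fun h1 (z : (G × G) →₀ ℤ)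
    simp only [LinearMap.comp_apply, LinearMap.add_apply, LinearMap.zero_apply] at h2
    have h3 := (Submodule.Quotient.mk_eq_zero _).1 h2
    rw [show d2 G z = 0 from z.2, map_zero, add_zero, hρ] at h3
    exact h3
  let Ψ : H2 G →+ Additive c.Ext :=
    { toFun := fun a => Additive.ofMul ⟨a - c.r 1 1, 1⟩
      map_zero' := by
        refine congrArg Additive.ofMul (Cocycle.Ext.ext ?_ rfl)
        rw [zero_sub]; rfl
      map_add' := fun a b => by
        refine congrArg Additive.ofMul (Cocycle.Ext.ext ?_ ?_)
        · change a + b - c.r 1 1 = (a - c.r 1 1) + (b - c.r 1 1) + c.r 1 1; abel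
        · exact (one_mul _).symm }
  have hinj : Function.Injective Ψ := fun a b h => by
    have : a - c.r 1 1 = b - c.r 1 1 := congrArg (fun x => (Additive.toMul x).a) h
    exact sub_left_injective this
  have hall : ∀ y : H2 G, (Ψ y).toMul ∈ zpowers e := fun y => hNe ⟨hK y, rfl⟩
  have h2 : Function.Injective fun y => (⟨(Ψ y).toMul, hall y⟩ : zpowers e) :=
    fun a b h => hinj (congrArg (fun x => Additive.ofMul x.1) h)
  let Ψ' : Multiplicative (H2 G) →* zpowers e :=
    { toFun := fun y => ⟨(Ψ y.toAdd).toMul, hall _⟩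
      map_one' := Subtype.ext (congrArg Additive.toMul (map_zero Ψ))
      map_mul' := fun a b => Subtype.ext (congrArg Additive.toMul (map_add Ψ a.toAdd b.toAdd)) }
  refine (card_dvd_of_injective Ψ' h2).trans ?_
  rw [Nat.card_zpowers]
  exact orderOf_dvd_of_pow_eq_one he

end BarResolution

section Splitting

open Subgroup GpH2

variable {G : Type} [Group G]

theorem range_d2_eq_top (hG : commutator G = ⊤) : LinearMap.range (d2 G) = ⊤ := by
  let q := (LinearMap.range (d2 G)).mkQ
  have hq : ∀ g h : G, q (Finsupp.single (g * h) 1) =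
      q (Finsupp.single g 1) + q (Finsupp.single h 1) := fun g h => by
    have : q (d2 G (Finsupp.single (g, h) 1)) = 0 :=
      (Submodule.Quotient.mk_eq_zero _).2 ⟨_, rfl⟩
    rw [d2_single, map_add, map_sub] at this
    rw [← sub_eq_zero, ← neg_eq_zero, ← this]; abel
  let φ : G →* Multiplicative ((G →₀ ℤ) ⧸ LinearMap.range (d2 G)) := MonoidHom.mk'
    (fun g => Multiplicative.ofAdd (q (Finsupp.single g 1))) fun g h =>
      congrArg Multiplicative.ofAdd (hq g h)
  have hφ : ∀ g, φ g = 1 := fun g => by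
    have h : commutator G ≤ φ.ker := Abelianization.commutator_subset_ker φ
    exact h (hG ▸ mem_top g)
  rw [← Submodule.ker_mkQ (LinearMap.range (d2 G)), LinearMap.ker_eq_top]
  exact Finsupp.lhom_ext' fun g => LinearMap.ext_ring (congrArg Multiplicative.toAdd (hφ g))

/-- A central extension of a perfect group with trivial second homology splits. -/
theorem exists_section (hG : commutator G = ⊤) (hH : ∀ x : H2 G, x = 0) {E : Type} [Group E]
    {π : E →* G} (hπ : Function.Surjective π) (hc : π.ker ≤ center E) :
    ∃ s : G →* E, ∀ g, π (s g) = g := by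
  choose σ hσ using hπ
  let _ : CommGroup π.ker :=
    { (inferInstance : Group π.ker) with
      mul_comm := fun a b => Subtype.ext (mem_center_iff.1 (hc b.2) a) }
  have hcomm : ∀ (a : π.ker) (x : E), x * a = a * x := fun a x => mem_center_iff.1 (hc a.2) x
  let f : G → G → π.ker := fun g h => ⟨σ g * σ h * (σ (g * h))⁻¹, by
    rw [MonoidHom.mem_ker, map_mul π, map_mul π, map_inv π, hσ, hσ, hσ, mul_inv_cancel]⟩
  have hf : ∀ g h, σ g * σ h = f g h * σ (g * h) := fun g h => by simp [f]
  have hcoc : ∀ g h k, f g h * f (g * h) k = f h k * f g (h * k) := fun g h k => by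
    refine Subtype.ext ?_
    have h1 : (f g h * f (g * h) k : E) * σ (g * h * k) = f h k * f g (h * k) * σ (g * h * k) := by
      rw [mul_assoc, ← hf, ← mul_assoc, ← hf, mul_assoc (f h k : E), mul_assoc g, ← hf,
        ← mul_assoc, ← hcomm, mul_assoc (σ g) _ (σ (h * k)), ← hf, mul_assoc]
    exact mul_right_cancel h1
  let F : ((G × G) →₀ ℤ) →ₗ[ℤ] Additive π.ker :=
    Finsupp.linearCombination ℤ fun p => Additive.ofMul (f p.1 p.2)
  have hF : ∀ g h, F (Finsupp.single (g, h) 1) = Additive.ofMul (f g h) := fun g h => by simp [F]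
  have hF3 : F.comp (d3 G) = 0 := by
    refine Finsupp.lhom_ext' fun ⟨g, h, k⟩ => LinearMap.ext_ring ?_
    change F (d3 G (Finsupp.single (g, h, k) 1)) = 0
    rw [d3_single]
    simp only [map_add, map_sub, hF, ← ofMul_mul, ← ofMul_div]
    rw [← ofMul_one, Additive.ofMul.injective.eq_iff, div_eq_one, div_mul_eq_mul_div, div_eq_iff_eq_mul,
      ← hcoc]
  have hker : LinearMap.ker (d2 G) ≤ LinearMap.ker F := fun z hz => by
    obtain ⟨w, hw⟩ := (Submodule.Quotient.mk_eq_zero _).1 (hH (Submodule.Quotient.mk ⟨z, hz⟩))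
    have := LinearMap.congr_fun hF3 w
    rw [LinearMap.comp_apply, hw] at this
    exact this
  have hcb : ∀ x : G →₀ ℤ, ∃ y, d2 G y = x := LinearMap.range_eq_top.1 (range_d2_eq_top hG)
  choose y hy using hcb
  let c : G → π.ker := fun g => (F (y (Finsupp.single g 1))).toMul
  have hcf : ∀ g h, c h / c (g * h) * c g = f g h := fun g h => by
    have h1 : F (y (Finsupp.single h 1) - y (Finsupp.single (g * h) 1) + y (Finsupp.single g 1)
        - Finsupp.single (g, h) 1) = 0 := by
      refine hker ?_
      rw [LinearMap.mem_ker, map_sub, map_add, map_sub, hy, hy, hy, d2_single, sub_self]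
    rw [map_sub, map_add, map_sub, hF, sub_eq_zero] at h1
    exact congrArg Additive.toMul h1
  refine ⟨MonoidHom.mk' (fun g => (c g)⁻¹ * σ g) fun g h => ?_, fun g => ?_⟩
  · have h1 : (c (g * h))⁻¹ = (c g)⁻¹ * (c h)⁻¹ * f g h := by
      rw [← hcf, div_eq_mul_inv, mul_comm _ (c g), mul_comm (c g)⁻¹, mul_assoc,
        inv_mul_cancel_left, inv_mul_cancel_left]
    have h2 : ((c (g * h))⁻¹ : E) = (c g : E)⁻¹ * (c h : E)⁻¹ * f g h := congrArg Subtype.val h1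
    change (c (g * h) : E)⁻¹ * σ (g * h) = (c g : E)⁻¹ * σ g * ((c h : E)⁻¹ * σ h)
    rw [h2, mul_assoc _ (f g h : E), ← hf]
    have h3 : (c h : E)⁻¹ * σ g = σ g * (c h : E)⁻¹ := (hcomm (c h)⁻¹ (σ g)).symm
    rw [mul_assoc, ← mul_assoc _ (σ g), h3]
    simp only [mul_assoc]
  · change π ((c g : E)⁻¹ * σ g) = g
    rw [map_mul π, map_inv π, hσ, show π (c g : E) = 1 from (c g).2, inv_one, one_mul]

end Splitting

section Weil

variable {l : Type} [Fintype l] [DecidableEq l]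

/-- The additive character of `ℤ/4` with values in `𝔽₅`. -/
def ps (a : ZMod 4) : ZMod 5 := 2 ^ a.val

/-- The embedding of `ℤ/2` into `ℤ/4`. -/
def dbl (x : ZMod 2) : ZMod 4 := (2 * x.val : ℕ)

/-- The reduction of `ℤ/4` modulo `2`. -/
abbrev rd : ZMod 4 →+* ZMod 2 := ZMod.castHom (by norm_num) (ZMod 2)

theorem ps_add : ∀ a b : ZMod 4, ps (a + b) = ps a * ps b := by decide

theorem dbl_add : ∀ a b : ZMod 2, dbl (a + b) = dbl a + dbl b := by decide

theorem dbl_rd : ∀ a : ZMod 4, dbl (rd a) = 2 * a := by decide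

theorem ps_zero : ps 0 = 1 := by decide

/-- The space of the Schrödinger representation. -/
abbrev Fun (l : Type) := (l → ZMod 2) → ZMod 5

/-- The Schrödinger representation of the Heisenberg group. -/
def W (u : l ⊕ l → ZMod 4) : Module.End (ZMod 5) (Fun l) where
  toFun f x := ps (∑ i, u (.inr i) * (u (.inl i) + dbl (x i))) * f (fun i => x i + rd (u (.inl i)))
  map_add' f g := by ext x; simp [mul_add]
  map_smul' c f := by ext x; simp [mul_left_comm]

theorem W_apply (u : l ⊕ l → ZMod 4) (f : Fun l) (x : l → ZMod 2) : W u f x =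
    ps (∑ i, u (.inr i) * (u (.inl i) + dbl (x i))) * f (fun i => x i + rd (u (.inl i))) := rfl

theorem W_mul (u v : l ⊕ l → ZMod 4) : W u * W v = ps (om u v) • W (u + v) := by
  refine LinearMap.ext fun f => funext fun x => ?_
  rw [Module.End.mul_apply, LinearMap.smul_apply, Pi.smul_apply, W_apply, W_apply, W_apply,
    smul_eq_mul, ← mul_assoc, ← mul_assoc, ← ps_add, ← ps_add]
  congr 2
  · rw [om, ← Finset.sum_add_distrib, ← Finset.sum_add_distrib]
    refine Finset.sum_congr rfl fun i _ => ?_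
    rw [dbl_add, dbl_rd, Pi.add_apply, Pi.add_apply]
    ring
  · funext i
    rw [Pi.add_apply, map_add, add_assoc]

theorem W_two_smul (u : l ⊕ l → ZMod 4) : W ((2 : ZMod 4) • u) = 1 := by
  refine LinearMap.ext fun f => funext fun x => ?_
  rw [W_apply]
  have h1 : ∀ a b : ZMod 4, ∀ y : ZMod 2, 2 * a * (2 * b + dbl y) = 0 := by decide
  have h2 : ∀ a : ZMod 4, rd (2 * a) = 0 := by decide
  simp only [Pi.smul_apply, smul_eq_mul, h1, h2, Finset.sum_const_zero, ps_zero, one_mul, add_zero]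
  rfl

theorem W_sq (u : l ⊕ l → ZMod 4) : W u * W u = 1 := by
  rw [W_mul, om_self, ps_zero, one_smul, ← two_smul (ZMod 4), W_two_smul]

theorem W_comm (u v : l ⊕ l → ZMod 4) : W u * W v = ps (2 * om u v) • (W v * W u) := by
  rw [W_mul, W_mul, smul_smul, ← ps_add, add_comm u, om_swap u v]
  congr 2
  ring

/-- The lift of the transvection along `v` to the Weil representation. -/
def wU (v : l ⊕ l → ZMod 4) : Module.End (ZMod 5) (Fun l) := 1 + (3 : ZMod 5) • W v

theorem wU_sq (v : l ⊕ l → ZMod 4) : wU v * wU v = W v := by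
  have h5 : (10 : ZMod 5) = 0 := by decide
  have h1 : (6 : ZMod 5) = 1 := by decide
  have : wU v * wU v = (10 : ZMod 5) • 1 + (6 : ZMod 5) • W v := by
    simp only [wU, add_mul, mul_add, one_mul, mul_one, smul_mul_assoc, mul_smul_comm, W_sq]
    module
  rw [this, h5, h1, zero_smul, one_smul, zero_add]

theorem W_add_smul (u v : l ⊕ l → ZMod 4) (n : ℕ) :
    W (u + (n : ZMod 4) • v) = ps (n * om v u) • (W u * W v ^ n) := by
  induction n with
  | zero => simp [ps_zero]
  | succ n ih =>
    rw [pow_succ, ← mul_assoc]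
    have h : u + ((n + 1 : ℕ) : ZMod 4) • v = u + (n : ZMod 4) • v + v := by
      push_cast; rw [add_smul, one_smul, add_assoc]
    have h2 : W (u + (n : ZMod 4) • v + v) =
        ps (om v u) • (W (u + (n : ZMod 4) • v) * W v) := by
      rw [W_mul, smul_smul, ← ps_add, om_add_left, om_smul_left, om_self, mul_zero, add_zero,
        om_swap v u, add_neg_cancel, ps_zero, one_smul]
    rw [h, h2, ih, smul_mul_assoc, smul_smul, ← ps_add]
    congr 2
    push_cast; ring

theorem wU_mul_W (v u : l ⊕ l → ZMod 4) : wU v * W u = W (ac (T v 1) u) * wU v := by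
  have even : W v * W u = W u * W v → W (ac (T v 1) u) = W u →
      wU v * W u = W (ac (T v 1) u) * wU v := fun h1 h2 => by
    rw [h2, wU, add_mul, mul_add, one_mul, mul_one, smul_mul_assoc, mul_smul_comm, h1]
  have odd : W v * W u = (4 : ZMod 5) • (W u * W v) →
      W (ac (T v 1) u) = (2 : ZMod 5) • (W u * W v) →
      wU v * W u = W (ac (T v 1) u) * wU v := fun h1 h2 => by
    rw [h2, wU, add_mul, mul_add, one_mul, mul_one, smul_mul_assoc, mul_smul_comm, h1,
      smul_mul_assoc, mul_assoc, W_sq, mul_one, smul_smul, smul_smul, add_comm]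
    congr 1
    exact (one_smul _ _).symm
  have key : ∀ n : ℕ, n < 4 → om v u = n → wU v * W u = W (ac (T v 1) u) * wU v := fun n hn h => by
    have h1 := W_comm v u
    have h2 : W (ac (T v 1) u) = ps (n * om v u) • (W u * W v ^ n) := by
      rw [ac_T, one_mul, h, W_add_smul, h]
    rw [h] at h1 h2
    interval_cases n
    · exact even (h1.trans (one_smul _ _)) (h2.trans (by rw [pow_zero, mul_one]; exact one_smul _ _))
    · exact odd h1 (by rwa [pow_one] at h2)
    · exact even (h1.trans (one_smul _ _))
        (h2.trans (by rw [pow_two, W_sq, mul_one]; exact one_smul _ _))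
    · exact odd h1 (by rw [pow_succ, pow_two, W_sq, one_mul] at h2; exact h2)
  exact key (om v u).val (ZMod.val_lt _) (ZMod.natCast_zmod_val _).symm

/-- Operators commuting with the Schrödinger representation are scalar. -/
theorem exists_eq_smul_of_commute {X : Module.End (ZMod 5) (Fun l)}
    (hX : ∀ u, X * W u = W u * X) : ∃ c : ZMod 5, X = c • 1 := by
  have hW : ∀ u f, X (W u f) = W u (X f) := fun u f => LinearMap.congr_fun (hX u) f
  let δ : (l → ZMod 2) → Fun l := fun y => Pi.single y 1
  have h0 : ∀ x, x ≠ 0 → X (δ 0) x = 0 := fun x hx => by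
    obtain ⟨i, hi⟩ : ∃ i, x i ≠ 0 := by
      by_contra h; push Not at h; exact hx (funext h)
    have hi : x i = 1 := by
      revert hi; generalize x i = y; revert y; decide
    have hs : ∀ y : l → ZMod 2, (∑ j, vf (ZMod 4) i (.inr j) * (vf (ZMod 4) i (.inl j) + dbl (y j)))
        = dbl (y i) := fun y => by simp
    have hy : ∀ (f : Fun l) (y : l → ZMod 2), W (vf (ZMod 4) i) f y = ps (dbl (y i)) * f y := fun f y => by
      rw [W_apply, hs]; simp
    have h1 : W (vf (ZMod 4) i) (δ 0) = δ 0 := funext fun y => by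
      rw [hy]
      by_cases h : y = 0
      · subst h
        rw [Pi.zero_apply, show ps (dbl 0) = 1 by decide, one_mul]
      · simp [δ, h]
    have h2 := hW (vf (ZMod 4) i) (δ 0)
    rw [h1] at h2
    have h3 := congrFun h2 x
    rw [hy, hi, show ps (dbl 1) = 4 by decide] at h3
    revert h3; generalize X (δ 0) x = y; revert y; decide
  refine ⟨X (δ 0) 0, ?_⟩
  refine LinearMap.pi_ext' fun y => LinearMap.ext_ring ?_
  let u : l ⊕ l → ZMod 4 := Sum.elim (fun i => (y i).val) 0
  have hu : ∀ f x, W u f x = f (x + y) := fun f x => by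
    rw [W_apply]
    have : ∀ a : ZMod 2, rd (a.val : ZMod 4) = a := by decide
    simp only [u, Sum.elim_inr, Pi.zero_apply, zero_mul, Finset.sum_const_zero, ps_zero, one_mul,
      Sum.elim_inl, this]
    rfl
  have hyy : ∀ x z : l → ZMod 2, x + z = 0 ↔ x = z := fun x z => by
    rw [funext_iff, funext_iff]
    refine forall_congr' fun i => ?_
    change x i + z i = 0 ↔ _
    generalize x i = a, z i = b
    revert a b; decide
  have h1 : W u (δ 0) = δ y := funext fun x => by
    rw [hu]
    simp only [δ, Pi.single_apply, hyy]
  change X (δ y) = X (δ 0) 0 • δ y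
  funext x
  rw [← h1, hW, hu, Pi.smul_apply, hu, smul_eq_mul]
  by_cases h : x + y = 0
  · simp [h, δ]
  · rw [h0 _ h]; simp [δ, h]

end Weil

section LowerBound

open Subgroup GpH2

variable {l : Type} [Fintype l] [DecidableEq l]

theorem T_braid_pow {R : Type} [CommRing R] {e f : l ⊕ l → R} (h : om e f = 1) :
    (T e 1 * T f 1 * T e 1) ^ 4 = 1 := by
  have h' : om f e = -1 := by rw [om_swap, h]
  have h1 : ∀ x, ac (T e 1 * T f 1 * T e 1) x =
      x + ((om e x + om f x) • e + (om f x - om e x) • f) := fun x => by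
    simp only [ac_mul, ac_T, om_add_right, om_smul_right, om_self, h, h']
    module
  have h2 : ∀ x, om e (ac (T e 1 * T f 1 * T e 1) x) = om f x := fun x => by
    rw [h1]; simp only [om_add_right, om_smul_right, om_self, h]; ring
  have h3 : ∀ x, om f (ac (T e 1 * T f 1 * T e 1) x) = -om e x := fun x => by
    rw [h1]; simp only [om_add_right, om_smul_right, om_self, h']; ring
  generalize T e 1 * T f 1 * T e 1 = B at h1 h2 h3
  refine sp_ext fun x => ?_
  have e2 := h1 (ac B x)
  have e3 := h1 (ac B (ac B x))
  have e4 := h1 (ac B (ac B (ac B x)))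
  simp only [h2, h3, neg_neg] at e2 e3 e4
  rw [pow_succ, pow_succ, pow_succ, pow_one, ac_one, ac_mul, ac_mul, ac_mul, e4, e3, e2, h1]
  module

theorem wU_braid_pow {e f : l ⊕ l → ZMod 4} (h : om e f = 1) :
    (wU e * wU f * wU e) ^ 4 = (4 : ZMod 5) • 1 := by
  have hc : W f * W e = (4 : ZMod 5) • (W e * W f) := by
    rw [W_comm, om_swap, h]; rfl
  have h0 : W e * (W e * W f) = W f := by rw [← mul_assoc, W_sq, one_mul]
  have h2 : wU e * wU f * wU e = W e + W f := by
    have : wU e * wU f * wU e = (10 : ZMod 5) • 1 + (6 : ZMod 5) • W e +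
        (111 : ZMod 5) • W f + (45 : ZMod 5) • (W e * W f) := by
      simp only [wU, add_mul, mul_add, one_mul, mul_one, smul_mul_assoc, mul_smul_comm, mul_assoc,
        W_sq, h0, hc]
      module
    rw [this, show (10 : ZMod 5) = 0 by decide, show (6 : ZMod 5) = 1 by decide,
      show (111 : ZMod 5) = 1 by decide, show (45 : ZMod 5) = 0 by decide]
    module
  have h3 : (W e + W f) * (W e + W f) = (2 : ZMod 5) • 1 := by
    have : (W e + W f) * (W e + W f) = (2 : ZMod 5) • 1 + (5 : ZMod 5) • (W e * W f) := by
      simp only [add_mul, mul_add, W_sq, hc]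
      module
    rw [this, show (5 : ZMod 5) = 0 by decide, zero_smul, add_zero]
  rw [h2, show 4 = 2 * 2 from rfl, pow_mul, pow_two, pow_two, h3, smul_mul_smul_comm, one_mul]
  rfl

/-- Pairs of a symplectic matrix over `ℤ/4` and an operator implementing it on the Schrödinger
representation. -/
def weilGroup (l : Type) [Fintype l] [DecidableEq l] :
    Subgroup ((Module.End (ZMod 5) (Fun l))ˣ × symplecticGroup l (ZMod 4)) where
  carrier := {x | ∀ u, (x.1 : Module.End (ZMod 5) (Fun l)) * W u = W (ac x.2 u) * x.1}
  one_mem' u := by simp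
  mul_mem' {x y} hx hy u := by
    change (x.1 : Module.End (ZMod 5) (Fun l)) * y.1 * W u = W (ac (x.2 * y.2) u) * (x.1 * y.1)
    rw [mul_assoc, hy, ← mul_assoc, hx, mul_assoc, ac_mul]
  inv_mem' {x} hx u := by
    change ((x.1⁻¹ : (Module.End (ZMod 5) (Fun l))ˣ) : Module.End (ZMod 5) (Fun l)) * W u
      = W (ac x.2⁻¹ u) * (x.1⁻¹ : (Module.End (ZMod 5) (Fun l))ˣ)
    rw [Units.inv_mul_eq_iff_eq_mul, ← mul_assoc, hx, ac_ac_inv, mul_assoc, Units.mul_inv, mul_one]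

/-- The operator `wU v` as a unit. -/
def wUnit (v : l ⊕ l → ZMod 4) : (Module.End (ZMod 5) (Fun l))ˣ where
  val := wU v
  inv := wU v * W v
  val_inv := by rw [← mul_assoc, wU_sq, W_sq]
  inv_val := by rw [← wU_sq, mul_assoc, mul_assoc, wU_sq, ← mul_assoc, wU_sq, W_sq]

theorem wUnit_mem (v : l ⊕ l → ZMod 4) : (wUnit v, T v 1) ∈ weilGroup l := wU_mul_W v

theorem isLocalRing_zmod_four : IsLocalRing (ZMod 4) := isLocalRing_zmod (k := 1) Nat.prime_two

/-- The projection of the Weil group onto the symplectic group. -/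
def weilProj (l : Type) [Fintype l] [DecidableEq l] : weilGroup l →* symplecticGroup l (ZMod 4) :=
  (MonoidHom.snd _ _).comp (weilGroup l).subtype

theorem weilProj_surjective : Function.Surjective (weilProj l) := by
  have := isLocalRing_zmod_four
  rw [← MonoidHom.range_eq_top, ← top_le_iff, ← Gn_univ, Gn, closure_le]
  rintro _ ⟨v, t, -, -, rfl⟩
  refine ⟨⟨_, wUnit_mem v⟩ ^ t.val, ?_⟩
  rw [map_pow]
  change T v 1 ^ t.val = _
  rw [T_pow, mul_one, ZMod.natCast_zmod_val]

theorem exists_eq_smul_of_mem_weilGroup {v : l ⊕ l → ZMod 4} {x : weilGroup l}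
    (hx : weilProj l x = T v 1) : ∃ c : ZMod 5, (x.1.1 : Module.End (ZMod 5) (Fun l)) = c • wU v := by
  let y : weilGroup l := x * ⟨_, wUnit_mem v⟩⁻¹
  have hy : y.1.2 = 1 := by
    change weilProj l x * (T v 1)⁻¹ = 1
    rw [hx, mul_inv_cancel]
  have hW : ∀ u, (y.1.1 : Module.End (ZMod 5) (Fun l)) * W u =
      W u * (y.1.1 : Module.End (ZMod 5) (Fun l)) := fun u => by
    rw [y.2 u, hy, ac_one]
  obtain ⟨c, hc⟩ := exists_eq_smul_of_commute hW
  refine ⟨c, ?_⟩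
  have : x = y * ⟨_, wUnit_mem v⟩ := (inv_mul_cancel_right x _).symm
  rw [this]
  change (y.1.1 : Module.End (ZMod 5) (Fun l)) * wU v = _
  rw [hc, smul_mul_assoc, one_mul]

theorem weilProj_ker_le_center : (weilProj l).ker ≤ center (weilGroup l) := by
  intro x hx
  have hW : ∀ u, (x.1.1 : Module.End (ZMod 5) (Fun l)) * W u =
      W u * (x.1.1 : Module.End (ZMod 5) (Fun l)) := fun u => by
    rw [x.2 u, show x.1.2 = 1 from hx, ac_one]
  obtain ⟨c, hc⟩ := exists_eq_smul_of_commute hW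
  refine mem_center_iff.2 fun y => Subtype.ext (Prod.ext (Units.ext ?_) ?_)
  · change (y.1.1 : Module.End (ZMod 5) (Fun l)) * x.1.1 = x.1.1 * y.1.1
    rw [hc, smul_mul_assoc, mul_smul_comm, one_mul, mul_one]
  · change y.1.2 * x.1.2 = x.1.2 * y.1.2
    rw [show x.1.2 = 1 from hx, mul_one, one_mul]

theorem not_exists_lift_weil {G : Type} [Group G] (s : G →* weilGroup l) {a b : G}
    {e f : l ⊕ l → ZMod 4} (h : om e f = 1) (ha : weilProj l (s a) = T e 1)
    (hb : weilProj l (s b) = T f 1) (hab : (a * b * a) ^ 4 = 1) : False := by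
  obtain ⟨c, hc⟩ := exists_eq_smul_of_mem_weilGroup ha
  obtain ⟨d, hd⟩ := exists_eq_smul_of_mem_weilGroup hb
  have h1 : (((s a).1.1 * (s b).1.1 * (s a).1.1 : Module.End (ZMod 5) (Fun l))) ^ 4 = 1 := by
    have := congrArg s hab
    rw [map_pow, map_mul s, map_mul s, map_one] at this
    exact congrArg (fun x => (x.1.1 : Module.End (ZMod 5) (Fun l))) this
  rw [hc, hd, smul_mul_smul_comm, smul_mul_smul_comm, smul_pow, wU_braid_pow h, smul_smul] at h1
  have h2 := congrFun (LinearMap.congr_fun h1 (fun _ => 1)) 0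
  have h3 : ∀ c d : ZMod 5, (c * d * c) ^ 4 * 4 * 1 ≠ (1 : ZMod 5) := by decide
  exact h3 c d h2

/-- Lifting along central extensions for perfect groups with trivial second homology. -/
theorem exists_lift_of_H2_trivial {G Q E : Type} [Group G] [Group Q] [Group E]
    (hG : commutator G = ⊤) (hH : ∀ x : H2 G, x = 0) {π : E →* Q} (hπ : Function.Surjective π)
    (hc : π.ker ≤ center E) (f : G →* Q) : ∃ s : G →* E, ∀ g, π (s g) = f g := by
  let P : Subgroup (E × G) := (π.comp (MonoidHom.fst E G)).eqLocus (f.comp (MonoidHom.snd E G))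
  let ρ : P →* G := (MonoidHom.snd E G).comp P.subtype
  have hρ : Function.Surjective ρ := fun g => by
    obtain ⟨x, hx⟩ := hπ (f g)
    exact ⟨⟨(x, g), hx⟩, rfl⟩
  have hk : ρ.ker ≤ center P := fun x hx => by
    have h1 : x.1.2 = 1 := hx
    have h2 : x.1.1 ∈ π.ker := by
      have h3 : π x.1.1 = f x.1.2 := x.2
      rw [MonoidHom.mem_ker, h3, h1, map_one]
    refine mem_center_iff.2 fun y => Subtype.ext (Prod.ext (mem_center_iff.1 (hc h2) y.1.1) ?_)
    change y.1.2 * x.1.2 = x.1.2 * y.1.2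
    rw [h1, mul_one, one_mul]
  obtain ⟨s, hs⟩ := exists_section hG hH hρ hk
  refine ⟨(MonoidHom.fst E G).comp (P.subtype.comp s), fun g => ?_⟩
  have h3 : π (s g).1.1 = f (s g).1.2 := (s g).2
  exact h3.trans (congrArg f (hs g))

theorem SpMap_T {g : ℕ} {R S : Type} [CommRing R] [CommRing S] (φ : R →+* S)
    (v : Fin g ⊕ Fin g → R) (t : R) : SpAux.SpMap φ g (T v t) = T (fun i => φ (v i)) (φ t) := by
  have val : ∀ {S : Type} [CommRing S] (v : Fin g ⊕ Fin g → S) (t : S) (i j : Fin g ⊕ Fin g),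
      (T v t).1 i j = (Pi.single j 1 : Fin g ⊕ Fin g → S) i + t * om v (Pi.single j 1) * v i :=
    fun v t i j => by
      have := congrFun (ac_T v t (Pi.single j 1)) i
      rw [ac_def, mulVec_single_one] at this
      exact this
  have hs : ∀ i j : Fin g ⊕ Fin g, φ ((Pi.single j 1 : Fin g ⊕ Fin g → R) i) =
      (Pi.single j 1 : Fin g ⊕ Fin g → S) i := fun i j => by
    simp only [Pi.single_apply]
    split_ifs
    · exact map_one _
    · exact map_zero _
  refine Subtype.ext (Matrix.ext fun i j => ?_)
  change φ ((T v t).1 i j) = _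
  rw [val, val, map_add, map_mul φ, map_mul φ, om, om, map_sum, hs]
  simp only [map_sub, map_mul φ, hs]

theorem exists_H2_ne_zero {g D : ℕ} (hg : 4 ≤ g) (h4 : 4 ∣ D) (hD : 1 ≤ D) :
    ∃ x : H2 (Sp g (ZMod D)), x ≠ 0 := by
  by_contra! hH
  obtain ⟨s, hs⟩ := exists_lift_of_H2_trivial (centBound_zmod hg hD).2 hH
    (weilProj_surjective (l := Fin g)) weilProj_ker_le_center
    (SpAux.SpMap (ZMod.castHom h4 (ZMod 4)) g)
  let k : Fin g := ⟨0, by omega⟩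
  have hom : ∀ R : Type, ∀ [CommRing R], om (ve R k) (vf R k) = 1 := by intros; simp
  refine not_exists_lift_weil s (hom (ZMod 4)) (a := T (ve _ k) 1) (b := T (vf _ k) 1) ?_ ?_
    (T_braid_pow (hom _))
  · rw [hs, SpMap_T, map_one]
    congr 1
    funext i
    simp only [ve, Pi.single_apply]
    split_ifs
    · exact map_one _
    · exact map_zero _
  · rw [hs, SpMap_T, map_one]
    congr 1
    funext i
    simp only [vf, Pi.single_apply]
    split_ifs
    · exact map_one _
    · exact map_zero _

end LowerBound

end SpH2

open GpH2 SpAux in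
/-- **Theorem (Statement 0).** For `g ≥ 4` and `D ≥ 1`, the second integral homology of
`Sp(2g, ℤ/Dℤ)` is `ℤ/2ℤ` if `4 ∣ D`, and trivial otherwise. -/
theorem H2_symplectic_zmod (g D : ℕ) (hg : 4 ≤ g) (hD : 1 ≤ D) :
    (D % 4 = 0 → Nonempty (H2 ↥(Sp g (ZMod D)) ≃+ ZMod 2)) ∧
    (D % 4 ≠ 0 → ∀ x : H2 ↥(Sp g (ZMod D)), x = 0) := by
  have : NeZero D := ⟨by omega⟩
  have hcard := (SpH2.centBound_zmod hg hD).1.card_H2_dvd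
  constructor
  · intro h
    have h4 : 4 ∣ D := Nat.dvd_of_mod_eq_zero h
    rw [if_pos h4] at hcard
    obtain ⟨x, hx⟩ := SpH2.exists_H2_ne_zero hg h4 hD
    have h2 : Nat.card (H2 ↥(Sp g (ZMod D))) = 2 := by
      refine ((Nat.dvd_prime Nat.prime_two).1 hcard).resolve_left fun h1 => hx ?_
      have := (Nat.card_eq_one_iff_unique.1 h1).1
      exact Subsingleton.elim _ _
    have : Fact (Nat.Prime 2) := ⟨Nat.prime_two⟩
    have hc : IsAddCyclic (H2 ↥(Sp g (ZMod D))) := isAddCyclic_of_prime_card h2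
    exact ⟨addEquivOfAddCyclicCardEq (by rw [h2, Nat.card_zmod])⟩
  · intro h x
    rw [if_neg fun h4 => h (Nat.mod_eq_zero_of_dvd h4), Nat.dvd_one] at hcard
    have := (Nat.card_eq_one_iff_unique.1 hcard).1
    exact Subsingleton.elim _ _
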